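/- arXiv:2003.04280 — 2 statements merged into one kernel-verified Lean document; each statement's English description precedes it below -/
import Mathlib

section
/- There exist a constant C > 0 and a function A : {0,1}* × {0,1}* → {0,1} such that for every integer n ≥ 2 and every finite simple graph G with exactly n vertices whose vertex set is a subset of ℤ × ℤ and each of whose edges joins two distinct points (x₁, y₁) and (x₂, y₂) with |x₁ − x₂| ≤ 1 and |y₁ − y₂| ≤ 1, there exists an injective labelling ℓ : V(G) → {0,1}* with |ℓ(v)| ≤ log₂ n + C·√(log₂ n · log₂(log₂ n + 2)) for every vertex v, and such that for all distinct vertices v, w of G, A(ℓ(v), ℓ(w)) = 1 if and only if vw ∈ E(G). -/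
attribute [local instance] Classical.propDecidable

lemma gal_pow_bound (N d q : ℕ) (hN : 0 < N) (h : q * d ≤ N) : (N + d) ^ q ≤ 3 * N ^ q := by
  have hN' : (0:ℝ) < N := by exact_mod_cast hN
  have h1 : ((1:ℝ) + d / N) ^ q ≤ 3 := by
    have h2 : (1:ℝ) + d / N ≤ Real.exp (d / N) := by
      have := Real.add_one_le_exp ((d:ℝ) / N); linarith
    calc ((1:ℝ) + d / N) ^ q ≤ (Real.exp (d / N)) ^ q := by
          apply pow_le_pow_left₀ (by positivity) h2
      _ = Real.exp (q * (d / N)) := by rw [← Real.exp_nat_mul]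
      _ ≤ Real.exp 1 := by
          apply Real.exp_le_exp.mpr
          rw [← mul_div_assoc, div_le_one hN']
          exact_mod_cast h
      _ ≤ 3 := by have := Real.exp_one_lt_d9; linarith
  have h3 : ((N:ℝ) + d) ^ q = N ^ q * (1 + d / N) ^ q := by
    rw [← mul_pow]; congr 1; field_simp
  have : ((N:ℝ) + d) ^ q ≤ 3 * N ^ q := by
    rw [h3]; have : (0:ℝ) < N ^ q := by positivity
    nlinarith
  exact_mod_cast this

lemma gal_sample {ι : Type} (E : Finset ι) (X : Finset ℤ) (N : ℕ) (hN : 0 < N)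
    (Q : ι → Finset ℤ) (S2 S0 : ι → Finset ℕ)
    (hS2 : ∀ e, S2 e ⊆ Finset.range N) (hS0 : ∀ e, S0 e ⊆ Finset.range N)
    (hdis : ∀ e, Disjoint (S2 e) (S0 e)) (hQ : ∀ e, Q e ⊆ X)
    (hcard : ∀ e, (Q e).card * ((S2 e).card - (S0 e).card) ≤ N) :
    ∃ ω : ℤ → ℕ, (∀ x, ω x < N) ∧ ∀ e ∈ E, (∀ x ∈ Q e, ω x ∉ S0 e) →
      2 ^ ((Q e).filter (fun x => ω x ∈ S2 e)).card ≤ 3 * E.card := by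
  classical
  let g : ι → ℕ → ℕ := fun e a => if a ∈ S2 e then 2 else if a ∈ S0 e then 0 else 1
  let h : ι → {x // x ∈ X} → ℕ → ℕ := fun e x a => if x.1 ∈ Q e then g e a else 1
  let Ω := Fintype.piFinset (fun _ : {x // x ∈ X} => Finset.range N)
  have hg : ∀ e, ∑ a ∈ Finset.range N, g e a ≤ N + ((S2 e).card - (S0 e).card) := by
    intro e
    have h1 : ∑ a ∈ Finset.range N, (g e a + if a ∈ S0 e then 1 else 0) =
        ∑ a ∈ Finset.range N, (1 + if a ∈ S2 e then 1 else 0) := by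
      apply Finset.sum_congr rfl
      intro a _
      have : a ∈ S2 e → a ∉ S0 e := fun h2 h0 => (Finset.disjoint_left.mp (hdis e)) h2 h0
      simp only [g]
      by_cases h2 : a ∈ S2 e <;> by_cases h0 : a ∈ S0 e <;> simp_all
    rw [Finset.sum_add_distrib, Finset.sum_add_distrib, Finset.sum_ite_mem, Finset.sum_ite_mem,
      Finset.inter_eq_right.mpr (hS2 e), Finset.inter_eq_right.mpr (hS0 e)] at h1
    simp at h1
    omega
  have key : ∀ e, ∑ f ∈ Ω, ∏ x, h e x (f x) ≤ 3 * Ω.card := by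
    intro e
    rw [Finset.sum_prod_piFinset]
    have h1 : ∀ x : {x // x ∈ X}, ∑ a ∈ Finset.range N, h e x a ≤
        if x.1 ∈ Q e then N + ((S2 e).card - (S0 e).card) else N := by
      intro x
      by_cases hx : x.1 ∈ Q e
      · simpa [h, hx] using hg e
      · simp [h, hx]
    refine (Finset.prod_le_prod (fun _ _ => Nat.zero_le _) (fun x _ => h1 x)).trans ?_
    have e1 : (∏ x : {x // x ∈ X}, if x.1 ∈ Q e then N + ((S2 e).card - (S0 e).card) else N)
       = ∏ x ∈ X, if x ∈ Q e then N + ((S2 e).card - (S0 e).card) else N := by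
      rw [← Finset.prod_attach X]; rfl
    rw [e1, Finset.prod_ite]
    simp only [Finset.prod_const]
    have e2 : X.filter (fun x => x ∈ Q e) = Q e := by
      ext x; simp; exact fun hx => hQ e hx
    have e3 : Ω.card = N ^ X.card := by simp [Ω]
    have e4 : (Q e).card + (X.filter (fun x => x ∉ Q e)).card = X.card := by
      have := Finset.card_filter_add_card_filter_not (s := X) (fun x => x ∈ Q e)
      rw [e2] at this; exact this
    rw [e3, e2, ← e4, pow_add, ← mul_assoc]
    exact Nat.mul_le_mul_right _ (gal_pow_bound N _ _ hN (hcard e))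
  have tot : ∑ f ∈ Ω, ∑ e ∈ E, ∏ x, h e x (f x) ≤ ∑ f ∈ Ω, 3 * E.card := by
    rw [Finset.sum_comm]
    refine (Finset.sum_le_sum (fun e _ => key e)).trans ?_
    simp; apply le_of_eq; ring
  have hne : Ω.Nonempty := ⟨fun _ => 0, by simp [Ω, hN]⟩
  obtain ⟨f, hf, hfle⟩ := Finset.exists_le_of_sum_le hne tot
  refine ⟨fun x => if hx : x ∈ X then f ⟨x, hx⟩ else 0, ?_, ?_⟩
  · intro x
    by_cases hx : x ∈ X
    · simp only [hx, dif_pos]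
      have := (Fintype.mem_piFinset.mp hf) ⟨x, hx⟩
      simpa using this
    · simp [hx, hN]
  · intro e he hav
    refine le_trans ?_ ((Finset.single_le_sum (f := fun e => ∏ x, h e x (f x)) (fun _ _ => Nat.zero_le _) he).trans hfle)
    have e1 : ∏ x, h e x (f x) = ∏ x ∈ X, (if x ∈ Q e then g e (if hx : x ∈ X then f ⟨x, hx⟩ else 0) else 1) := by
      rw [← Finset.prod_attach X]
      apply Finset.prod_congr rfl
      intro x _
      simp [h]
    rw [e1, Finset.prod_ite_mem, Finset.inter_eq_right.mpr (hQ e), Finset.card_filter, ← Finset.prod_pow_eq_pow_sum]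
    apply Finset.prod_le_prod' 
    intro x hx
    have := hav x hx
    simp only [g]
    by_cases h2 : (if hx : x ∈ X then f ⟨x, hx⟩ else 0) ∈ S2 e
    · simp [h2]
    · simp [h2, this]

lemma gal_levels (b t : ℕ) (hb : 1 ≤ b) (X : Finset ℤ) (F : Finset (Finset ℤ))
    (hF : ∀ Q ∈ F, Q ⊆ X) (hX : X.card ≤ (2 ^ b) ^ t) :
    ∃ lev col : ℤ → ℕ, (∀ x, lev x ≤ t) ∧ (∀ x, col x < 2 ^ b) ∧
      (∀ Q ∈ F, ∀ i c, i ≤ t → c < 2 ^ b → (∀ x ∈ Q, lev x ≤ i) →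
        2 ^ (Q.filter (fun x => lev x = i ∧ col x = c)).card
          ≤ 3 * (F.card * ((t + 1) * (2 ^ b + 1)))) ∧
      (∀ Q ∈ F, ∀ T ≤ t, Q.card ≤ (2 ^ b) ^ T →
        2 ^ (Q.filter (fun x => T ≤ lev x)).card
          ≤ 3 * (F.card * ((t + 1) * (2 ^ b + 1)))) := by
  classical
  obtain ⟨B, hB⟩ : ∃ B, B = 2 ^ b := ⟨_, rfl⟩
  have hB2 : 1 < B := by rw [hB]; exact Nat.one_lt_two_pow (by omega)
  rw [← hB] at hX ⊢
  let lev0 : ℕ → ℕ := fun a => t - Nat.log B a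
  let col0 : ℕ → ℕ := fun a => a / B ^ (Nat.log B a)
  let N := B ^ (t + 1)
  have hN : 0 < N := by positivity
  let E : Finset (Finset ℤ × ℕ × ℕ) := F ×ˢ (Finset.range (t + 1) ×ˢ Finset.range (B + 1))
  let Q' : Finset ℤ × ℕ × ℕ → Finset ℤ := fun e =>
    if e.1 ∈ F ∧ e.2.1 ≤ t ∧ (e.2.2 = B → e.1.card ≤ B ^ e.2.1) then e.1 else ∅
  let S2 : Finset ℤ × ℕ × ℕ → Finset ℕ := fun e =>
    (Finset.range N).filter (fun a => if e.2.2 = B then e.2.1 ≤ lev0 a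
      else (lev0 a = e.2.1 ∧ col0 a = e.2.2))
  let S0 : Finset ℤ × ℕ × ℕ → Finset ℕ := fun e =>
    (Finset.range N).filter (fun a => e.2.2 ≠ B ∧ e.2.1 + 1 ≤ lev0 a)
  have hEc : E.card = F.card * ((t + 1) * (B + 1)) := by simp [E]
  obtain ⟨ω, hω, hω2⟩ := gal_sample E X N hN Q' S2 S0 (fun e => Finset.filter_subset _ _)
    (fun e => Finset.filter_subset _ _) (by
      intro e
      rw [Finset.disjoint_left]
      intro a ha hb
      simp only [S2, S0, Finset.mem_filter] at ha hb
      obtain ⟨_, ha⟩ := ha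
      obtain ⟨_, hb1, hb2⟩ := hb
      rw [if_neg hb1] at ha
      omega) (by
      intro e
      simp only [Q']
      split_ifs with h
      · exact hF _ h.1
      · simp) (by
      rintro ⟨Q, i, c⟩
      simp only [Q']
      split_ifs with h
      swap
      · simp
      obtain ⟨hQF, hi, hc⟩ := h
      by_cases hcB : c = B
      · have h1 : (S2 (Q, i, c)).card ≤ B ^ (t + 1 - i) := by
          rw [← Finset.card_range (B ^ (t + 1 - i))]
          apply Finset.card_le_card
          intro a ha
          simp only [S2, Finset.mem_filter, hcB, if_true, lev0] at ha
          rw [Finset.mem_range]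
          have h2 := Nat.lt_pow_succ_log_self hB2 a
          by_cases ha0 : i = 0
          · subst ha0; simpa using ha.1
          refine lt_of_lt_of_le h2 (Nat.pow_le_pow_right (by omega) (by omega))
        calc Q.card * _ ≤ B ^ i * B ^ (t + 1 - i) :=
              Nat.mul_le_mul (hc hcB) ((Nat.sub_le _ _).trans h1)
          _ = N := by rw [← pow_add]; congr 1; omega
      · have h1 : (S2 (Q, i, c)).card ≤ B ^ (t - i) := by
          have : B ^ (t - i) = (Finset.Ico (c * B ^ (t - i)) ((c + 1) * B ^ (t - i))).card := by
            rw [Nat.card_Ico, ← Nat.sub_mul]; simp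
          rw [this]
          apply Finset.card_le_card
          intro a ha
          simp only [S2, Finset.mem_filter, hcB, if_false, lev0, col0, Finset.mem_range] at ha
          obtain ⟨haN, hl, hcol⟩ := ha
          have h3 : Nat.log B a < t + 1 := Nat.log_lt_of_lt_pow' (by omega) haN
          have h4 : Nat.log B a = t - i := by omega
          rw [h4] at hcol
          rw [Finset.mem_Ico, ← hcol]
          constructor
          · exact Nat.div_mul_le_self _ _
          · have := Nat.lt_mul_div_succ a (b := B ^ (t - i)) (by positivity)
            rw [mul_comm]; exact this
        by_cases hit : i = t
        · subst hit
          simp only [Nat.sub_self, pow_zero] at h1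
          have : Q.card ≤ B ^ i := (Finset.card_le_card (hF _ hQF)).trans hX
          calc Q.card * _ ≤ B ^ i * 1 := Nat.mul_le_mul this ((Nat.sub_le _ _).trans h1)
            _ ≤ N := by rw [mul_one]; exact Nat.pow_le_pow_right (by omega) (by omega)
        · have h2 : B ^ (t - i) ≤ (S0 (Q, i, c)).card := by
            rw [← Finset.card_range (B ^ (t - i))]
            apply Finset.card_le_card
            intro a ha
            rw [Finset.mem_range] at ha
            simp only [S0, Finset.mem_filter, lev0, Finset.mem_range]
            refine ⟨lt_of_lt_of_le ha (Nat.pow_le_pow_right (by omega) (by omega)), hcB, ?_⟩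
            have : Nat.log B a < t - i := Nat.log_lt_of_lt_pow' (by omega) ha
            omega
          rw [Nat.sub_eq_zero_of_le (h1.trans h2)]; simp)
  rw [hEc] at hω2
  refine ⟨fun x => lev0 (ω x), fun x => col0 (ω x), fun x => Nat.sub_le _ _, ?_, ?_, ?_⟩
  · intro x
    rw [Nat.div_lt_iff_lt_mul (by positivity)]
    have := Nat.lt_pow_succ_log_self hB2 (ω x)
    rwa [pow_succ, mul_comm] at this
  · intro Q hQ i c hi hc hlev
    have hQ' : Q' (Q, i, c) = Q := by
      simp only [Q']; rw [if_pos]; exact ⟨hQ, hi, fun h => absurd h (by show c ≠ B; omega)⟩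
    have := hω2 (Q, i, c) (by simp [E, hQ]; omega)
    rw [hQ'] at this
    refine le_trans (le_of_eq ?_) (this ?_)
    · congr 2
      apply Finset.filter_congr
      intro x _
      simp only [S2, Finset.mem_filter, Finset.mem_range, hω x, true_and, if_neg (show c ≠ B by omega)]
    · intro x hx h0
      simp only [S0, Finset.mem_filter] at h0
      have h5 : lev0 (ω x) ≤ i := hlev x hx
      omega
  · intro Q hQ T hT hcard
    have hQ' : Q' (Q, T, B) = Q := by
      simp only [Q']; rw [if_pos]; exact ⟨hQ, hT, fun h => hcard⟩
    have := hω2 (Q, T, B) (by simp [E, hQ]; omega)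
    rw [hQ'] at this
    refine le_trans (le_of_eq ?_) (this ?_)
    · congr 2
      apply Finset.filter_congr
      intro x _
      simp only [S2, Finset.mem_filter, Finset.mem_range, hω x, true_and, if_true]
    · intro x hx h0
      simp only [S0, Finset.mem_filter] at h0
      simp at h0

/-- Projection to the first coordinate of the points of `s` in a box. -/
noncomputable def gbox (s : Finset (ℤ × ℤ)) (PX PY : ℤ → Prop) : Finset ℤ :=
  (s.filter (fun p => PX p.1 ∧ PY p.2)).image Prod.fst

lemma mem_gbox (s : Finset (ℤ × ℤ)) (PX PY : ℤ → Prop) (x : ℤ) :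
    x ∈ gbox s PX PY ↔ ∃ y, (x, y) ∈ s ∧ PX x ∧ PY y := by
  unfold gbox
  rw [Finset.mem_image]
  constructor
  · rintro ⟨⟨a, y⟩, hp, rfl⟩
    exact ⟨y, Finset.mem_filter.mp hp⟩
  · rintro ⟨y, h⟩
    exact ⟨(x, y), Finset.mem_filter.mpr h, rfl⟩

/-- Order-convex predicates on the integers. -/
def GConv (P : ℤ → Prop) : Prop := ∀ a b c, a ≤ b → b ≤ c → P a → P c → P b

lemma gal_boxes (s : Finset (ℤ × ℤ)) : ∃ F : Finset (Finset ℤ), F.card ≤ s.card ^ 4 ∧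
    (∀ Q ∈ F, Q ⊆ s.image Prod.fst) ∧
    ∀ PX PY, GConv PX → GConv PY → (gbox s PX PY).Nonempty → gbox s PX PY ∈ F := by
  refine ⟨(s ×ˢ (s ×ˢ (s ×ˢ s))).image (fun q => gbox s (fun x => q.1.1 ≤ x ∧ x ≤ q.2.1.1)
    (fun y => q.2.2.1.2 ≤ y ∧ y ≤ q.2.2.2.2)), ?_, ?_, ?_⟩
  · refine Finset.card_image_le.trans (le_of_eq ?_)
    simp only [Finset.card_product]; ring
  · intro Q hQ
    rw [Finset.mem_image] at hQ
    obtain ⟨q, _, rfl⟩ := hQ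
    intro x hx
    rw [mem_gbox] at hx
    obtain ⟨y, hy, _⟩ := hx
    exact Finset.mem_image_of_mem Prod.fst hy
  · intro PX PY hX hY hne
    have hne' : (s.filter (fun p => PX p.1 ∧ PY p.2)).Nonempty := by
      simpa [gbox] using hne
    obtain ⟨p1, h1, h1'⟩ := Finset.exists_min_image _ Prod.fst hne'
    obtain ⟨p2, h2, h2'⟩ := Finset.exists_max_image _ Prod.fst hne'
    obtain ⟨p3, h3, h3'⟩ := Finset.exists_min_image _ Prod.snd hne'
    obtain ⟨p4, h4, h4'⟩ := Finset.exists_max_image _ Prod.snd hne'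
    rw [Finset.mem_image]
    rw [Finset.mem_filter] at h1 h2 h3 h4
    refine ⟨(p1, p2, p3, p4), by simp [h1.1, h2.1, h3.1, h4.1], ?_⟩
    ext x
    rw [mem_gbox, mem_gbox]
    constructor
    · rintro ⟨y, hs, ⟨a, b⟩, c, d⟩
      exact ⟨y, hs, hX _ _ _ a b h1.2.1 h2.2.1, hY _ _ _ c d h3.2.2 h4.2.2⟩
    · rintro ⟨y, hs, h⟩
      have hp' : (x, y) ∈ s.filter (fun p => PX p.1 ∧ PY p.2) := Finset.mem_filter.mpr ⟨hs, h⟩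
      exact ⟨y, hs, ⟨h1' _ hp', h2' _ hp'⟩, h3' _ hp', h4' _ hp'⟩

lemma gal_levels' (s : Finset (ℤ × ℤ)) (b t L : ℕ) (hb : 1 ≤ b) (hs : s.card ≤ (2 ^ b) ^ t)
    (hL : 3 * (s.card ^ 4 * ((t + 1) * (2 ^ b + 1))) ≤ 2 ^ L) :
    ∃ lev col : ℤ → ℕ, (∀ x, lev x ≤ t) ∧ (∀ x, col x < 2 ^ b) ∧
      (∀ PX PY, GConv PX → GConv PY → ∀ i c, i ≤ t → c < 2 ^ b →
        (∀ x ∈ gbox s PX PY, lev x ≤ i) →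
        ((gbox s PX PY).filter (fun x => lev x = i ∧ col x = c)).card ≤ L) ∧
      (∀ PX PY, GConv PX → GConv PY → ∀ T ≤ t, (gbox s PX PY).card ≤ (2 ^ b) ^ T →
        ((gbox s PX PY).filter (fun x => T ≤ lev x)).card ≤ L) := by
  obtain ⟨F, hF1, hF2, hF3⟩ := gal_boxes s
  obtain ⟨lev, col, h1, h2, h3, h4⟩ := gal_levels b t hb (s.image Prod.fst) F hF2
    (Finset.card_image_le.trans hs)
  have hb' : 3 * (F.card * ((t + 1) * (2 ^ b + 1))) ≤ 2 ^ L :=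
    le_trans (Nat.mul_le_mul_left _ (Nat.mul_le_mul_right _ hF1)) hL
  refine ⟨lev, col, h1, h2, ?_, ?_⟩
  · intro PX PY hX hY i c hi hc hlev
    by_cases hne : (gbox s PX PY).Nonempty
    · exact (Nat.pow_le_pow_iff_right (by norm_num : 1 < 2)).mp
        ((h3 _ (hF3 PX PY hX hY hne) i c hi hc hlev).trans hb')
    · rw [Finset.not_nonempty_iff_eq_empty] at hne
      rw [hne]; simp
  · intro PX PY hX hY T hT hc
    by_cases hne : (gbox s PX PY).Nonempty
    · exact (Nat.pow_le_pow_iff_right (by norm_num : 1 < 2)).mp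
        ((h4 _ (hF3 PX PY hX hY hne) T hT hc).trans hb')
    · rw [Finset.not_nonempty_iff_eq_empty] at hne
      rw [hne]; simp

/-- The centre of the level-`j` window of row `y`. -/
def gctr (K j : ℕ) (y : ℤ) : ℤ := j + K * ((y - j) / K)

lemma gctr_le (K j : ℕ) (hK : 0 < K) (y : ℤ) : gctr K j y ≤ y := by
  have := Int.mul_ediv_self_le (x := y - j) (k := K) (by omega)
  unfold gctr; omega

lemma gctr_lt (K j : ℕ) (hK : 0 < K) (y : ℤ) : y < gctr K j y + K := by
  have := Int.lt_mul_ediv_self_add (x := y - j) (k := K) (by omega)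
  unfold gctr; omega

lemma gctr_dvd (K j : ℕ) (hK : 0 < K) (y : ℤ) (h : gctr K j y ≠ gctr K j (y + 1)) :
    (K : ℤ) ∣ y + 1 - j := by
  by_contra hd
  apply h
  unfold gctr
  have hK' : (0 : ℤ) < K := by omega
  have : (y + 1 - j) / (K : ℤ) = (y - j) / K := by
    have e : y + 1 - (j : ℤ) = (y - j) + 1 := by ring
    rw [e] at hd ⊢
    apply le_antisymm
    · rw [← Int.lt_add_one_iff, Int.ediv_lt_iff_lt_mul hK']
      have h1 := Int.lt_mul_ediv_self_add (x := y - j) (k := K) hK'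
      rcases eq_or_ne (y - (j : ℤ) + 1) (((y - j) / K + 1) * K) with h2 | h2
      · exact absurd ⟨_, h2.trans (mul_comm _ _)⟩ hd
      · have : ((y - (j:ℤ)) / K + 1) * K = K * ((y - j) / K) + K := by ring
        omega
    · exact Int.ediv_le_ediv hK' (by omega)
  rw [this]

lemma gctr_unique (K j j' : ℕ) (hj : j < K) (hj' : j' < K) (y y' : ℤ) (hy : |y - y'| ≤ 1)
    (h : gctr K j y ≠ gctr K j y') (h' : gctr K j' y ≠ gctr K j' y') : j = j' := by
  have main : ∀ z : ℤ, gctr K j z ≠ gctr K j (z + 1) → gctr K j' z ≠ gctr K j' (z + 1) →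
      j = j' := by
    intro z h h'
    have h1 := gctr_dvd K j (by omega) z h
    have h2 := gctr_dvd K j' (by omega) z h'
    have h3 := dvd_sub h1 h2
    have e : z + 1 - (j : ℤ) - (z + 1 - j') = j' - j := by ring
    rw [e] at h3
    have := Int.eq_zero_of_abs_lt_dvd h3 (by rw [abs_lt]; omega)
    omega
  rw [abs_le] at hy
  have : y' = y ∨ y' = y + 1 ∨ y = y' + 1 := by omega
  rcases this with rfl | rfl | rfl
  · exact absurd rfl h
  · exact main _ h h'
  · have hs := h'.symm
    exact main _ h.symm hs

/-- Level-`j` separators of row `y`. -/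
noncomputable def gV (s : Finset (ℤ × ℤ)) (lev : ℤ → ℕ) (K j : ℕ) (y : ℤ) : Finset ℤ :=
  (s.filter (fun p => j ≤ lev p.1 ∧
    |p.2 - gctr K j y| ≤ (2 * (lev p.1 : ℤ) - j + 2) * K)).image Prod.fst

lemma mem_gV (s : Finset (ℤ × ℤ)) (lev : ℤ → ℕ) (K j : ℕ) (y x : ℤ) :
    x ∈ gV s lev K j y ↔ j ≤ lev x ∧ ∃ y', (x, y') ∈ s ∧
      |y' - gctr K j y| ≤ (2 * (lev x : ℤ) - j + 2) * K := by
  unfold gV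
  rw [Finset.mem_image]
  constructor
  · rintro ⟨⟨a, y'⟩, hp, rfl⟩
    rw [Finset.mem_filter] at hp
    exact ⟨hp.2.1, y', hp.1, hp.2.2⟩
  · rintro ⟨h, y', h1, h2⟩
    exact ⟨(x, y'), Finset.mem_filter.mpr ⟨h1, h, h2⟩, rfl⟩

lemma gV_nested (s : Finset (ℤ × ℤ)) (lev : ℤ → ℕ) (K j : ℕ) (hK : 0 < K) (y : ℤ) :
    gV s lev K (j + 1) y ⊆ gV s lev K j y := by
  intro x hx
  rw [mem_gV] at hx ⊢
  obtain ⟨h1, y', h2, h3⟩ := hx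
  refine ⟨by omega, y', h2, ?_⟩
  have a1 := gctr_le K j hK y
  have a2 := gctr_lt K j hK y
  have a3 := gctr_le K (j+1) hK y
  have a4 := gctr_lt K (j+1) hK y
  have e : (2 * (lev x : ℤ) - j + 2) * K = (2 * (lev x : ℤ) - ((j + 1 : ℕ) : ℤ) + 2) * K + K := by
    push_cast; ring
  rw [e]
  rw [abs_le] at h3 ⊢
  omega

/-- The level-`j` ancestor of `x` in row `y`. -/
noncomputable def ganc (s : Finset (ℤ × ℤ)) (lev : ℤ → ℕ) (K j : ℕ) (y x : ℤ) : WithBot ℤ :=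
  ((gV s lev K j y).filter (fun z => z ≤ x)).max

/-- Colour of a possibly missing element. -/
noncomputable def gcolB (col : ℤ → ℕ) (a : WithBot ℤ) : ℕ := (a.map col).unbotD 0

lemma gcolB_coe (col : ℤ → ℕ) (a : ℤ) : gcolB col (a : WithBot ℤ) = col a := rfl

lemma gcolB_lt (col : ℤ → ℕ) (b : ℕ) (h : ∀ x, col x < 2 ^ b) (a : WithBot ℤ) :
    gcolB col a < 2 ^ b := by
  induction a using WithBot.recBotCoe with
  | bot => simp [gcolB]
  | coe a => exact h a

/-- Elements of the level-`j` gap of `x` with the colour of the ancestor of `x`. -/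
noncomputable def gS (s : Finset (ℤ × ℤ)) (lev col : ℤ → ℕ) (K j : ℕ) (y x : ℤ) : Finset ℤ :=
  (gV s lev K j y).filter (fun z => ganc s lev K (j + 1) y x < (z : WithBot ℤ) ∧ z ≤ x ∧
    col z = gcolB col (ganc s lev K j y x))

lemma ganc_eq (s : Finset (ℤ × ℤ)) (lev col : ℤ → ℕ) (K j : ℕ) (hK : 0 < K) (y x : ℤ) :
    ganc s lev K j y x = max (ganc s lev K (j + 1) y x) (gS s lev col K j y x).max := by
  apply le_antisymm
  · rcases h : ganc s lev K j y x with _ | z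
    · exact bot_le
    · have hz : z ∈ (gV s lev K j y).filter (fun z => z ≤ x) := Finset.mem_of_max h
      rw [Finset.mem_filter] at hz
      by_cases hlt : ganc s lev K (j + 1) y x < (z : WithBot ℤ)
      · apply le_max_of_le_right
        apply Finset.le_max
        rw [gS, Finset.mem_filter]
        refine ⟨hz.1, hlt, hz.2, ?_⟩
        rw [h]; rfl
      · exact le_max_of_le_left (not_lt.mp hlt)
  · apply max_le
    · exact Finset.max_mono (Finset.filter_subset_filter _ (gV_nested s lev K j hK y))
    · apply Finset.max_mono
      intro z hz
      rw [gS, Finset.mem_filter] at hz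
      exact Finset.mem_filter.mpr ⟨hz.1, hz.2.2.1⟩

lemma ganc_inj_step (s : Finset (ℤ × ℤ)) (lev col : ℤ → ℕ) (K j : ℕ) (hK : 0 < K) (y x x' : ℤ)
    (h1 : ganc s lev K (j + 1) y x = ganc s lev K (j + 1) y x')
    (h2 : gcolB col (ganc s lev K j y x) = gcolB col (ganc s lev K j y x'))
    (h3 : (gS s lev col K j y x).card = (gS s lev col K j y x').card) :
    ganc s lev K j y x = ganc s lev K j y x' := by
  have main : ∀ x x' : ℤ, x ≤ x' → ganc s lev K (j + 1) y x = ganc s lev K (j + 1) y x' →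
      gcolB col (ganc s lev K j y x) = gcolB col (ganc s lev K j y x') →
      (gS s lev col K j y x).card = (gS s lev col K j y x').card →
      ganc s lev K j y x = ganc s lev K j y x' := by
    intro x x' hle h1 h2 h3
    have : gS s lev col K j y x = gS s lev col K j y x' := by
      apply Finset.eq_of_subset_of_card_le _ h3.ge
      intro z hz
      rw [gS, Finset.mem_filter] at hz ⊢
      rw [← h1, ← h2]
      exact ⟨hz.1, hz.2.1, hz.2.2.1.trans hle, hz.2.2.2⟩
    rw [ganc_eq s lev col K j hK y x, ganc_eq s lev col K j hK y x', h1, this]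
  rcases le_total x x' with h | h
  · exact main x x' h h1 h2 h3
  · exact (main x' x h h1.symm h2.symm h3.symm).symm

lemma ganc_inj_top (s : Finset (ℤ × ℤ)) (lev : ℤ → ℕ) (K j : ℕ) (y x x' : ℤ)
    (h3 : ((gV s lev K j y).filter (fun z => z ≤ x)).card
      = ((gV s lev K j y).filter (fun z => z ≤ x')).card) :
    ganc s lev K j y x = ganc s lev K j y x' := by
  have main : ∀ x x' : ℤ, x ≤ x' → ((gV s lev K j y).filter (fun z => z ≤ x)).card
      = ((gV s lev K j y).filter (fun z => z ≤ x')).card →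
      ganc s lev K j y x = ganc s lev K j y x' := by
    intro x x' hle h3
    unfold ganc
    rw [Finset.eq_of_subset_of_card_le _ h3.ge]
    intro z hz
    rw [Finset.mem_filter] at hz ⊢
    exact ⟨hz.1, hz.2.trans hle⟩
  rcases le_total x x' with h | h
  · exact main x x' h h3
  · exact (main x' x h h3.symm).symm

lemma ganc_zero (s : Finset (ℤ × ℤ)) (lev : ℤ → ℕ) (K j : ℕ) (y x : ℤ)
    (hx : x ∈ gV s lev K j y) : ganc s lev K j y x = x := by
  apply le_antisymm
  · apply Finset.max_le
    intro z hz
    rw [Finset.mem_filter] at hz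
    exact WithBot.coe_le_coe.mpr hz.2
  · exact Finset.le_max (Finset.mem_filter.mpr ⟨hx, le_rfl⟩)

lemma mem_gV_zero (s : Finset (ℤ × ℤ)) (lev : ℤ → ℕ) (K : ℕ) (hK : 0 < K) (y x y' : ℤ)
    (hs : (x, y') ∈ s) (h : |y' - y| ≤ 1) : x ∈ gV s lev K 0 y := by
  rw [mem_gV]
  refine ⟨Nat.zero_le _, y', hs, ?_⟩
  have a1 := gctr_le K 0 hK y
  have a2 := gctr_lt K 0 hK y
  have e : (2 * (lev x : ℤ) - ((0 : ℕ) : ℤ) + 2) * K = 2 * ((lev x : ℤ) * K) + 2 * K := by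
    push_cast; ring
  rw [e]
  have : 0 ≤ (lev x : ℤ) * K := by positivity
  rw [abs_le] at h ⊢
  omega

/-- Index of `x` at level `j` in row `y`, with `T` levels in use. -/
noncomputable def gidx (s : Finset (ℤ × ℤ)) (lev col : ℤ → ℕ) (K T : ℕ) (y x : ℤ) (j : ℕ) : ℕ :=
  if j < T then (gS s lev col K j y x).card
  else if j = T then ((gV s lev K T y).filter (fun z => z ≤ x)).card else 0

/-- Colour of `x` at level `j` in row `y`, with `T` levels in use. -/
noncomputable def gcol (s : Finset (ℤ × ℤ)) (lev col : ℤ → ℕ) (K T : ℕ) (y x : ℤ) (j : ℕ) : ℕ :=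
  if j < T then gcolB col (ganc s lev K j y x) else 0

lemma gcode_inj (s : Finset (ℤ × ℤ)) (lev col : ℤ → ℕ) (K T : ℕ) (hK : 0 < K) (y x x' : ℤ)
    (hx : (x, y) ∈ s) (hx' : (x', y) ∈ s)
    (hc : ∀ j < T, gcol s lev col K T y x j = gcol s lev col K T y x' j)
    (hi : ∀ j ≤ T, gidx s lev col K T y x j = gidx s lev col K T y x' j) : x = x' := by
  have main : ∀ k ≤ T, ganc s lev K (T - k) y x = ganc s lev K (T - k) y x' := by
    intro k
    induction k with
    | zero =>
      intro _
      have := hi T le_rfl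
      simp only [gidx, lt_irrefl, if_false, if_true] at this
      exact ganc_inj_top s lev K T y x x' this
    | succ k ih =>
      intro hk
      have ih := ih (by omega)
      have e : T - k = T - (k + 1) + 1 := by omega
      rw [e] at ih
      have hlt : T - (k + 1) < T := by omega
      have h2 := hc _ hlt
      have h3 := hi _ hlt.le
      simp only [gcol, gidx, if_pos hlt] at h2 h3
      exact ganc_inj_step s lev col K _ hK y x x' ih h2 h3
  have := main T le_rfl
  rw [Nat.sub_self, ganc_zero _ _ _ _ _ _ (mem_gV_zero s lev K hK y x y hx (by simp)),
    ganc_zero _ _ _ _ _ _ (mem_gV_zero s lev K hK y x' y hx' (by simp))] at this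
  exact WithBot.coe_injective this

lemma gcol_delta (s : Finset (ℤ × ℤ)) (lev col : ℤ → ℕ) (b K T T' : ℕ) (hT : T' ≤ K)
    (hcol : ∀ x, col x < 2 ^ b)
    (hTT : T' ≤ T + 1) (y y' x x' : ℤ) (hy : |y - y'| ≤ 1) (hx : x' = x ∨ x' = x + 1) :
    ∃ g : Fin 3 → ℕ, (∀ i, g i < 2 ^ b) ∧ ∀ j < T',
      gcol s lev col K T' y' x' j = gcol s lev col K T y x j ∨
      ∃ i, gcol s lev col K T' y' x' j = g i := by
  obtain ⟨j0, hj0⟩ : ∃ j0, ∀ j < K, gctr K j y ≠ gctr K j y' → j = j0 := by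
    by_cases h : ∃ j < K, gctr K j y ≠ gctr K j y'
    · obtain ⟨j, hj, hne⟩ := h
      exact ⟨j, fun j' hj' hne' => gctr_unique K j' j hj' hj y y' hy hne' hne⟩
    · exact ⟨0, fun j hj hne => absurd ⟨j, hj, hne⟩ h⟩
  refine ⟨![col x', gcolB col (ganc s lev K T y' x'), gcolB col (ganc s lev K j0 y' x')], ?_, ?_⟩
  · intro i
    fin_cases i
    · exact hcol _
    · exact gcolB_lt _ _ hcol _
    · exact gcolB_lt _ _ hcol _
  · intro j hj
    have e1 : gcol s lev col K T' y' x' j = gcolB col (ganc s lev K j y' x') := by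
      simp [gcol, hj]
    rw [e1]
    by_cases h1 : x' ∈ gV s lev K j y'
    · right; refine ⟨0, ?_⟩
      rw [ganc_zero _ _ _ _ _ _ h1]; rfl
    by_cases h2 : j = T
    · right; refine ⟨1, ?_⟩
      rw [h2]; rfl
    by_cases h3 : j = j0
    · right; refine ⟨2, ?_⟩
      rw [h3]; rfl
    left
    have hjT : j < T := by omega
    have e2 : gcol s lev col K T y x j = gcolB col (ganc s lev K j y x) := by
      simp [gcol, hjT]
    rw [e2]
    have hc : gctr K j y = gctr K j y' := by
      by_contra hne
      exact h3 (hj0 j (by omega) hne)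
    have hV : gV s lev K j y = gV s lev K j y' := by
      unfold gV; rw [hc]
    congr 1
    unfold ganc
    rw [hV]
    congr 1
    ext z
    rw [Finset.mem_filter, Finset.mem_filter]
    constructor
    · rintro ⟨hz, hzx⟩
      refine ⟨hz, ?_⟩
      have : z ≠ x' ∨ x' = x := by
        by_cases hzx' : z = x'
        · subst hzx'; exact absurd hz h1
        · exact Or.inl hzx'
      omega
    · rintro ⟨hz, hzx⟩
      exact ⟨hz, by omega⟩

lemma gS_card (s : Finset (ℤ × ℤ)) (lev col : ℤ → ℕ) (b t L K j : ℕ) (hK : 0 < K)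
    (hlev : ∀ x, lev x ≤ t) (hcol : ∀ x, col x < 2 ^ b)
    (hA : ∀ PX PY, GConv PX → GConv PY → ∀ i c, i ≤ t → c < 2 ^ b →
        (∀ x ∈ gbox s PX PY, lev x ≤ i) →
        ((gbox s PX PY).filter (fun x => lev x = i ∧ col x = c)).card ≤ L) (y x : ℤ) :
    (gS s lev col K j y x).card ≤ (t + 1) * L := by
  let c := gcolB col (ganc s lev K j y x)
  let PX : ℤ → Prop := fun z => ganc s lev K (j + 1) y x < (z : WithBot ℤ) ∧ z ≤ x
  let PY : ℕ → ℤ → Prop := fun i y' => |y' - gctr K j y| ≤ (2 * (i : ℤ) - j + 2) * K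
  have hPX : GConv PX := by
    intro p q r hpq hqr hp hr
    exact ⟨lt_of_lt_of_le hp.1 (WithBot.coe_le_coe.mpr hpq), hqr.trans hr.2⟩
  have hPY : ∀ i, GConv (PY i) := by
    intro i p q r hpq hqr hp hr
    simp only [PY, abs_le] at hp hr ⊢
    constructor <;> linarith [hp.1, hp.2, hr.1, hr.2]
  have hsub : gS s lev col K j y x ⊆ (Finset.Icc j t).biUnion
      (fun i => (gbox s PX (PY i)).filter (fun z => lev z = i ∧ col z = c)) := by
    intro z hz
    rw [gS, Finset.mem_filter] at hz
    obtain ⟨hzV, hz1, hz2, hz3⟩ := hz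
    rw [mem_gV] at hzV
    obtain ⟨h1, y', h2, h3⟩ := hzV
    rw [Finset.mem_biUnion]
    refine ⟨lev z, Finset.mem_Icc.mpr ⟨h1, hlev z⟩, Finset.mem_filter.mpr ⟨?_, rfl, hz3⟩⟩
    rw [mem_gbox]
    exact ⟨y', h2, ⟨hz1, hz2⟩, h3⟩
  refine (Finset.card_le_card hsub).trans ((Finset.card_biUnion_le_card_mul _ _ L ?_).trans ?_)
  · intro i hi
    rw [Finset.mem_Icc] at hi
    apply hA PX (PY i) hPX (hPY i) i c hi.2 (gcolB_lt _ _ hcol _)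
    intro z hz
    by_contra hlt
    rw [mem_gbox] at hz
    obtain ⟨y', h1, ⟨h2, h3⟩, h4⟩ := hz
    have : z ∈ gV s lev K (j + 1) y := by
      rw [mem_gV]
      refine ⟨by omega, y', h1, ?_⟩
      have a1 := gctr_le K j hK y
      have a2 := gctr_lt K j hK y
      have a3 := gctr_le K (j+1) hK y
      have a4 := gctr_lt K (j+1) hK y
      have e : (2 * (i : ℤ) - j + 2) * K + K ≤
          (2 * (lev z : ℤ) - ((j + 1 : ℕ) : ℤ) + 2) * K := by
        have : (i : ℤ) + 1 ≤ lev z := by omega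
        have hk : (0 : ℤ) ≤ K := by positivity
        push_cast
        nlinarith
      simp only [PY] at h4
      rw [abs_le] at h4 ⊢
      omega
    have h5 : (z : WithBot ℤ) ≤ ganc s lev K (j + 1) y x :=
      Finset.le_max (Finset.mem_filter.mpr ⟨this, h3⟩)
    exact absurd h2 (not_lt.mpr h5)
  · apply Nat.mul_le_mul_right
    rw [Nat.card_Icc]; omega

lemma gtop_card (s : Finset (ℤ × ℤ)) (lev : ℤ → ℕ) (b t L K T : ℕ) (hK : 0 < K)
    (hlev : ∀ x, lev x ≤ t) (hT : T ≤ t)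
    (hB : ∀ PX PY, GConv PX → GConv PY → ∀ T ≤ t, (gbox s PX PY).card ≤ (2 ^ b) ^ T →
        ((gbox s PX PY).filter (fun x => T ≤ lev x)).card ≤ L) (y x : ℤ)
    (hc : (gbox s (fun _ => True) (fun y' => |y' - y| ≤ (2 * (t : ℤ) + 3) * K)).card
      ≤ (2 ^ b) ^ T) :
    ((gV s lev K T y).filter (fun z => z ≤ x)).card ≤ L := by
  refine le_trans (Finset.card_le_card ?_) (hB (fun _ => True)
    (fun y' => |y' - y| ≤ (2 * (t : ℤ) + 3) * K) (fun _ _ _ _ _ _ _ => trivial) ?_ T hT hc)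
  · intro z hz
    rw [Finset.mem_filter, mem_gV] at hz
    obtain ⟨⟨h1, y', h2, h3⟩, _⟩ := hz
    rw [Finset.mem_filter, mem_gbox]
    refine ⟨⟨y', h2, trivial, ?_⟩, h1⟩
    have a1 := gctr_le K T hK y
    have a2 := gctr_lt K T hK y
    have e : (2 * (lev z : ℤ) - T + 2) * K + K ≤ (2 * (t : ℤ) + 3) * K := by
      have : (lev z : ℤ) ≤ t := by exact_mod_cast hlev z
      have hk : (0 : ℤ) ≤ K := by positivity
      have hT0 : (0 : ℤ) ≤ T := by positivity
      nlinarith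
    rw [abs_le] at h3 ⊢
    omega
  · intro p q r hpq hqr hp hr
    simp only [abs_le] at hp hr ⊢
    constructor <;> linarith [hp.1, hp.2, hr.1, hr.2]

/-- Smoothed weight of row `y`. -/
def gw (s : Finset (ℤ × ℤ)) (m R : ℕ) (y : ℤ) : ℕ :=
  ∑ p ∈ s, 2 ^ (m - ((y - p.2).natAbs - R))

lemma gw_smooth (s : Finset (ℤ × ℤ)) (m R : ℕ) (y y' : ℤ) (h : |y - y'| ≤ 1) :
    gw s m R y ≤ 2 * gw s m R y' := by
  unfold gw
  rw [Finset.mul_sum]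
  apply Finset.sum_le_sum
  intro p _
  rw [← pow_succ']
  apply Nat.pow_le_pow_right (by norm_num)
  rw [abs_le] at h
  omega

lemma gw_ge (s : Finset (ℤ × ℤ)) (m R : ℕ) (y : ℤ) :
    (s.filter (fun p => |p.2 - y| ≤ (R : ℤ))).card * 2 ^ m ≤ gw s m R y := by
  unfold gw
  calc _ = ∑ p ∈ s.filter (fun p => |p.2 - y| ≤ (R : ℤ)), 2 ^ m := by simp
    _ ≤ ∑ p ∈ s.filter (fun p => |p.2 - y| ≤ (R : ℤ)), 2 ^ (m - ((y - p.2).natAbs - R)) := by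
      apply Finset.sum_le_sum
      intro p hp
      rw [Finset.mem_filter, abs_le] at hp
      apply Nat.pow_le_pow_right (by norm_num)
      omega
    _ ≤ _ := Finset.sum_le_sum_of_subset (Finset.filter_subset _ _)

lemma gw_le (s : Finset (ℤ × ℤ)) (m R : ℕ) (y : ℤ) : gw s m R y ≤ s.card * 2 ^ m := by
  unfold gw
  rw [← smul_eq_mul]
  apply Finset.sum_le_card_nsmul
  intro p _
  exact Nat.pow_le_pow_right (by norm_num) (Nat.sub_le _ _)

lemma gw_total (s : Finset (ℤ × ℤ)) (m R : ℕ) (hs : s.card ≤ 2 ^ m) :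
    ∑ y ∈ s.image Prod.snd, gw s m R y ≤ s.card * (2 ^ m * (2 * R + 2 * m + 2)) := by
  unfold gw
  rw [Finset.sum_comm, ← smul_eq_mul]
  apply Finset.sum_le_card_nsmul
  intro p _
  have hpt : ∀ y ∈ s.image Prod.snd, 2 ^ (m - ((y - p.2).natAbs - R)) ≤
      (if y ∈ Finset.Icc (p.2 - (R + m : ℕ)) (p.2 + (R + m : ℕ)) then 2 ^ m else 0) + 1 := by
    intro y _
    split_ifs with h
    · have := Nat.pow_le_pow_right (n := 2) (by norm_num) (Nat.sub_le m ((y - p.2).natAbs - R))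
      omega
    · rw [Finset.mem_Icc] at h
      have : m - ((y - p.2).natAbs - R) = 0 := by omega
      rw [this]; simp
  refine (Finset.sum_le_sum hpt).trans ?_
  rw [Finset.sum_add_distrib, Finset.sum_ite_mem]
  simp only [Finset.sum_const, smul_eq_mul, mul_one]
  have h1 : (s.image Prod.snd ∩ Finset.Icc (p.2 - (R + m : ℕ)) (p.2 + (R + m : ℕ))).card
      ≤ 2 * R + 2 * m + 1 := by
    refine (Finset.card_le_card Finset.inter_subset_right).trans ?_
    rw [Int.card_Icc]; omega
  have h2 : (s.image Prod.snd).card ≤ 2 ^ m := Finset.card_image_le.trans hs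
  nlinarith [Nat.mul_le_mul_right (2 ^ m) h1]

lemma gal_rows (s : Finset (ℤ × ℤ)) (m R r : ℕ) (hs : s.card ≤ 2 ^ m)
    (hr : 2 * R + 2 * m + 2 ≤ 2 ^ r) :
    ∃ f μ : ℤ → ℕ, (∀ y ∈ s.image Prod.snd, f y ≤ m ∧ μ y < 2 ^ (m + r - f y) ∧
      (s.filter (fun p => |p.2 - y| ≤ (R : ℤ))).card ≤ 2 ^ (f y + 1)) ∧
      (∀ y ∈ s.image Prod.snd, ∀ y' ∈ s.image Prod.snd, f y = f y' → μ y = μ y' → y = y') ∧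
      (∀ y ∈ s.image Prod.snd, ∀ y' ∈ s.image Prod.snd, |y - y'| ≤ 1 → f y' ≤ f y + 1 ∧
        |(μ y' : ℤ) * 2 ^ f y' - μ y * 2 ^ f y| < 6 * 2 ^ f y') := by
  obtain ⟨rows, hrows⟩ : ∃ rows, rows = s.image Prod.snd := ⟨_, rfl⟩
  let w := gw s m R
  let S : ℤ → ℕ := fun y => ∑ y' ∈ rows.filter (fun y' => y' < y), w y'
  let e : ℤ → ℕ := fun y => Nat.log 2 (w y)
  let μ : ℤ → ℕ := fun y => (S y + (2 ^ e y - 1)) / 2 ^ e y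
  have hw : ∀ y ∈ rows, 2 ^ m ≤ w y := by
    intro y hy
    rw [hrows, Finset.mem_image] at hy
    obtain ⟨p, hp, rfl⟩ := hy
    refine le_trans ?_ (gw_ge s m R p.2)
    apply Nat.le_mul_of_pos_left
    apply Finset.card_pos.mpr
    exact ⟨p, Finset.mem_filter.mpr ⟨hp, by simp⟩⟩
  have hwpos : ∀ y ∈ rows, w y ≠ 0 := fun y hy => by
    have := hw y hy
    have : 0 < 2 ^ m := by positivity
    omega
  have he1 : ∀ y ∈ rows, 2 ^ e y ≤ w y := fun y hy => Nat.pow_log_le_self 2 (hwpos y hy)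
  have he2 : ∀ y, w y < 2 * 2 ^ e y := fun y => by
    have := Nat.lt_pow_succ_log_self (b := 2) (by norm_num) (w y)
    rw [pow_succ'] at this; exact this
  have hem : ∀ y ∈ rows, m ≤ e y := fun y hy => Nat.le_log_of_pow_le (by norm_num) (hw y hy)
  have he2m : ∀ y ∈ rows, e y ≤ 2 * m := by
    intro y hy
    have h1 : w y ≤ 2 ^ (2 * m) := by
      refine (gw_le s m R y).trans ?_
      rw [two_mul, pow_add]
      exact Nat.mul_le_mul_right _ hs
    exact (Nat.pow_le_pow_iff_right (by norm_num : 1 < 2)).mp ((he1 y hy).trans h1)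
  have hμ1 : ∀ y, S y ≤ μ y * 2 ^ e y := by
    intro y
    have h0 : 0 < 2 ^ e y := by positivity
    have := Nat.lt_div_mul_add (a := S y + (2 ^ e y - 1)) h0
    simp only [μ]; omega
  have hμ2 : ∀ y ∈ rows, μ y * 2 ^ e y < S y + w y := by
    intro y hy
    have h0 : 0 < 2 ^ e y := by positivity
    have := Nat.div_mul_le_self (S y + (2 ^ e y - 1)) (2 ^ e y)
    have h1 := he1 y hy
    simp only [μ]; omega
  have hSS : ∀ y ∈ rows, ∀ y', y < y' → S y + w y ≤ S y' := by
    intro y hy y' hlt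
    simp only [S]
    rw [add_comm, ← Finset.sum_insert (by simp)]
    apply Finset.sum_le_sum_of_subset
    intro z hz
    rw [Finset.mem_insert, Finset.mem_filter] at hz
    rw [Finset.mem_filter]
    rcases hz with rfl | ⟨h1, h2⟩
    · exact ⟨hy, hlt⟩
    · exact ⟨h1, by omega⟩
  have hSeq : ∀ y ∈ rows, S (y + 1) = S y + w y := by
    intro y hy
    apply le_antisymm _ (hSS y hy _ (by omega))
    simp only [S]
    rw [add_comm _ (w y), ← Finset.sum_insert (by simp)]
    apply Finset.sum_le_sum_of_subset
    intro z hz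
    rw [Finset.mem_insert, Finset.mem_filter]
    rw [Finset.mem_filter] at hz
    by_cases h : z = y
    · exact Or.inl h
    · exact Or.inr ⟨hz.1, by omega⟩
  have hSW : ∀ y ∈ rows, S y + w y ≤ 2 ^ (2 * m + r) := by
    intro y hy
    have h1 : S y + w y ≤ ∑ y ∈ rows, w y := by
      simp only [S]
      rw [add_comm, ← Finset.sum_insert (by simp)]
      apply Finset.sum_le_sum_of_subset
      intro z hz
      rw [Finset.mem_insert, Finset.mem_filter] at hz
      rcases hz with rfl | ⟨h1, h2⟩
      · exact hy
      · exact h1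
    refine h1.trans ?_
    rw [hrows]
    refine (gw_total s m R hs).trans ?_
    have e1 : 2 ^ (2 * m + r) = 2 ^ m * (2 ^ m * 2 ^ r) := by
      rw [← pow_add, ← pow_add]; congr 1; omega
    rw [e1]
    exact Nat.mul_le_mul hs (Nat.mul_le_mul_left _ hr)
  rw [← hrows]
  refine ⟨fun y => e y - m, μ, ?_, ?_, ?_⟩
  · intro y hy
    have h1 := hem y hy
    have h2 := he2m y hy
    refine ⟨show e y - m ≤ m by omega, ?_, ?_⟩
    · have h3 := (hμ2 y hy).trans_le (hSW y hy)
      have e1 : 2 ^ (2 * m + r) = 2 ^ (m + r - (e y - m)) * 2 ^ e y := by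
        rw [← pow_add]; congr 1; omega
      rw [e1] at h3
      exact lt_of_mul_lt_mul_right h3 (Nat.zero_le _)
    · have h3 := (gw_ge s m R y).trans_lt (he2 y)
      have e1 : 2 * 2 ^ e y = 2 ^ (e y - m + 1) * 2 ^ m := by
        rw [← pow_add, ← pow_succ']; congr 1; omega
      rw [e1] at h3
      exact (lt_of_mul_lt_mul_right h3 (Nat.zero_le _)).le
  · intro y hy y' hy' hf hμ
    have h1 := hem y hy
    have h2 := hem y' hy'
    have he : e y = e y' := by simp only at hf; omega
    have a1 := hμ1 y
    have a2 := hμ2 y hy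
    have a3 := hμ1 y'
    have a4 := hμ2 y' hy'
    rw [← he, ← hμ] at a3 a4
    by_contra hne
    rcases lt_or_gt_of_ne hne with h | h
    · have := hSS y hy y' h; omega
    · have := hSS y' hy' y h; omega
  · intro y hy y' hy' hyy
    have h1 := hem y hy
    have h2 := hem y' hy'
    have s1 := gw_smooth s m R y y' hyy
    have s2 := gw_smooth s m R y' y (by rw [abs_sub_comm]; exact hyy)
    constructor
    · have h3 : 2 ^ e y' < 2 ^ (e y + 2) := by
        have := he1 y' hy'
        have := he2 y
        have e2 : 2 ^ (e y + 2) = 4 * 2 ^ e y := by rw [pow_add]; ring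
        rw [e2]
        simp only [w] at *
        omega
      have := (Nat.pow_lt_pow_iff_right (by norm_num : 1 < 2)).mp h3
      simp only; omega
    · have a1 := hμ1 y
      have a2 := hμ2 y hy
      have a3 := hμ1 y'
      have a4 := hμ2 y' hy'
      have a5 := he2 y'
      have key : |(μ y' : ℤ) * 2 ^ e y' - μ y * 2 ^ e y| < 6 * 2 ^ e y' := by
        zify at a1 a2 a3 a4 a5
        have s1' : (w y : ℤ) ≤ 2 * w y' := by exact_mod_cast s1
        have hp : (0:ℤ) < 2 ^ e y' := by positivity
        rw [abs_le] at hyy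
        have : y' = y ∨ y' = y + 1 ∨ y = y' + 1 := by omega
        rcases this with rfl | rfl | rfl
        · simp
        · have := hSeq y hy
          zify at this
          rw [abs_lt]; constructor <;> linarith
        · have := hSeq y' hy'
          zify at this
          rw [abs_lt]; constructor <;> linarith
      have p1 : (2:ℤ) ^ e y' = 2 ^ (e y' - m) * 2 ^ m := by rw [← pow_add]; congr 1; omega
      have p2 : (2:ℤ) ^ e y = 2 ^ (e y - m) * 2 ^ m := by rw [← pow_add]; congr 1; omega
      rw [p1, p2, ← mul_assoc, ← mul_assoc, ← mul_assoc, ← sub_mul, abs_mul,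
        abs_of_pos (show (0:ℤ) < 2 ^ m by positivity)] at key
      exact lt_of_mul_lt_mul_right key (by positivity)

lemma gal_geom (s : Finset (ℤ × ℤ)) (m b t r L : ℕ) (hb : 1 ≤ b) (ht : t = m / b + 1)
    (hs : s.card ≤ 2 ^ m)
    (hr : 2 * ((2 * t + 3) * (t + 1)) + 2 * m + 2 ≤ 2 ^ r)
    (hL : 3 * ((2 ^ m) ^ 4 * ((t + 1) * (2 ^ b + 1))) ≤ 2 ^ L)
    (hI : (t + 1) * L < 2 ^ r) :
    ∃ (f μ : ℤ × ℤ → ℕ) (col idx : ℤ × ℤ → ℕ → ℕ),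
      (∀ v ∈ s, f v ≤ m ∧ μ v < 2 ^ (m + r - f v) ∧ ∀ j, col v j < 2 ^ b ∧ idx v j < 2 ^ r ∧
        (f v / b + 1 ≤ j → col v j = 0)) ∧
      (∀ v ∈ s, ∀ w ∈ s, f v = f w → μ v = μ w → (∀ j < f v / b + 1, col v j = col w j) →
        (∀ j ≤ f v / b + 1, idx v j = idx w j) → v = w) ∧
      (∀ v ∈ s, ∀ w ∈ s, |v.2 - w.2| ≤ 1 → (w.1 = v.1 ∨ w.1 = v.1 + 1) →
        |(μ w : ℤ) * 2 ^ f w - μ v * 2 ^ f v| < 6 * 2 ^ f w ∧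
        ∃ g : Fin 3 → ℕ, (∀ i, g i < 2 ^ b) ∧
          ∀ j < f w / b + 1, col w j = col v j ∨ ∃ i, col w j = g i) := by
  have hbt : m ≤ b * t := by
    rw [ht]; exact (Nat.lt_mul_div_succ m (by omega)).le
  have hst : s.card ≤ (2 ^ b) ^ t := by
    rw [← pow_mul]; exact hs.trans (Nat.pow_le_pow_right (by norm_num) hbt)
  obtain ⟨lev, cl, hlev, hcl, hA, hB⟩ := gal_levels' s b t L hb hst
    (le_trans (Nat.mul_le_mul_left _ (Nat.mul_le_mul_right _ (Nat.pow_le_pow_left hs 4))) hL)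
  obtain ⟨f, μ, h1, h2, h3⟩ := gal_rows s m ((2 * t + 3) * (t + 1)) r hs hr
  have hK : 0 < t + 1 := by omega
  have hT : ∀ y ∈ s.image Prod.snd, f y / b + 1 ≤ t := by
    intro y hy
    rw [ht]
    exact Nat.add_le_add_right (Nat.div_le_div_right (h1 y hy).1) 1
  have hmem : ∀ v ∈ s, v.2 ∈ s.image Prod.snd := fun v hv => Finset.mem_image_of_mem _ hv
  refine ⟨fun v => f v.2, fun v => μ v.2,
    fun v j => gcol s lev cl (t + 1) (f v.2 / b + 1) v.2 v.1 j,
    fun v j => gidx s lev cl (t + 1) (f v.2 / b + 1) v.2 v.1 j, ?_, ?_, ?_⟩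
  · intro v hv
    obtain ⟨a1, a2, a3⟩ := h1 v.2 (hmem v hv)
    refine ⟨a1, a2, fun j => ⟨?_, ?_, ?_⟩⟩
    · simp only [gcol]
      split_ifs
      · exact gcolB_lt _ _ hcl _
      · positivity
    · refine lt_of_le_of_lt ?_ hI
      simp only [gidx]
      split_ifs
      · exact gS_card s lev cl b t L (t + 1) j hK hlev hcl hA _ _
      · refine le_trans (gtop_card s lev b t L (t + 1) _ hK hlev (hT _ (hmem v hv)) hB _ _ ?_)
          (Nat.le_mul_of_pos_left _ hK)
        have e1 : gbox s (fun _ => True)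
            (fun y' => |y' - v.2| ≤ (2 * (t : ℤ) + 3) * ((t + 1 : ℕ) : ℤ)) ⊆
            (s.filter (fun p => |p.2 - v.2| ≤ (((2 * t + 3) * (t + 1) : ℕ) : ℤ))).image
              Prod.fst := by
          intro x hx
          rw [mem_gbox] at hx
          obtain ⟨y', c1, _, c2⟩ := hx
          rw [Finset.mem_image]
          refine ⟨(x, y'), Finset.mem_filter.mpr ⟨c1, ?_⟩, rfl⟩
          push_cast at c2 ⊢
          exact c2
        refine (Finset.card_le_card e1).trans (Finset.card_image_le.trans (a3.trans ?_))
        rw [← pow_mul]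
        apply Nat.pow_le_pow_right (by norm_num)
        exact Nat.lt_mul_div_succ (f v.2) (by omega)
      · exact Nat.zero_le _
    · intro hj
      simp only at hj
      simp only [gcol]
      rw [if_neg (by omega)]
  · intro v hv w hw hf hμ hc hi
    have hy : v.2 = w.2 := h2 _ (hmem v hv) _ (hmem w hw) hf hμ
    simp only [← hy] at hc hi
    have hx : v.1 = w.1 := gcode_inj s lev cl (t + 1) (f v.2 / b + 1) hK v.2 v.1 w.1 hv
      (by rw [hy]; exact hw) hc hi
    exact Prod.ext hx hy
  · intro v hv w hw hy hx
    obtain ⟨b1, b2⟩ := h3 _ (hmem v hv) _ (hmem w hw) hy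
    refine ⟨b2, ?_⟩
    refine gcol_delta s lev cl b (t + 1) (f v.2 / b + 1) (f w.2 / b + 1)
      ((hT _ (hmem w hw)).trans (by omega)) hcl ?_ v.2 w.2 v.1 w.1 hy hx
    have : (f v.2 + b) / b = f v.2 / b + 1 := Nat.add_div_right _ (by omega)
    have h5 : f w.2 / b ≤ (f v.2 + b) / b := Nat.div_le_div_right (by omega)
    omega

/-- The part of a label describing the point itself. -/
abbrev GCore (m b r : ℕ) : Type :=
  Σ f : Fin (m + 1), Fin (2 ^ (m + r - f.val)) × (Fin (f.val / b + 1) → Fin (2 ^ b))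

/-- The sampling indices. -/
abbrev GIdx (t r : ℕ) : Type := Fin (t + 1) → Fin (2 ^ r)

/-- The description of a neighbour relative to a point. -/
abbrev GDelta (m b t r : ℕ) : Type :=
  Fin (m + 1) × Fin 16 × (Fin 3 → Fin (2 ^ b)) × (Fin (t + 1) → Option (Fin 3)) × GIdx t r

/-- A full label. -/
abbrev GLab (m b t r : ℕ) : Type :=
  GCore m b r × GIdx t r × (Fin 4 → Option (GDelta m b t r))

lemma gcore_card (m b r : ℕ) : Fintype.card (GCore m b r) ≤ (m + 1) * 2 ^ (m + r + b) := by
  rw [Fintype.card_sigma]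
  refine (Finset.sum_le_card_nsmul _ _ (2 ^ (m + r + b)) ?_).trans (by simp)
  intro f _
  simp only [Fintype.card_prod, Fintype.card_fin, Fintype.card_pi, Finset.prod_const,
    Finset.card_univ]
  rw [← pow_mul, ← pow_add]
  apply Nat.pow_le_pow_right (by norm_num)
  have h1 := f.isLt
  have h2 := Nat.mul_div_le f.val b
  rw [Nat.mul_add]
  omega

lemma gdelta_card (m b t r : ℕ) : Fintype.card (GDelta m b t r) =
    (m + 1) * (16 * ((2 ^ b) ^ 3 * (4 ^ (t + 1) * (2 ^ r) ^ (t + 1)))) := by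
  simp

lemma glab_card (m b t r lam : ℕ) (h : m + 1 ≤ 2 ^ lam) : Fintype.card (GLab m b t r) ≤
    2 ^ (lam + (m + r + b) + r * (t + 1) +
      4 * (1 + (lam + 4 + 3 * b + 2 * (t + 1) + r * (t + 1)))) := by
  have hd : Fintype.card (Option (GDelta m b t r)) ≤
      2 ^ (1 + (lam + 4 + 3 * b + 2 * (t + 1) + r * (t + 1))) := by
    rw [Fintype.card_option, gdelta_card]
    have e : (m + 1) * (16 * ((2 ^ b) ^ 3 * (4 ^ (t + 1) * (2 ^ r) ^ (t + 1)))) ≤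
        2 ^ (lam + 4 + 3 * b + 2 * (t + 1) + r * (t + 1)) := by
      calc _ ≤ 2 ^ lam * (16 * ((2 ^ b) ^ 3 * (4 ^ (t + 1) * (2 ^ r) ^ (t + 1)))) :=
            Nat.mul_le_mul_right _ h
        _ = _ := by
            rw [show (4 : ℕ) = 2 ^ 2 from rfl, show (16 : ℕ) = 2 ^ 4 from rfl]
            simp only [← pow_mul, ← pow_add]
            congr 1
            ring
    have e2 : 1 ≤ 2 ^ (lam + 4 + 3 * b + 2 * (t + 1) + r * (t + 1)) := Nat.one_le_two_pow
    rw [pow_add 2 1]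
    omega
  have e3 : Fintype.card (GLab m b t r) = Fintype.card (GCore m b r) *
      ((2 ^ r) ^ (t + 1) * Fintype.card (Option (GDelta m b t r)) ^ 4) := by
    rw [Fintype.card_prod, Fintype.card_prod, Fintype.card_pi, Fintype.card_pi]
    simp only [Finset.prod_const, Finset.card_univ, Fintype.card_fin]
  rw [e3]
  calc _ ≤ (2 ^ lam * 2 ^ (m + r + b)) * ((2 ^ r) ^ (t + 1) *
        (2 ^ (1 + (lam + 4 + 3 * b + 2 * (t + 1) + r * (t + 1)))) ^ 4) := by
        refine Nat.mul_le_mul ((gcore_card m b r).trans (Nat.mul_le_mul_right _ h)) ?_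
        exact Nat.mul_le_mul_left _ (Nat.pow_le_pow_left hd 4)
    _ = _ := by
        simp only [← pow_mul, ← pow_add]
        congr 1
        ring

/-- Colour sequence stored in a core. -/
def gcc {m b r : ℕ} (c : GCore m b r) (j : ℕ) : ℕ :=
  if h : j < c.1.val / b + 1 then (c.2.2 ⟨j, h⟩).val else 0

/-- The second label is the one described by the delta `d` relative to the first. -/
def gRel {m b t r : ℕ} (c₁ : GCore m b r) (d : GDelta m b t r) (c₂ : GCore m b r)
    (i₂ : GIdx t r) : Prop :=
  c₂.1 = d.1 ∧ c₂.2.1.val % 16 = d.2.1.val ∧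
  |(c₂.2.1.val : ℤ) * 2 ^ c₂.1.val - (c₁.2.1.val : ℤ) * 2 ^ c₁.1.val| < 6 * 2 ^ c₂.1.val ∧
  (∀ j : Fin (t + 1), j.val < c₂.1.val / b + 1 →
    gcc c₂ j.val = (d.2.2.2.1 j).elim (gcc c₁ j.val) (fun i => (d.2.2.1 i).val)) ∧
  i₂ = d.2.2.2.2

/-- One-sided adjacency of labels. -/
def gAdj1 {m b t r : ℕ} (l₁ l₂ : GLab m b t r) : Prop :=
  ∃ i d, l₁.2.2 i = some d ∧ gRel l₁.1 d l₂.1 l₂.2.1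

/-- Forward directions. -/
def gdir : Fin 4 → ℤ × ℤ := ![(0, 1), (1, -1), (1, 0), (1, 1)]

lemma gdir_total (u v : ℤ × ℤ) (h : u ≠ v) (h1 : |u.1 - v.1| ≤ 1) (h2 : |u.2 - v.2| ≤ 1) :
    (∃ i, v = u + gdir i) ∨ (∃ i, u = v + gdir i) := by
  obtain ⟨a, b⟩ := u
  obtain ⟨c, d⟩ := v
  simp only [abs_le] at h1 h2
  have hne : ¬ (a = c ∧ b = d) := fun hh => h (by rw [hh.1, hh.2])
  have k : (c = a ∧ d = b + 1) ∨ (c = a + 1 ∧ d = b - 1) ∨ (c = a + 1 ∧ d = b) ∨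
      (c = a + 1 ∧ d = b + 1) ∨ (a = c ∧ b = d + 1) ∨ (a = c + 1 ∧ b = d - 1) ∨
      (a = c + 1 ∧ b = d) ∨ (a = c + 1 ∧ b = d + 1) := by omega
  rcases k with k | k | k | k | k | k | k | k
  · exact Or.inl ⟨0, by simp [gdir, k.1, k.2]⟩
  · exact Or.inl ⟨1, by simp [gdir, k.1, k.2, sub_eq_add_neg]⟩
  · exact Or.inl ⟨2, by simp [gdir, k.1, k.2]⟩
  · exact Or.inl ⟨3, by simp [gdir, k.1, k.2]⟩
  · exact Or.inr ⟨0, by simp [gdir, k.1, k.2]⟩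
  · exact Or.inr ⟨1, by simp [gdir, k.1, k.2, sub_eq_add_neg]⟩
  · exact Or.inr ⟨2, by simp [gdir, k.1, k.2]⟩
  · exact Or.inr ⟨3, by simp [gdir, k.1, k.2]⟩

lemma gdir_prop (u v : ℤ × ℤ) (i : Fin 4) (h : v = u + gdir i) :
    |u.2 - v.2| ≤ 1 ∧ (v.1 = u.1 ∨ v.1 = u.1 + 1) := by
  subst h
  fin_cases i <;> simp [gdir]

lemma gmu_unique (a b c : ℤ) (f : ℕ) (h : a % 16 = b % 16)
    (h1 : |a * 2 ^ f - c| < 6 * 2 ^ f) (h2 : |b * 2 ^ f - c| < 6 * 2 ^ f) : a = b := by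
  have hp : (0 : ℤ) < 2 ^ f := by positivity
  rw [abs_lt] at h1 h2
  have k1 : (a - b) * 2 ^ f < 12 * 2 ^ f := by nlinarith
  have k2 : (-12) * 2 ^ f < (a - b) * 2 ^ f := by nlinarith
  have k3 := lt_of_mul_lt_mul_right k1 hp.le
  have k4 := lt_of_mul_lt_mul_right k2 hp.le
  omega

lemma gal_lab (m b t r L : ℕ) (hb : 1 ≤ b) (ht : t = m / b + 1)
    (hr : 2 * ((2 * t + 3) * (t + 1)) + 2 * m + 2 ≤ 2 ^ r)
    (hL : 3 * ((2 ^ m) ^ 4 * ((t + 1) * (2 ^ b + 1))) ≤ 2 ^ L)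
    (hI : (t + 1) * L < 2 ^ r) (s : Finset (ℤ × ℤ)) (hs : s.card ≤ 2 ^ m)
    (G : SimpleGraph {p : ℤ × ℤ // p ∈ s})
    (hG : ∀ u v : {p : ℤ × ℤ // p ∈ s}, G.Adj u v →
            |u.1.1 - v.1.1| ≤ 1 ∧ |u.1.2 - v.1.2| ≤ 1) :
    ∃ l : {p : ℤ × ℤ // p ∈ s} → GLab m b t r, Function.Injective l ∧
      ∀ v w, (gAdj1 (l v) (l w) ∨ gAdj1 (l w) (l v)) ↔ G.Adj v w := by
  obtain ⟨f, μ, col, idx, h1, h2, h3⟩ := gal_geom s m b t r L hb ht hs hr hL hI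
  let core : {p : ℤ × ℤ // p ∈ s} → GCore m b r := fun v =>
    ⟨⟨f v.1, by have := (h1 v.1 v.2).1; omega⟩, ⟨μ v.1, (h1 v.1 v.2).2.1⟩,
      fun j => ⟨col v.1 j.val, ((h1 v.1 v.2).2.2 j.val).1⟩⟩
  let ix : {p : ℤ × ℤ // p ∈ s} → GIdx t r := fun v j =>
    ⟨idx v.1 j.val, ((h1 v.1 v.2).2.2 j.val).2.1⟩
  have hfv : ∀ v, (core v).1.val = f v.1 := fun v => rfl
  have hmv : ∀ v, (core v).2.1.val = μ v.1 := fun v => rfl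
  have hcc : ∀ v j, gcc (core v) j = col v.1 j := by
    intro v j
    simp only [gcc, core]
    split_ifs with h
    · rfl
    · exact (((h1 v.1 v.2).2.2 j).2.2 (by omega)).symm
  have hft : ∀ v : {p : ℤ × ℤ // p ∈ s}, f v.1 / b + 1 ≤ t := by
    intro v
    rw [ht]
    exact Nat.add_le_add_right (Nat.div_le_div_right (h1 v.1 v.2).1) 1
  have hinj : ∀ v w : {p : ℤ × ℤ // p ∈ s}, f v.1 = f w.1 → μ v.1 = μ w.1 →
      (∀ j < f v.1 / b + 1, col v.1 j = col w.1 j) → ix v = ix w → v = w := by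
    intro v w e1 e2 e3 e4
    refine Subtype.ext (h2 v.1 v.2 w.1 w.2 e1 e2 e3 ?_)
    intro j hj
    have := congrFun e4 ⟨j, by have := hft v; omega⟩
    exact congrArg Fin.val this
  have hex : ∀ v w : {p : ℤ × ℤ // p ∈ s}, (∃ i, w.1 = v.1 + gdir i) →
      ∃ d : GDelta m b t r, gRel (core v) d (core w) (ix w) := by
    rintro v w ⟨i, hi⟩
    obtain ⟨q1, q2⟩ := gdir_prop _ _ i hi
    obtain ⟨p1, g, p2, p3⟩ := h3 v.1 v.2 w.1 w.2 q1 q2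
    have p4 : ∀ j : Fin (t + 1), ∃ o : Option (Fin 3), j.val < f w.1 / b + 1 →
        col w.1 j.val = o.elim (col v.1 j.val) g := by
      intro j
      by_cases hj : j.val < f w.1 / b + 1
      · rcases p3 j.val hj with h | ⟨i, h⟩
        · exact ⟨none, fun _ => h⟩
        · exact ⟨some i, fun _ => h⟩
      · exact ⟨none, fun h => absurd h hj⟩
    choose sel hsel using p4
    refine ⟨⟨(core w).1, ⟨μ w.1 % 16, Nat.mod_lt _ (by norm_num)⟩, fun i => ⟨g i, p2 i⟩, sel,
      ix w⟩, rfl, rfl, p1, ?_, rfl⟩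
    intro j hj
    rw [hcc, hcc]
    exact hsel j hj
  have huniq : ∀ v u w d, gRel (core v) d (core u) (ix u) →
      gRel (core v) d (core w) (ix w) → u = w := by
    rintro v u w d ⟨a1, a2, a3, a4, a5⟩ ⟨b1, b2, b3, b4, b5⟩
    have e1 : f u.1 = f w.1 := congrArg Fin.val (a1.trans b1.symm)
    change |(μ u.1 : ℤ) * 2 ^ f u.1 - (μ v.1 : ℤ) * 2 ^ f v.1| < 6 * 2 ^ f u.1 at a3
    change |(μ w.1 : ℤ) * 2 ^ f w.1 - (μ v.1 : ℤ) * 2 ^ f v.1| < 6 * 2 ^ f w.1 at b3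
    rw [hmv] at a2 b2
    rw [← e1] at b3
    refine hinj u w e1 ?_ ?_ (a5.trans b5.symm)
    · have := gmu_unique (μ u.1) (μ w.1) _ (f u.1) (by omega) a3 b3
      exact_mod_cast this
    · intro j hj
      have hjt : j < t + 1 := by have := hft u; omega
      have k1 := a4 ⟨j, hjt⟩ hj
      have k2 := b4 ⟨j, hjt⟩ (by rw [hfv, ← e1]; exact hj)
      simp only [hcc] at k1 k2
      rw [k1, k2]
  have hdel : ∀ (v : {p : ℤ × ℤ // p ∈ s}) (i : Fin 4), ∃ o : Option (GDelta m b t r),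
      (∀ d, o = some d → ∃ w, G.Adj v w ∧ gRel (core v) d (core w) (ix w)) ∧
      (∀ w, G.Adj v w → w.1 = v.1 + gdir i → ∃ d, o = some d ∧
        gRel (core v) d (core w) (ix w)) := by
    intro v i
    by_cases hw : ∃ w, G.Adj v w ∧ w.1 = v.1 + gdir i
    · obtain ⟨w, w1, w2⟩ := hw
      obtain ⟨d, hd⟩ := hex v w ⟨i, w2⟩
      refine ⟨some d, ?_, ?_⟩
      · intro d' hd'
        obtain rfl := Option.some.inj hd'
        exact ⟨w, w1, hd⟩
      · intro w' _ hw'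
        have : w' = w := Subtype.ext (hw'.trans w2.symm)
        subst this
        exact ⟨d, rfl, hd⟩
    · refine ⟨none, fun d hd => by simp at hd, fun w w1 w2 => absurd ⟨w, w1, w2⟩ hw⟩
  choose del hdel1 hdel2 using hdel
  let l : {p : ℤ × ℤ // p ∈ s} → GLab m b t r := fun v => (core v, ix v, del v)
  have hl1 : ∀ v w, gAdj1 (l v) (l w) → G.Adj v w := by
    rintro v w ⟨i, d, e1, e2⟩
    obtain ⟨u, u1, u2⟩ := hdel1 v i d e1
    rw [huniq v w u d e2 u2]
    exact u1
  refine ⟨l, ?_, ?_⟩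
  · intro v w hvw
    have e1 : core v = core w := congrArg Prod.fst hvw
    have e2 : ix v = ix w := congrArg (fun x => x.2.1) hvw
    refine hinj v w ?_ ?_ ?_ e2
    · rw [← hfv, ← hfv, e1]
    · rw [← hmv, ← hmv, e1]
    · intro j _
      rw [← hcc, ← hcc, e1]
  · intro v w
    constructor
    · rintro (h | h)
      · exact hl1 v w h
      · exact (hl1 w v h).symm
    · intro h
      obtain ⟨q1, q2⟩ := hG v w h
      have hne : v.1 ≠ w.1 := fun e => h.ne (Subtype.ext e)
      rcases gdir_total v.1 w.1 hne q1 q2 with ⟨i, hi⟩ | ⟨i, hi⟩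
      · obtain ⟨d, d1, d2⟩ := hdel2 v i w h hi
        exact Or.inl ⟨i, d, d1, d2⟩
      · obtain ⟨d, d1, d2⟩ := hdel2 w i v h.symm hi
        exact Or.inr ⟨i, d, d1, d2⟩

/-- Double-logarithmic parameter. -/
def glam (m : ℕ) : ℕ := Nat.log 2 m + 1

/-- Block length. -/
def gb (m : ℕ) : ℕ := Nat.sqrt (m * glam m) + 1

/-- Number of blocks. -/
def gt (m : ℕ) : ℕ := m / gb m + 1

/-- Slack in bits. -/
def gr (m : ℕ) : ℕ := 2 * glam m + 6

/-- Label length. -/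
def gF (m : ℕ) : ℕ := m + 250 * gb m

lemma glam_lt (m : ℕ) : m + 1 ≤ 2 ^ glam m := Nat.lt_pow_succ_log_self (by norm_num) m

lemma gF_mono : StrictMono gF := by
  intro a c h
  have h1 : glam a ≤ glam c := Nat.add_le_add_right (Nat.log_mono_right h.le) 1
  have h2 : gb a ≤ gb c := Nat.add_le_add_right (Nat.sqrt_le_sqrt (Nat.mul_le_mul h.le h1)) 1
  unfold gF
  omega

lemma glam_le (m : ℕ) (hm : 1 ≤ m) : glam m ≤ m := by
  have : Nat.log 2 m < m := Nat.log_lt_self 2 (by omega)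
  unfold glam
  omega

lemma gb_sq (m : ℕ) : m * glam m ≤ gb m * gb m := (Nat.lt_succ_sqrt (m * glam m)).le

lemma gb_le (m : ℕ) (hm : 1 ≤ m) : gb m ≤ m + 1 := by
  unfold gb
  have h1 : Nat.sqrt (m * glam m) ≤ Nat.sqrt (m * m) :=
    Nat.sqrt_le_sqrt (Nat.mul_le_mul_left _ (glam_le m hm))
  rw [Nat.sqrt_eq] at h1
  omega

lemma glam_le_gb (m : ℕ) (hm : 1 ≤ m) : glam m ≤ gb m := by
  have h1 := gb_sq m
  have h2 := glam_le m hm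
  by_contra h
  push Not at h
  nlinarith

lemma gt_lam (m : ℕ) (hm : 1 ≤ m) : (gt m + 1) * glam m ≤ 3 * gb m := by
  have hb : 0 < gb m := Nat.succ_pos _
  have h1 : m / gb m * glam m ≤ gb m := by
    have h2 : gb m * (m / gb m) ≤ m := Nat.mul_div_le m (gb m)
    have h3 := gb_sq m
    refine Nat.le_of_mul_le_mul_left ?_ hb
    calc gb m * (m / gb m * glam m) = gb m * (m / gb m) * glam m := by ring
      _ ≤ m * glam m := Nat.mul_le_mul_right _ h2
      _ ≤ _ := h3
  have h2 := glam_le_gb m hm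
  unfold gt
  nlinarith

lemma glab_card' (m : ℕ) (hm : 1 ≤ m) :
    Fintype.card (GLab m (gb m) (gt m) (gr m)) ≤ 2 ^ gF m := by
  refine (glab_card m (gb m) (gt m) (gr m) (glam m) (glam_lt m)).trans ?_
  apply Nat.pow_le_pow_right (by norm_num)
  have h1 := gt_lam m hm
  have h2 := glam_le_gb m hm
  have h3 : 1 ≤ glam m := Nat.succ_le_succ (Nat.zero_le _)
  have h5 : gt m + 1 ≤ (gt m + 1) * glam m := Nat.le_mul_of_pos_right _ h3
  have h4 : gr m * (gt m + 1) ≤ 8 * ((gt m + 1) * glam m) := by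
    unfold gr
    nlinarith
  have h6 : gr m ≤ 8 * glam m := by unfold gr; omega
  unfold gF
  omega

lemma gal_param (m : ℕ) (hm : 1 ≤ m) (s : Finset (ℤ × ℤ)) (hs : s.card ≤ 2 ^ m)
    (G : SimpleGraph {p : ℤ × ℤ // p ∈ s})
    (hG : ∀ u v : {p : ℤ × ℤ // p ∈ s}, G.Adj u v →
            |u.1.1 - v.1.1| ≤ 1 ∧ |u.1.2 - v.1.2| ≤ 1) :
    ∃ l : {p : ℤ × ℤ // p ∈ s} → GLab m (gb m) (gt m) (gr m), Function.Injective l ∧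
      ∀ v w, (gAdj1 (l v) (l w) ∨ gAdj1 (l w) (l v)) ↔ G.Adj v w := by
  have hb : 1 ≤ gb m := Nat.succ_le_succ (Nat.zero_le _)
  have hbm := gb_le m hm
  have htm : gt m ≤ m + 1 := Nat.add_le_add_right (Nat.div_le_self _ _) 1
  have hp : 64 * ((m + 1) * (m + 1)) ≤ 2 ^ gr m := by
    have h1 := glam_lt m
    have : 2 ^ gr m = 64 * (2 ^ glam m * 2 ^ glam m) := by
      unfold gr
      rw [pow_add, two_mul, pow_add]
      ring
    rw [this]
    exact Nat.mul_le_mul_left _ (Nat.mul_le_mul h1 h1)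
  refine gal_lab m (gb m) (gt m) (gr m) (5 * m + gb m + 4) hb rfl ?_ ?_ ?_ s hs G hG
  · refine le_trans ?_ hp
    have : (2 * gt m + 3) * (gt m + 1) ≤ (2 * (m + 1) + 3) * (m + 1 + 1) :=
      Nat.mul_le_mul (by omega) (by omega)
    nlinarith
  · have h1 : gt m + 1 ≤ 2 * 2 ^ m := by
      have := Nat.lt_two_pow_self (n := m)
      omega
    have h2 : 2 ^ gb m + 1 ≤ 2 * 2 ^ gb m := by
      have := Nat.one_le_two_pow (n := gb m)
      omega
    calc 3 * ((2 ^ m) ^ 4 * ((gt m + 1) * (2 ^ gb m + 1)))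
        ≤ 16 / 4 * ((2 ^ m) ^ 4 * ((2 * 2 ^ m) * (2 * 2 ^ gb m))) :=
          Nat.mul_le_mul (by norm_num) (Nat.mul_le_mul_left _ (Nat.mul_le_mul h1 h2))
      _ = 2 ^ (5 * m + gb m + 4) := by
          rw [pow_add, pow_add, mul_comm 5 m, pow_mul]
          norm_num
          ring
  · refine lt_of_lt_of_le ?_ hp
    have : (gt m + 1) * (5 * m + gb m + 4) ≤ (m + 1 + 1) * (5 * m + (m + 1) + 4) :=
      Nat.mul_le_mul (by omega) (by omega)
    nlinarith

lemma gal_enc (m : ℕ) : ∃ e : GLab m (gb m) (gt m) (gr m) → List Bool,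
    1 ≤ m → (Function.Injective e ∧ ∀ x, (e x).length = gF m) := by
  by_cases hm : 1 ≤ m
  · have h : Fintype.card (GLab m (gb m) (gt m) (gr m)) ≤ Fintype.card (Fin (gF m) → Bool) := by
      refine (glab_card' m hm).trans ?_
      simp
    obtain ⟨e⟩ := Function.Embedding.nonempty_of_card_le h
    refine ⟨fun x => List.ofFn (e x), fun _ => ⟨?_, fun x => by simp⟩⟩
    intro x y hxy
    exact e.injective (List.ofFn_injective hxy)
  · exact ⟨fun _ => [], fun h => absurd h hm⟩

lemma gal_real (n : ℕ) (hn : 2 ≤ n) : (gF (Nat.clog 2 n) : ℝ) ≤ Real.logb 2 n +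
    2000 * Real.sqrt (Real.logb 2 n * Real.logb 2 (Real.logb 2 n + 2)) := by
  set m := Nat.clog 2 n with hmdef
  set X := Real.logb 2 n with hX
  set Y := Real.logb 2 (X + 2) with hY
  have hn0 : (0 : ℝ) < n := by positivity
  have hX1 : 1 ≤ X := by
    rw [hX, Real.le_logb_iff_rpow_le (by norm_num) hn0]
    norm_num
    exact_mod_cast hn
  have hY1 : 1 ≤ Y := by
    rw [hY, Real.le_logb_iff_rpow_le (by norm_num) (by linarith)]
    norm_num
    linarith
  have hm1 : 1 ≤ m := Nat.clog_pos (by norm_num) hn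
  have hmX : (m : ℝ) ≤ X + 1 := by
    have h1 : 2 ^ m.pred < n := Nat.pow_pred_clog_lt_self (by norm_num) (by omega)
    have h2 : ((m - 1 : ℕ) : ℝ) ≤ X := by
      rw [hX, Real.le_logb_iff_rpow_le (by norm_num) hn0, Real.rpow_natCast]
      exact_mod_cast h1.le
    have h3 : (m : ℝ) = ((m - 1 : ℕ) : ℝ) + 1 := by
      exact_mod_cast (by omega : m = m - 1 + 1)
    linarith
  have hlY : (glam m : ℝ) ≤ Y + 1 := by
    have h1 : 2 ^ Nat.log 2 m ≤ m := Nat.pow_log_le_self 2 (by omega)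
    have h2 : ((Nat.log 2 m : ℕ) : ℝ) ≤ Y := by
      rw [hY, Real.le_logb_iff_rpow_le (by norm_num) (by linarith), Real.rpow_natCast]
      have : ((2 ^ Nat.log 2 m : ℕ) : ℝ) ≤ m := by exact_mod_cast h1
      push_cast at this
      linarith
    unfold glam
    push_cast
    linarith
  have hXY : 1 ≤ X * Y := by nlinarith
  set S := Real.sqrt (X * Y) with hS
  have hS1 : 1 ≤ S := by rw [hS, Real.one_le_sqrt]; exact hXY
  have hSS : S * S = X * Y := Real.mul_self_sqrt (by linarith)
  have hb : (Nat.sqrt (m * glam m) : ℝ) ≤ 2 * S := by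
    have h1 : Nat.sqrt (m * glam m) * Nat.sqrt (m * glam m) ≤ m * glam m := Nat.sqrt_le _
    have h2 : (Nat.sqrt (m * glam m) : ℝ) * Nat.sqrt (m * glam m) ≤ m * glam m := by
      exact_mod_cast h1
    have h3 : (m : ℝ) * glam m ≤ (2 * X) * (2 * Y) :=
      mul_le_mul (by linarith) (by linarith) (by positivity) (by linarith)
    refine abs_le_of_sq_le_sq' ?_ (by linarith) |>.2
    nlinarith
  unfold gF gb
  push_cast
  linarith

/-- adjacency labelling for subgraphs of the grid with diagonals:
there are a constant `C > 0` and a universal adjacency decoder `A` such that every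
`n`-vertex graph (`n ≥ 2`) on points of `ℤ × ℤ` whose edges join points differing by at
most 1 in each coordinate has an injective labelling by bit strings of length at most
`log₂ n + C·√(log₂ n · log₂(log₂ n + 2))` from which `A` decides adjacency. -/
theorem grid_adjacency_labelling :
    ∃ C : ℝ, 0 < C ∧ ∃ A : List Bool → List Bool → Bool,
      ∀ n : ℕ, 2 ≤ n → ∀ s : Finset (ℤ × ℤ), s.card = n →
        ∀ G : SimpleGraph {p : ℤ × ℤ // p ∈ s},
          (∀ u v : {p : ℤ × ℤ // p ∈ s}, G.Adj u v →
            |u.1.1 - v.1.1| ≤ 1 ∧ |u.1.2 - v.1.2| ≤ 1) →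
          ∃ ℓ : {p : ℤ × ℤ // p ∈ s} → List Bool, Function.Injective ℓ ∧
            (∀ v, ((ℓ v).length : ℝ) ≤
              Real.logb 2 n +
                C * Real.sqrt (Real.logb 2 n * Real.logb 2 (Real.logb 2 n + 2))) ∧
            (∀ v w, v ≠ w → (A (ℓ v) (ℓ w) = true ↔ G.Adj v w)) := by
  choose e he using gal_enc
  refine ⟨2000, by norm_num, fun l₁ l₂ => decide (∃ m, 1 ≤ m ∧ ∃ x y, e m x = l₁ ∧ e m y = l₂ ∧
    (gAdj1 x y ∨ gAdj1 y x)), ?_⟩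
  intro n hn s hs G hG
  have hm : 1 ≤ Nat.clog 2 n := Nat.clog_pos (by norm_num) hn
  obtain ⟨l, hl1, hl2⟩ := gal_param (Nat.clog 2 n) hm s
    (by rw [hs]; exact Nat.le_pow_clog (by norm_num) n) G hG
  refine ⟨fun v => e _ (l v), fun v w h => hl1 ((he _ hm).1 h), ?_, ?_⟩
  · intro v
    rw [(he _ hm).2]
    exact gal_real n hn
  · intro v w _
    rw [decide_eq_true_iff, ← hl2 v w]
    constructor
    · rintro ⟨m', hm', x, y, hx, hy, hxy⟩
      have hmm : m' = Nat.clog 2 n := by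
        apply gF_mono.injective
        rw [← (he _ hm').2 x, hx, (he _ hm).2]
      subst hmm
      rw [← (he _ hm).1 hx, ← (he _ hm).1 hy]
      exact hxy
    · intro h
      exact ⟨_, hm, _, _, rfl, rfl, h⟩
end

section
/- For every integer t ≥ 1, there exist a constant C > 0 and a function A : {0,1}* × {0,1}* → {0,1} such that for every integer n ≥ 2 and every finite simple graph G with exactly n vertices that is a subgraph of H ⊠ P for some t-tree H and some path P (i.e., V(G) ⊆ V(H) × V(P) and E(G) ⊆ E(H ⊠ P)), there exists an injective labelling ℓ : V(G) → {0,1}* with |ℓ(v)| ≤ log₂ n + C·√(log₂ n · log₂(log₂ n + 2)) for every vertex v, and such that for all distinct vertices v, w of G, A(ℓ(v), ℓ(w)) = 1 if and only if vw ∈ E(G). -/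
attribute [local instance] Classical.propDecidable

/-- `H` is a `t`-tree: there is an ordering of the vertices (an equivalence with
`Fin (card V)`) such that, for every vertex `v`, the neighbours of `v` coming earlier
in the ordering form a clique of size at most `t` in `H`. -/
def IsTTree (t : ℕ) {V : Type*} [Fintype V] (H : SimpleGraph V) : Prop :=
  ∃ e : V ≃ Fin (Fintype.card V),
    ∀ v : V, H.IsClique {w | H.Adj v w ∧ e w < e v} ∧
      {w | H.Adj v w ∧ e w < e v}.ncard ≤ t

namespace SPAL

/-! ### Part 1: interval representations of chordal graphs of small clique number -/

section Rep
variable {V : Type} (H : SimpleGraph V)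

/-- `Y` induces a connected subgraph. -/
def Ind (Y : Finset V) : Prop :=
  ∀ A, A ⊆ Y → A.Nonempty → (Y \ A).Nonempty → ∃ a ∈ A, ∃ b ∈ Y \ A, H.Adj a b

/-- `X` has an interval representation with point-depth at most `D`. -/
def Rep (X : Finset V) (D : ℕ) : Prop :=
  ∃ a b : V → ℕ, (∀ z ∈ X, a z ≤ b z) ∧ (∀ z ∈ X, ∀ z' ∈ X, H.Adj z z' → a z ≤ b z') ∧
    ∀ q, (X.filter (fun z => a z ≤ q ∧ q ≤ b z)).card ≤ D

lemma rep_union {X Y : Finset V} {D : ℕ} (hX : Rep H X D) (hY : Rep H Y D)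
    (hd : Disjoint X Y) (hno : ∀ x ∈ X, ∀ y ∈ Y, ¬ H.Adj x y) : Rep H (X ∪ Y) D := by
  obtain ⟨a, b, h1, h2, h3⟩ := hX
  obtain ⟨a', b', h1', h2', h3'⟩ := hY
  set l := X.sup b + 1 with hl
  have hb : ∀ z ∈ X, b z < l := fun z hz => Nat.lt_succ_of_le (Finset.le_sup hz)
  have hdis : ∀ z ∈ Y, z ∉ X := fun z hz hx => (Finset.disjoint_left.mp hd hx hz)
  refine ⟨fun z => if z ∈ X then a z else l + a' z,
    fun z => if z ∈ X then b z else l + b' z, ?_, ?_, ?_⟩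
  · intro z hz
    rcases Finset.mem_union.mp hz with h | h
    · simp [h, h1 z h]
    · simp [hdis z h, h1' z h]
  · intro z hz z' hz' hadj
    rcases Finset.mem_union.mp hz with h | h <;> rcases Finset.mem_union.mp hz' with h' | h'
    · simp [h, h', h2 z h z' h' hadj]
    · exact absurd hadj (hno _ h _ h')
    · exact absurd hadj.symm (hno _ h' _ h)
    · simp [hdis z h, hdis z' h', h2' z h z' h' hadj]
  · intro q
    by_cases hq : q < l
    · refine le_trans (Finset.card_le_card ?_) (h3 q)
      intro z hz
      simp only [Finset.mem_filter, Finset.mem_union] at hz ⊢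
      obtain ⟨hz, hz1, hz2⟩ := hz
      by_cases h : z ∈ X
      · simp only [h, if_true] at hz1 hz2
        exact ⟨h, hz1, hz2⟩
      · simp only [h, if_false] at hz1 hz2
        omega
    · refine le_trans (Finset.card_le_card ?_) (h3' (q - l))
      intro z hz
      simp only [Finset.mem_filter, Finset.mem_union] at hz ⊢
      obtain ⟨hz, hz1, hz2⟩ := hz
      by_cases h : z ∈ X
      · simp only [h, if_true] at hz1 hz2
        have := hb z h
        omega
      · simp only [h, if_false] at hz1 hz2
        refine ⟨by tauto, by omega, by omega⟩

lemma rep_add {X K : Finset V} {D c : ℕ} (hX : Rep H (X \ K) D) (hK : K.card ≤ c) :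
    Rep H X (D + c) := by
  obtain ⟨a, b, h1, h2, h3⟩ := hX
  set l := X.sup b + X.sup a with hl
  have hb : ∀ z ∈ X, b z ≤ l := fun z hz => le_trans (Finset.le_sup hz) (Nat.le_add_right _ _)
  have ha : ∀ z ∈ X, a z ≤ l := fun z hz => le_trans (Finset.le_sup hz) (Nat.le_add_left _ _)
  refine ⟨fun z => if z ∈ K then 0 else a z, fun z => if z ∈ K then l else b z, ?_, ?_, ?_⟩
  · intro z hz
    by_cases h : z ∈ K
    · simp [h]
    · simpa [h] using h1 z (by simp [h, hz])
  · intro z hz z' hz' hadj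
    by_cases h : z ∈ K
    · simp [h]
    · by_cases h' : z' ∈ K
      · simpa [h, h'] using ha z hz
      · simpa [h, h'] using h2 z (by simp [h, hz]) z' (by simp [h', hz']) hadj
  · intro q
    refine le_trans (Finset.card_le_card (t := ((X \ K).filter
      (fun z => a z ≤ q ∧ q ≤ b z)) ∪ K) ?_) (le_trans (Finset.card_union_le _ _)
        (Nat.add_le_add (h3 q) hK))
    intro z hz
    simp only [Finset.mem_filter, Finset.mem_union, Finset.mem_sdiff] at hz ⊢
    obtain ⟨hz, hz1, hz2⟩ := hz
    by_cases h : z ∈ K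
    · exact Or.inr h
    · simp only [h, if_false] at hz1 hz2
      exact Or.inl ⟨⟨hz, h⟩, hz1, hz2⟩

variable (e : V → ℕ) (he : Function.Injective e)
  (hcl : ∀ g u w, H.Adj g u → H.Adj g w → e u < e g → e w < e g → u ≠ w → H.Adj u w)

include he hcl in
lemma ind_erase {Y : Finset V} (hY : Ind H Y) {g : V} (hg : g ∈ Y) (hmax : ∀ y ∈ Y, e y ≤ e g) :
    Ind H (Y.erase g) := by
  intro A hA hne hne'
  have hlt : ∀ y ∈ Y.erase g, e y < e g := fun y hy =>
    lt_of_le_of_ne (hmax y (Finset.mem_of_mem_erase hy))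
      (fun h => (Finset.ne_of_mem_erase hy) (he h))
  have hgA : g ∉ A := fun h => by simpa using hA h
  by_contra hcon
  push Not at hcon
  obtain ⟨a1, ha1, b1, hb1, hab1⟩ := hY A (hA.trans (Finset.erase_subset _ _)) hne
    ⟨g, by simp [hg, hgA]⟩
  have hb1g : b1 = g := by
    by_contra h
    refine hcon a1 ha1 b1 ?_ hab1
    simp only [Finset.mem_sdiff, Finset.mem_erase] at hb1 ⊢
    tauto
  subst hb1g
  obtain ⟨b0, hb0⟩ := hne'
  obtain ⟨a2, ha2, b2, hb2, hab2⟩ := hY (insert b1 A) (by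
      intro x hx
      rcases Finset.mem_insert.mp hx with h | h
      · rw [h]; exact hg
      · exact Finset.mem_of_mem_erase (hA h)) ⟨b1, by simp⟩
    ⟨b0, by
      simp only [Finset.mem_sdiff, Finset.mem_erase, Finset.mem_insert] at hb0 ⊢
      tauto⟩
  have hb2' : b2 ∈ Y.erase b1 \ A := by
    simp only [Finset.mem_sdiff, Finset.mem_erase, Finset.mem_insert] at hb2 ⊢
    tauto
  rcases Finset.mem_insert.mp ha2 with h | h
  · subst h
    have h1 := hlt a1 (hA ha1)
    have h2 := hlt b2 (Finset.mem_sdiff.mp hb2').1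
    refine hcon a1 ha1 b2 hb2' (hcl a2 a1 b2 hab1.symm hab2 h1 h2 ?_)
    rintro rfl
    exact (Finset.mem_sdiff.mp hb2').2 ha1
  · exact hcon a2 h b2 hb2' hab2

include he hcl in
lemma ind_low (n : ℕ) : ∀ Y : Finset V, Y.card = n → Ind H Y → ∀ v ∈ Y, (∀ y ∈ Y, e v ≤ e y) →
    ∀ w, e w < e v → ∀ u ∈ Y, H.Adj u w → H.Adj v w := by
  induction n with
  | zero =>
    intro Y hc _ v hv
    rw [Finset.card_eq_zero.mp hc] at hv
    simp at hv
  | succ n ih =>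
    intro Y hc hY v hv hmin w hw u hu huw
    obtain ⟨g, hg, hmax⟩ := Finset.exists_max_image Y e ⟨v, hv⟩
    by_cases hvg : v = g
    · subst hvg
      have : u = v := he (le_antisymm (hmax u hu) (hmin u hu))
      rwa [this] at huw
    · have hv' : v ∈ Y.erase g := Finset.mem_erase.mpr ⟨hvg, hv⟩
      have key := ih (Y.erase g) (by rw [Finset.card_erase_of_mem hg, hc]; rfl)
        (ind_erase H e he hcl hY hg hmax) v hv' (fun y hy => hmin y (Finset.mem_of_mem_erase hy))
        w hw
      by_cases hug : u = g
      · subst hug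
        obtain ⟨a, ha, b, hb, hab⟩ := hY {u} (by simpa using hu) ⟨u, by simp⟩
          ⟨v, by simp [hv, hvg]⟩
        have hau : a = u := by simpa using ha
        subst hau
        have hb' : b ∈ Y ∧ b ≠ a := by simpa using hb
        refine key b (Finset.mem_erase.mpr ⟨hb'.2, hb'.1⟩) ?_
        have hbw : e w < e b := lt_of_lt_of_le hw (hmin b hb'.1)
        refine hcl a b w hab huw (lt_of_le_of_ne (hmax b hb'.1) (fun h => hb'.2 (he h)))
          (lt_of_lt_of_le hbw (hmax b hb'.1)) ?_
        rintro rfl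
        exact lt_irrefl _ hbw
      · exact key u (Finset.mem_erase.mpr ⟨hug, hu⟩) huw

lemma ind_insert {Y : Finset V} (hY : Ind H Y) {u w : V} (hu : u ∈ Y) (h : H.Adj u w) :
    Ind H (insert w Y) := by
  intro A hA hne hne'
  by_cases hwY : w ∈ Y
  · rw [Finset.insert_eq_of_mem hwY] at *
    exact hY A hA hne hne'
  by_cases h1 : (A ∩ Y).Nonempty
  · by_cases h2 : (Y \ (A ∩ Y)).Nonempty
    · obtain ⟨a, ha, b, hb, hab⟩ := hY (A ∩ Y) Finset.inter_subset_right h1 h2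
      refine ⟨a, (Finset.mem_inter.mp ha).1, b, ?_, hab⟩
      simp only [Finset.mem_sdiff, Finset.mem_inter, Finset.mem_insert] at hb ⊢
      tauto
    · rw [Finset.not_nonempty_iff_eq_empty, Finset.sdiff_eq_empty_iff_subset] at h2
      obtain ⟨b, hb⟩ := hne'
      have huA : u ∈ A := (Finset.mem_inter.mp (h2 hu)).1
      have hbw : b = w := by
        simp only [Finset.mem_sdiff, Finset.mem_insert] at hb
        rcases hb.1 with h' | h'
        · exact h'
        · exact absurd (Finset.mem_inter.mp (h2 h')).1 hb.2
      exact ⟨u, huA, b, hb, by rw [hbw]; exact h⟩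
  · rw [Finset.not_nonempty_iff_eq_empty] at h1
    have hno : ∀ x ∈ A, x ∉ Y := fun x hx hy => by
      have : x ∈ A ∩ Y := Finset.mem_inter.mpr ⟨hx, hy⟩
      rw [h1] at this; simp at this
    obtain ⟨a, ha⟩ := hne
    have haw : a = w := by
      rcases Finset.mem_insert.mp (hA ha) with h' | h'
      · exact h'
      · exact absurd h' (hno a ha)
    refine ⟨a, ha, u, ?_, by rw [haw]; exact h.symm⟩
    simp only [Finset.mem_sdiff, Finset.mem_insert]
    exact ⟨Or.inr hu, fun h' => hno u h' hu⟩

include he hcl in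
lemma exists_sep {t : ℕ} (ht : ∀ v : V, ∀ S : Finset V, (∀ w ∈ S, H.Adj v w ∧ e w < e v) →
      S.card ≤ t) (X : Finset V) :
    ∃ K : Finset V, K.card ≤ t + 1 ∧ ∀ Y, Y ⊆ X \ K → Ind H Y → 2 * Y.card ≤ X.card := by
  by_cases hex : ∃ Y, Y ⊆ X ∧ Ind H Y ∧ X.card < 2 * Y.card
  swap
  · push Not at hex
    exact ⟨∅, by simp, fun Y hY hI => hex Y (by simpa using hY) hI⟩
  -- candidates: pairs (v, Y)
  let P : Finset (V × Finset V) := (X ×ˢ X.powerset).filter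
    (fun p => p.1 ∈ p.2 ∧ Ind H p.2 ∧ X.card < 2 * p.2.card ∧ ∀ y ∈ p.2, e p.1 ≤ e y)
  have hmk : ∀ Y, Y ⊆ X → Ind H Y → X.card < 2 * Y.card → ∃ v, (v, Y) ∈ P := by
    intro Y hY hI hc
    have hne : Y.Nonempty := by
      rw [← Finset.card_pos]; omega
    obtain ⟨v, hv, hmin⟩ := Finset.exists_min_image Y e hne
    refine ⟨v, ?_⟩
    simp only [P, Finset.mem_filter, Finset.mem_product, Finset.mem_powerset]
    exact ⟨⟨hY hv, hY⟩, hv, hI, hc, hmin⟩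
  have hPne : P.Nonempty := by
    obtain ⟨Y, h1, h2, h3⟩ := hex
    obtain ⟨v, hv⟩ := hmk Y h1 h2 h3
    exact ⟨_, hv⟩
  obtain ⟨⟨v0, Y0⟩, hp0, hmax0⟩ := Finset.exists_max_image P (fun p => e p.1) hPne
  obtain ⟨⟨v, Y⟩, hp, hmax⟩ := Finset.exists_max_image (P.filter (fun p => e p.1 = e v0))
    (fun p => p.2.card) ⟨(v0, Y0), by simp [hp0]⟩
  simp only [Finset.mem_filter] at hp hmax
  obtain ⟨hpP, hev⟩ := hp
  have hpP' := hpP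
  simp only [P, Finset.mem_filter, Finset.mem_product, Finset.mem_powerset] at hpP'
  obtain ⟨⟨hvX, hYX⟩, hvY, hI, hbig, hmin⟩ := hpP'
  refine ⟨insert v (X.filter (fun w => H.Adj v w ∧ e w < e v)), ?_, ?_⟩
  · refine le_trans (Finset.card_insert_le _ _) (Nat.add_le_add_right (ht v _ ?_) 1)
    intro w hw
    exact (Finset.mem_filter.mp hw).2
  · intro Y' hY' hI'
    by_contra hc
    push Not at hc
    have hY'X : Y' ⊆ X := hY'.trans Finset.sdiff_subset
    obtain ⟨v', hv'⟩ := hmk Y' hY'X hI' hc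
    have hle : e v' ≤ e v := by rw [hev]; exact hmax0 _ hv'
    simp only [P, Finset.mem_filter, Finset.mem_product, Finset.mem_powerset] at hv'
    have hvY' : v ∉ Y' := fun h => by
      have := hY' h
      simp at this
    have hlt : e v' < e v := lt_of_le_of_ne hle (fun h => hvY' (he h ▸ hv'.2.1))
    have hv'Y : v' ∉ Y := fun h => absurd (hmin v' h) (by omega)
    have h_meet : (Y' ∩ Y).Nonempty := by
      rw [← Finset.card_pos]
      have h1 := Finset.card_union_add_card_inter Y' Y
      have h2 := Finset.card_le_card (Finset.union_subset hY'X hYX)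
      omega
    obtain ⟨u, hu, w, hw, huw⟩ := hI' (Y' ∩ Y) Finset.inter_subset_left h_meet
      ⟨v', by simp [hv'.2.1, hv'Y]⟩
    have huY := (Finset.mem_inter.mp hu).2
    have hwY' : w ∈ Y' := (Finset.mem_sdiff.mp hw).1
    have hwY : w ∉ Y := fun h => (Finset.mem_sdiff.mp hw).2 (Finset.mem_inter.mpr ⟨hwY', h⟩)
    have hwv : w ≠ v := fun h => hvY' (h ▸ hwY')
    rcases lt_trichotomy (e w) (e v) with h | h | h
    · have hadj := ind_low H e he hcl _ Y rfl hI v hvY hmin w h u huY huw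
      have := hY' hwY'
      simp only [Finset.mem_sdiff, Finset.mem_insert, Finset.mem_filter] at this
      exact this.2 (Or.inr ⟨this.1, hadj, h⟩)
    · exact hwv (he h)
    · have := hmax (v, insert w Y) ⟨by
        simp only [P, Finset.mem_filter, Finset.mem_product, Finset.mem_powerset]
        refine ⟨⟨hvX, Finset.insert_subset (hY'X hwY') hYX⟩, Finset.mem_insert_of_mem hvY,
          ind_insert H hI huY huw, ?_, ?_⟩
        · rw [Finset.card_insert_of_notMem hwY]; omega
        · intro y hy
          rcases Finset.mem_insert.mp hy with rfl | hy
          · exact h.le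
          · exact hmin y hy, hev⟩
      simp only at this
      rw [Finset.card_insert_of_notMem hwY] at this
      omega

include he hcl in
lemma rep_exists {t : ℕ} (ht : ∀ v : V, ∀ S : Finset V, (∀ w ∈ S, H.Adj v w ∧ e w < e v) →
      S.card ≤ t) (d : ℕ) : ∀ n, ∀ X : Finset V, X.card ≤ n →
      (∀ Y, Y ⊆ X → Ind H Y → Y.card < 2 ^ d) → Rep H X ((t + 1) * d) := by
  induction d with
  | zero =>
    intro n X _ hX
    have : X = ∅ := by
      by_contra h
      obtain ⟨x, hx⟩ := Finset.nonempty_iff_ne_empty.mpr h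
      have := hX {x} (by simpa using hx) (by
        intro A hA ⟨a, ha⟩ ⟨b, hb⟩
        exfalso
        have h1 : a = x := by simpa using hA ha
        have h2 : b = x ∧ b ∉ A := by simpa using hb
        exact h2.2 (by rw [h2.1, ← h1]; exact ha))
      simp at this
    subst this
    exact ⟨fun _ => 0, fun _ => 0, by simp, by simp, by simp⟩
  | succ d ihd =>
    intro n
    induction n with
    | zero =>
      intro X hX _
      have : X = ∅ := Finset.card_eq_zero.mp (by omega)
      subst this
      exact ⟨fun _ => 0, fun _ => 0, by simp, by simp, by simp⟩
    | succ n ih =>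
      intro X hX hXc
      by_cases hI : Ind H X
      · obtain ⟨K, hK, hs⟩ := exists_sep H e he hcl ht X
        have := ihd _ (X \ K) le_rfl (by
          intro Y hY hYI
          have h1 := hs Y hY hYI
          have h2 := hXc X subset_rfl hI
          rw [pow_succ] at h2
          omega)
        have h2 := rep_add H this hK
        rw [mul_add, mul_one]
        exact h2
      · unfold Ind at hI
        push Not at hI
        obtain ⟨A, hA, hne, hne', hno⟩ := hI
        have hc := Finset.card_sdiff_add_card_eq_card hA
        have h1 := Finset.card_pos.mpr hne
        have h2 := Finset.card_pos.mpr hne'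
        have r1 := ih A (by omega) (fun Y hY => hXc Y (hY.trans hA))
        have r2 := ih (X \ A) (by omega) (fun Y hY => hXc Y (hY.trans Finset.sdiff_subset))
        have := rep_union H r1 r2 Finset.disjoint_sdiff hno
        rwa [Finset.union_sdiff_of_subset hA] at this

end Rep

/-! ### Part 2: slowly changing hierarchical partitions of the line -/

/-- Mass of the interval `[a, b)`. -/
noncomputable def mass (f : ℕ → ℝ) (a b : ℕ) : ℝ := ∑ j ∈ Finset.Ico a b, f j

lemma mass_nonneg {f : ℕ → ℝ} (hf : ∀ j, 0 ≤ f j) (a b : ℕ) : 0 ≤ mass f a b :=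
  Finset.sum_nonneg (fun j _ => hf j)

lemma mass_add (f : ℕ → ℝ) {a b c : ℕ} (h1 : a ≤ b) (h2 : b ≤ c) :
    mass f a b + mass f b c = mass f a c :=
  Finset.sum_Ico_consecutive f h1 h2

lemma mass_mono {f : ℕ → ℝ} (hf : ∀ j, 0 ≤ f j) {a b a' b' : ℕ} (h1 : a' ≤ a) (h2 : b ≤ b') :
    mass f a b ≤ mass f a' b' :=
  Finset.sum_le_sum_of_subset_of_nonneg (Finset.Ico_subset_Ico h1 h2) (fun j _ _ => hf j)

/-- Cells ended by a cut are heavy. -/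
def Heavy (f : ℕ → ℝ) (Y : Finset ℕ) (τ : ℝ) : Prop :=
  ∀ c ∈ Y, ∀ p, (p = 0 ∨ p ∈ Y) → p < c → τ ≤ mass f p c

/-- All cells are light. -/
def Light (f : ℕ → ℝ) (Y : Finset ℕ) (U : ℝ) : Prop :=
  ∀ a b, (∀ c ∈ Y, ¬ (a < c ∧ c < b)) → mass f a b ≤ U

lemma greedy_aux {f : ℕ → ℝ} {W : Finset ℕ} {τ V : ℝ} (hτ : 0 < τ)
    (hU : Light f W V) (a b : ℕ) (hab : a ≤ b)
    (h : ∀ w ∈ W, a < w → w < b → mass f a w < τ) : mass f a b < τ + V := by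
  have hne : (insert a (W.filter (fun c => a < c ∧ c < b))).Nonempty := ⟨a, by simp⟩
  obtain ⟨w0, hw0, hmax⟩ := Finset.exists_max_image _ (fun c : ℕ => c) hne
  have h1 : mass f a w0 < τ ∧ a ≤ w0 ∧ w0 ≤ b := by
    rcases Finset.mem_insert.mp hw0 with rfl | h'
    · simp [mass, hτ, hab]
    · simp only [Finset.mem_filter] at h'
      exact ⟨h w0 h'.1 h'.2.1 h'.2.2, h'.2.1.le, h'.2.2.le⟩
  have h2 : mass f w0 b ≤ V := by
    apply hU
    rintro c hc ⟨hc1, hc2⟩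
    have := hmax c (Finset.mem_insert_of_mem (Finset.mem_filter.mpr
      ⟨hc, lt_of_le_of_lt h1.2.1 hc1, hc2⟩))
    omega
  rw [← mass_add f h1.2.1 h1.2.2]
  linarith [h1.1]

lemma greedy {f : ℕ → ℝ} (hf : ∀ j, 0 ≤ f j) {Z W : Finset ℕ} (hZW : Z ⊆ W) {τ V : ℝ} (hτ : 0 < τ)
    (hV : 0 ≤ V)
    (hL : Heavy f Z τ) (hU : Light f W V) :
    ∃ Y, Z ⊆ Y ∧ Y ⊆ W ∧ Heavy f Y τ ∧ Light f Y (2 * τ + V) := by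
  obtain ⟨Y, hY, hmax⟩ := Finset.exists_max_image
    (W.powerset.filter (fun Y => Z ⊆ Y ∧ Heavy f Y τ)) Finset.card
    ⟨Z, by simp [hZW, hL]⟩
  simp only [Finset.mem_filter, Finset.mem_powerset] at hY hmax
  obtain ⟨hYW, hZY, hYL⟩ := hY
  refine ⟨Y, hZY, hYW, hYL, ?_⟩
  intro a b hno
  by_contra hcon
  push Not at hcon
  have hab : a < b := by
    by_contra h
    have : mass f a b = 0 := by simp [mass, Finset.Ico_eq_empty_of_le (not_lt.mp h)]
    linarith
  have hex : ∃ w, w ∈ W ∧ a < w ∧ w < b ∧ τ ≤ mass f a w := by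
    by_contra hne
    push Not at hne
    have := greedy_aux hτ hU a b hab.le hne
    linarith
  obtain ⟨hwW, haw, hwb, hmw⟩ := Nat.find_spec hex
  set w := Nat.find hex
  have h1 : mass f a w < τ + V := by
    refine greedy_aux hτ hU a w haw.le ?_
    intro x hxW hax hxw
    by_contra hx
    exact Nat.find_min hex hxw ⟨hxW, hax, hxw.trans hwb, not_lt.mp hx⟩
  have h2 : τ ≤ mass f w b := by
    have := mass_add f haw.le hwb.le
    linarith
  have hwY : w ∉ Y := fun h => hno w h ⟨haw, hwb⟩
  have := hmax (insert w Y) ⟨Finset.insert_subset hwW hYW,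
    hZY.trans (Finset.subset_insert _ _), by
      intro c hc p hp hpc
      rcases Finset.mem_insert.mp hc with rfl | hc
      · have hpa : p ≤ a := by
          rcases hp with rfl | hp
          · omega
          · rcases Finset.mem_insert.mp hp with h | hp
            · omega
            · have := hno p hp
              omega
        exact hmw.trans (mass_mono hf hpa le_rfl)
      · have hpY : (p = 0 ∨ p ∈ Y) ∨ p = w := by
          rcases hp with h | h
          · exact Or.inl (Or.inl h)
          · rcases Finset.mem_insert.mp h with h | h
            · exact Or.inr h
            · exact Or.inl (Or.inr h)
        rcases hpY with h | rfl
        · exact hYL c hc p h hpc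
        · have hcb : b ≤ c := by
            have := hno c hc
            omega
          exact h2.trans (mass_mono hf le_rfl hcb)⟩
  rw [Finset.card_insert_of_notMem hwY] at this
  omega

lemma heavy_empty (f : ℕ → ℝ) (τ : ℝ) : Heavy f ∅ τ := by
  intro c hc; simp at hc

/-- Hypotheses on a slowly changing sequence of mass distributions. -/
structure Slow (f : ℕ → ℕ → ℝ) (q τ : ℝ) (B k N : ℕ) : Prop where
  nonneg : ∀ y j, 0 ≤ f y j
  q0 : 0 < q
  q1 : q ≤ 1
  up : ∀ y j, q * f y j ≤ f (y + 1) j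
  down : ∀ y j, q * f (y + 1) j ≤ f y j
  tau : 0 < τ
  point : ∀ y j, f y j ≤ τ
  supp : ∀ y j, N ≤ j → f y j = 0
  total : ∀ y a b, mass (f y) a b ≤ 3 * ((B : ℝ) ^ k * τ)
  qk : 1 / 2 ≤ q ^ k
  B8 : 8 ≤ B
  k1 : 1 ≤ k

namespace Slow
variable {f : ℕ → ℕ → ℝ} {q τ : ℝ} {B k N : ℕ} (S : Slow f q τ B k N)
include S

lemma mass_up (y a b : ℕ) : q * mass (f y) a b ≤ mass (f (y + 1)) a b := by
  unfold mass
  rw [Finset.mul_sum]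
  exact Finset.sum_le_sum (fun j _ => S.up y j)

lemma mass_down (y a b : ℕ) : q * mass (f (y + 1)) a b ≤ mass (f y) a b := by
  unfold mass
  rw [Finset.mul_sum]
  exact Finset.sum_le_sum (fun j _ => S.down y j)

lemma light_all (y : ℕ) : Light (f y) (Finset.Icc 1 N) τ := by
  intro a b h
  by_cases hab : b ≤ a + 1
  · refine le_trans (mass_mono (S.nonneg y) le_rfl hab) ?_
    simpa [mass] using S.point y a
  · have : N ≤ a := by
      by_contra hN
      exact h (a + 1) (by simp; omega) (by omega)
    have h0 : mass (f y) a b = 0 := Finset.sum_eq_zero (fun j hj => S.supp y j (by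
      have := (Finset.mem_Ico.mp hj).1; omega))
    rw [h0]; exact S.tau.le

lemma tl_pos (l : ℕ) : 0 < (B : ℝ) ^ l * τ := by
  have := S.B8
  have : (0 : ℝ) < B := by exact_mod_cast (by omega : 0 < B)
  have := S.tau
  positivity

lemma tl_succ (l : ℕ) : 8 * ((B : ℝ) ^ l * τ) ≤ (B : ℝ) ^ (l + 1) * τ := by
  have h8 : (8 : ℝ) ≤ B := by exact_mod_cast S.B8
  have := S.tl_pos l
  have e : (B : ℝ) ^ (l + 1) * τ = B * ((B : ℝ) ^ l * τ) := by ring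
  rw [e]
  exact mul_le_mul_of_nonneg_right h8 this.le

lemma qpow_half {a : ℕ} (ha : a ≤ k) : 1 / 2 ≤ q ^ a :=
  S.qk.trans (pow_le_pow_of_le_one S.q0.le S.q1 ha)

end Slow

/-- Number of steps since level `l` was rebuilt. -/
def age (k y l : ℕ) : ℕ := (y + (k - 1 - l)) % k

lemma age_lt {k : ℕ} (hk : 1 ≤ k) (y l : ℕ) : age k y l < k := Nat.mod_lt _ hk

lemma age_succ {k : ℕ} {y l : ℕ} (hl : l < k) (h : l ≠ y % k) :
    age k (y + 1) l = age k y l + 1 := by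
  unfold age
  have e : y + 1 + (k - 1 - l) = (y + (k - 1 - l)) + 1 := by omega
  rw [e, Nat.add_mod_eq_add_mod_right 1 (Nat.mod_mod (y + (k - 1 - l)) k).symm]
  apply Nat.mod_eq_of_lt
  have h1 : (y + (k - 1 - l)) % k < k := Nat.mod_lt _ (by omega)
  by_contra hcon
  have h2 : (y + (k - 1 - l)) % k = k - 1 := by omega
  have hy := Nat.mod_lt y (show 0 < k by omega)
  rw [Nat.add_mod, Nat.mod_eq_of_lt (show k - 1 - l < k by omega)] at h2
  by_cases hlt : y % k + (k - 1 - l) < k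
  · rw [Nat.mod_eq_of_lt hlt] at h2
    omega
  · have : (y % k + (k - 1 - l)) % k = y % k + (k - 1 - l) - k := by
      rw [Nat.mod_eq_sub_mod (by omega), Nat.mod_eq_of_lt (by omega)]
    omega

/-- Invariant maintained by the sequence of hierarchical partitions. -/
structure Inv (f : ℕ → ℕ → ℝ) (q τ : ℝ) (B k N : ℕ) (y : ℕ) (C : ℕ → Finset ℕ) : Prop where
  sub : ∀ l, C l ⊆ Finset.Icc 1 N
  nest : ∀ l, C (l + 1) ⊆ C l
  empty : ∀ l, k ≤ l → C l = ∅
  heavy : ∀ l, l < k → Heavy (f y) (C l) (q ^ age k y l * ((B : ℝ) ^ l * τ))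
  light : ∀ l, l < k → ∀ a b, (∀ c ∈ C l, ¬ (a < c ∧ c < b)) →
    q ^ age k y l * mass (f y) a b ≤ 3 * ((B : ℝ) ^ l * τ)

namespace Slow
variable {f : ℕ → ℕ → ℝ} {q τ : ℝ} {B k N : ℕ} (S : Slow f q τ B k N)
include S

lemma inv_heavy {y : ℕ} {C : ℕ → Finset ℕ} (h : Inv f q τ B k N y C) (l : ℕ) :
    Heavy (f y) (C l) ((B : ℝ) ^ l * τ / 2) := by
  by_cases hl : l < k
  · intro c hc p hp hpc
    refine le_trans ?_ (h.heavy l hl c hc p hp hpc)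
    have h1 := S.qpow_half (age_lt S.k1 y l).le
    have h2 := S.tl_pos l
    nlinarith
  · rw [h.empty l (not_lt.mp hl)]
    exact heavy_empty _ _

lemma inv_light {y : ℕ} {C : ℕ → Finset ℕ} (h : Inv f q τ B k N y C) {l : ℕ} (hl : l ≤ k) :
    Light (f y) (C l) (6 * ((B : ℝ) ^ l * τ)) := by
  intro a b hab
  rcases hl.lt_or_eq with hl | rfl
  · have h0 := h.light l hl a b hab
    have h1 := S.qpow_half (age_lt S.k1 y l).le
    have h2 := mass_nonneg (S.nonneg y) a b
    nlinarith
  · have := S.total y a b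
    have := S.tl_pos l
    linarith

lemma start_exists : ∃ C, Inv f q τ B k N 0 C := by
  let P : ℕ → Finset ℕ → Prop := fun l Y => Y ⊆ Finset.Icc 1 N ∧
    Heavy (f 0) Y ((B : ℝ) ^ l * τ) ∧ Light (f 0) Y (3 * ((B : ℝ) ^ l * τ))
  have h0 : ∃ Y, P 0 Y := by
    obtain ⟨Y, _, h2, h3, h4⟩ := greedy (S.nonneg 0) (Finset.empty_subset _) S.tau S.tau.le
      (heavy_empty _ _) (S.light_all 0)
    refine ⟨Y, h2, by simpa using h3, ?_⟩
    intro a b hab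
    have := h4 a b hab
    simp only [pow_zero, one_mul]
    linarith
  have hs : ∀ l (Y : {Y // P l Y}), ∃ Y', P (l + 1) Y' ∧ Y' ⊆ Y.1 := by
    rintro l ⟨Y, hY1, hY2, hY3⟩
    have hp := S.tl_pos l
    obtain ⟨Y', _, h2, h3, h4⟩ := greedy (S.nonneg 0) (Finset.empty_subset _) (S.tl_pos (l + 1))
      (by positivity) (heavy_empty _ _) hY3
    refine ⟨Y', ⟨h2.trans hY1, h3, ?_⟩, h2⟩
    intro a b hab
    have := h4 a b hab
    have := S.tl_succ l
    linarith
  choose g hg1 hg2 using hs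
  let D : (l : ℕ) → {Y // P l Y} := fun l =>
    Nat.rec ⟨h0.choose, h0.choose_spec⟩ (fun l Y => ⟨g l Y, hg1 l Y⟩) l
  have hD : ∀ l, (D (l + 1)).1 ⊆ (D l).1 := fun l => hg2 l (D l)
  refine ⟨fun l => if l < k then (D l).1 else ∅, ?_, ?_, ?_, ?_, ?_⟩
  · intro l
    by_cases h : l < k
    · simpa [h] using (D l).2.1
    · simp [h]
  · intro l
    by_cases h : l + 1 < k
    · have h' : l < k := by omega
      simpa [h, h'] using hD l
    · simp [h]
  · intro l h
    simp [not_lt.mpr h]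
  · intro l h
    simp only [h, if_true]
    intro c hc p hp hpc
    refine le_trans ?_ ((D l).2.2.1 c hc p hp hpc)
    exact mul_le_of_le_one_left (S.tl_pos l).le (pow_le_one₀ S.q0.le S.q1)
  · intro l h a b hab
    simp only [h, if_true] at hab
    refine le_trans ?_ ((D l).2.2.2 a b hab)
    exact mul_le_of_le_one_left (mass_nonneg (S.nonneg 0) a b) (pow_le_one₀ S.q0.le S.q1)

lemma step (y : ℕ) (C : ℕ → Finset ℕ) (h : Inv f q τ B k N y C) :
    ∃ C', Inv f q τ B k N (y + 1) C' ∧ ∀ l, l ≠ y % k → C' l = C l := by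
  set l0 := y % k with hl0
  have hl0k : l0 < k := Nat.mod_lt _ S.k1
  -- aged versions
  have hH : ∀ l, l < k → l ≠ l0 →
      Heavy (f (y + 1)) (C l) (q ^ age k (y + 1) l * ((B : ℝ) ^ l * τ)) := by
    intro l hl hne c hc p hp hpc
    have h1 := h.heavy l hl c hc p hp hpc
    have h2 := S.mass_up y p c
    rw [age_succ hl hne, pow_succ]
    have := mul_le_mul_of_nonneg_left h1 S.q0.le
    linarith
  have hLt : ∀ l, l < k → l ≠ l0 → ∀ a b, (∀ c ∈ C l, ¬ (a < c ∧ c < b)) →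
      q ^ age k (y + 1) l * mass (f (y + 1)) a b ≤ 3 * ((B : ℝ) ^ l * τ) := by
    intro l hl hne a b hab
    have h1 := h.light l hl a b hab
    have h2 := S.mass_down y a b
    rw [age_succ hl hne, pow_succ]
    have := mul_le_mul_of_nonneg_left h2 (pow_nonneg S.q0.le (age k y l))
    linarith
  obtain ⟨W, hWsub, hWN, hW2, hWL⟩ : ∃ W, C (l0 + 1) ⊆ W ∧ W ⊆ Finset.Icc 1 N ∧
      (∀ l, l + 1 = l0 → W ⊆ C l) ∧ Light (f (y + 1)) W ((B : ℝ) ^ l0 * τ) := by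
    rcases Nat.eq_zero_or_pos l0 with h0 | hpos
    · refine ⟨Finset.Icc 1 N, h.sub _, subset_rfl, by intro l hl; omega, ?_⟩
      rw [h0]; simpa using S.light_all (y + 1)
    · obtain ⟨l, hl⟩ : ∃ l, l0 = l + 1 := ⟨l0 - 1, by omega⟩
      refine ⟨C l, ?_, h.sub _, ?_, ?_⟩
      · rw [hl]; exact (h.nest (l + 1)).trans (h.nest l)
      · intro l' hl'
        have : l' = l := by omega
        rw [this]
      · intro a b hab
        have h1 := hLt l (by omega) (by omega) a b hab
        have h2 := S.qpow_half (age_lt S.k1 (y + 1) l).le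
        have h3 := S.tl_succ l
        have h4 := mass_nonneg (S.nonneg (y + 1)) a b
        have h5 := S.tl_pos l
        rw [hl]
        nlinarith
  have hZ : Heavy (f (y + 1)) (C (l0 + 1)) ((B : ℝ) ^ l0 * τ) := by
    by_cases hk : l0 + 1 < k
    · intro c hc p hp hpc
      refine le_trans ?_ (hH (l0 + 1) hk (by omega) c hc p hp hpc)
      have h1 := S.qpow_half (age_lt S.k1 (y + 1) (l0 + 1)).le
      have h2 := S.tl_succ l0
      have h3 := S.tl_pos l0
      nlinarith
    · rw [h.empty _ (not_lt.mp hk)]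
      exact heavy_empty _ _
  obtain ⟨Y, hY1, hY2, hY3, hY4⟩ := greedy (S.nonneg (y + 1)) hWsub (S.tl_pos l0)
    (S.tl_pos l0).le hZ hWL
  refine ⟨fun l => if l = l0 then Y else C l, ⟨?_, ?_, ?_, ?_, ?_⟩, ?_⟩
  · intro l
    by_cases hl : l = l0
    · simpa [hl] using hY2.trans hWN
    · simpa [hl] using h.sub l
  · intro l
    by_cases hl : l = l0
    · subst hl
      simpa using hY1
    · by_cases hl' : l + 1 = l0
      · simpa [hl, hl'] using hY2.trans (hW2 l hl')
      · simpa [hl, hl'] using h.nest l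
  · intro l hl
    have : l ≠ l0 := by omega
    simpa [this] using h.empty l hl
  · intro l hl
    by_cases hne : l = l0
    · subst hne
      simp only [if_true]
      intro c hc p hp hpc
      refine le_trans ?_ (hY3 c hc p hp hpc)
      exact mul_le_of_le_one_left (S.tl_pos _).le (pow_le_one₀ S.q0.le S.q1)
    · simpa [hne] using hH l hl hne
  · intro l hl a b hab
    by_cases hne : l = l0
    · subst hne
      simp only [if_true] at hab
      have h1 := hY4 a b hab
      refine le_trans (mul_le_of_le_one_left (mass_nonneg (S.nonneg _) a b)
        (pow_le_one₀ S.q0.le S.q1)) ?_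
      linarith
    · simp only [hne, if_false] at hab
      exact hLt l hl hne a b hab
  · intro l hl
    simp [hl]

/-- The main dynamic statement. -/
theorem exists_seq : ∃ C : ℕ → ℕ → Finset ℕ, (∀ y, Inv f q τ B k N y (C y)) ∧
    ∀ y l, l ≠ y % k → C (y + 1) l = C y l := by
  obtain ⟨C0, hC0⟩ := S.start_exists
  have hs : ∀ y (C : {C // Inv f q τ B k N y C}), ∃ C', Inv f q τ B k N (y + 1) C' ∧
      ∀ l, l ≠ y % k → C' l = C.1 l := fun y C => S.step y C.1 C.2
  choose g hg1 hg2 using hs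
  let D : (y : ℕ) → {C // Inv f q τ B k N y C} := fun y =>
    Nat.rec ⟨C0, hC0⟩ (fun y Y => ⟨g y Y, hg1 y Y⟩) y
  exact ⟨fun y => (D y).1, fun y => (D y).2, fun y l hl => hg2 y (D y) l hl⟩

end Slow

/-! ### Part 3: digits and addresses of cells -/

/-- Two points lie in the same cell. -/
def Same (Y : Finset ℕ) (p p' : ℕ) : Prop := ∀ c ∈ Y, (c ≤ p ↔ c ≤ p')

lemma Same.symm {Y : Finset ℕ} {p p' : ℕ} (h : Same Y p p') : Same Y p' p :=
  fun c hc => (h c hc).symm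

lemma Same.trans {Y : Finset ℕ} {p p' p'' : ℕ} (h : Same Y p p') (hh : Same Y p' p'') :
    Same Y p p'' := fun c hc => (h c hc).trans (hh c hc)

/-- Rank of the `Y`-cell of `p` inside its `Z`-cell. -/
noncomputable def dig (Z Y : Finset ℕ) (p : ℕ) : ℕ :=
  (Y.filter (fun c => c ≤ p ∧ ∀ c' ∈ Z, c' ≤ p → c' < c)).card

lemma dig_same {Z Y : Finset ℕ} (hZ : Z ⊆ Y) {p p' : ℕ} (h : Same Y p p') :
    dig Z Y p = dig Z Y p' := by
  unfold dig
  congr 1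
  apply Finset.filter_congr
  intro c hc
  rw [h c hc]
  constructor
  · rintro ⟨h1, h2⟩
    exact ⟨h1, fun c' hc' hp => h2 c' hc' ((h c' (hZ hc')).mpr hp)⟩
  · rintro ⟨h1, h2⟩
    exact ⟨h1, fun c' hc' hp => h2 c' hc' ((h c' (hZ hc')).mp hp)⟩

lemma same_of_dig_aux {Z Y : Finset ℕ} {p p' : ℕ} (hpp : p ≤ p') (h : Same Z p p')
    (hd : dig Z Y p = dig Z Y p') : Same Y p p' := by
  have hsub : Y.filter (fun c => c ≤ p ∧ ∀ c' ∈ Z, c' ≤ p → c' < c) ⊆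
      Y.filter (fun c => c ≤ p' ∧ ∀ c' ∈ Z, c' ≤ p' → c' < c) := by
    intro c hc
    simp only [Finset.mem_filter] at hc ⊢
    exact ⟨hc.1, hc.2.1.trans hpp, fun c' hc' hp => hc.2.2 c' hc' ((h c' hc').mpr hp)⟩
  have heq := Finset.eq_of_subset_of_card_le hsub (le_of_eq hd.symm)
  intro c hc
  refine ⟨fun h' => h'.trans hpp, fun h' => ?_⟩
  by_cases hm : c ∈ Y.filter (fun c => c ≤ p' ∧ ∀ c' ∈ Z, c' ≤ p' → c' < c)
  · rw [← heq] at hm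
    exact (Finset.mem_filter.mp hm).2.1
  · simp only [Finset.mem_filter, not_and, not_forall, not_lt] at hm
    obtain ⟨c', hc', hp', hcc⟩ := hm hc h'
    exact hcc.trans ((h c' hc').mpr hp')

lemma same_of_dig {Z Y : Finset ℕ} {p p' : ℕ} (h : Same Z p p')
    (hd : dig Z Y p = dig Z Y p') : Same Y p p' := by
  rcases le_total p p' with hp | hp
  · exact same_of_dig_aux hp h hd
  · exact (same_of_dig_aux hp h.symm hd.symm).symm

lemma same_of_digs {C : ℕ → Finset ℕ} {k : ℕ} (hk : ∀ l, k ≤ l → C l = ∅) {p p' : ℕ} (l : ℕ)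
    (h : ∀ l', l ≤ l' → dig (C (l' + 1)) (C l') p = dig (C (l' + 1)) (C l') p') :
    Same (C l) p p' := by
  by_cases hl : k ≤ l
  · rw [hk l hl]
    intro c hc
    simp at hc
  · obtain ⟨d, hd⟩ : ∃ d, l + d = k := ⟨k - l, by omega⟩
    clear hl
    induction d generalizing l with
    | zero =>
      rw [hk l (by omega)]
      intro c hc
      simp at hc
    | succ d ih =>
      exact same_of_dig (ih (l + 1) (fun l' hl' => h l' (by omega)) (by omega)) (h l le_rfl)

lemma nest_le {C : ℕ → Finset ℕ} (h : ∀ l, C (l + 1) ⊆ C l) {l l' : ℕ} (hl : l ≤ l') :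
    C l' ⊆ C l := by
  induction l', hl using Nat.le_induction with
  | base => exact subset_rfl
  | succ n _ ih => exact (h n).trans ih

lemma digs_of_same {C : ℕ → Finset ℕ} (h : ∀ l, C (l + 1) ⊆ C l) {p p' : ℕ} {l : ℕ}
    (hs : Same (C l) p p') (l' : ℕ) (hl : l ≤ l') :
    dig (C (l' + 1)) (C l') p = dig (C (l' + 1)) (C l') p' :=
  dig_same (h l') (fun c hc => hs c (nest_le h hl hc))

lemma heavy_card {f : ℕ → ℝ} (hf : ∀ j, 0 ≤ f j) {τ : ℝ} (a : ℕ)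
    (S : Finset ℕ) : (∀ c ∈ S, ∀ p ∈ S, p < c → τ ≤ mass f p c) →
    ∀ b, (∀ c ∈ S, a ≤ c ∧ c ≤ b) → 0 ≤ τ → (S.card : ℝ) * τ ≤ τ + mass f a b := by
  induction S using Finset.induction_on_max with
  | empty =>
    intro _ b _ hτ
    have := mass_nonneg hf a b
    simp; linarith
  | insert x S hx ih =>
    intro hS b hb hτ
    have hxS : x ∉ S := fun h => lt_irrefl _ (hx x h)
    rw [Finset.card_insert_of_notMem hxS]
    push_cast
    have hxb := hb x (Finset.mem_insert_self _ _)
    rcases S.eq_empty_or_nonempty with rfl | hne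
    · have := mass_nonneg hf a b
      simp; linarith
    · obtain ⟨w, hw, hmax⟩ := Finset.exists_max_image S (fun c => c) hne
      have h1 := ih (fun c hc p hp => hS c (Finset.mem_insert_of_mem hc) p
        (Finset.mem_insert_of_mem hp)) w (fun c hc =>
          ⟨(hb c (Finset.mem_insert_of_mem hc)).1, hmax c hc⟩) hτ
      have h2 := hS x (Finset.mem_insert_self _ _) w (Finset.mem_insert_of_mem hw) (hx w hw)
      have h3 := mass_add f (hb w (Finset.mem_insert_of_mem hw)).1 (hx w hw).le
      have h4 := mass_mono hf (le_refl a) hxb.2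
      nlinarith

namespace Slow
variable {f : ℕ → ℕ → ℝ} {q τ : ℝ} {B k N : ℕ} (S : Slow f q τ B k N)
include S

lemma cell_card {y : ℕ} {C : ℕ → Finset ℕ} (h : Inv f q τ B k N y C) {l : ℕ} (hl : l + 1 ≤ k)
    {T : Finset ℕ} (hT : T ⊆ C l) (hs : ∀ c ∈ T, ∀ c' ∈ T, Same (C (l + 1)) c c') :
    T.card ≤ 12 * B + 1 := by
  rcases T.eq_empty_or_nonempty with rfl | hne
  · simp
  obtain ⟨a, ha, hmin⟩ := Finset.exists_min_image T (fun c => c) hne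
  obtain ⟨b, hb, hmax⟩ := Finset.exists_max_image T (fun c => c) hne
  have h1 := heavy_card (S.nonneg y) a T
    (fun c hc p hp hpc => S.inv_heavy h l c (hT hc) p (Or.inr (hT hp)) hpc) b
    (fun c hc => ⟨hmin c hc, hmax c hc⟩) (by have := S.tl_pos l; positivity)
  have h2 := S.inv_light h hl a b (by
    rintro c hc ⟨h1, h2⟩
    have := (hs a ha b hb c hc).mpr h2.le
    omega)
  have h3 := S.tl_pos l
  have e : (B : ℝ) ^ (l + 1) * τ = B * ((B : ℝ) ^ l * τ) := by ring
  rw [e] at h2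
  have h4 : (T.card : ℝ) ≤ 12 * B + 1 := by
    have : (T.card : ℝ) * ((B : ℝ) ^ l * τ) ≤ (12 * B + 1) * ((B : ℝ) ^ l * τ) := by nlinarith
    exact le_of_mul_le_mul_right this h3
  exact_mod_cast h4

lemma dig_le {y : ℕ} {C : ℕ → Finset ℕ} (h : Inv f q τ B k N y C) (l p : ℕ) :
    dig (C (l + 1)) (C l) p ≤ 12 * B + 1 := by
  by_cases hl : l + 1 ≤ k
  · refine S.cell_card h hl (Finset.filter_subset _ _) ?_
    intro c hc c' hc' x hx
    simp only [Finset.mem_filter] at hc hc'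
    constructor
    · intro h1; exact (hc'.2.2 x hx (h1.trans hc.2.1)).le
    · intro h1; exact (hc.2.2 x hx (h1.trans hc'.2.1)).le
  · simp [dig, h.empty l (by omega)]

end Slow

lemma exists_idx {α β : Type*} (key : α → β) (s : Set α) (M : ℕ)
    (h : ∀ T : Finset α, (∀ x ∈ T, x ∈ s) → (∀ x ∈ T, ∀ x' ∈ T, key x = key x') → T.card ≤ M) :
    ∃ idx : α → ℕ, (∀ x ∈ s, idx x < M) ∧
      ∀ x ∈ s, ∀ x' ∈ s, key x = key x' → idx x = idx x' → x = x' := by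
  have hfin : ∀ b, {x | x ∈ s ∧ key x = b}.Finite := by
    intro b
    by_contra hinf
    obtain ⟨T, hT, hc⟩ := Set.Infinite.exists_subset_card_eq (s := {x | x ∈ s ∧ key x = b})
      hinf (M + 1)
    have := h T (fun x hx => (hT hx).1) (fun x hx x' hx' => (hT hx).2.trans (hT hx').2.symm)
    omega
  have hcard : ∀ b, (hfin b).toFinset.card ≤ M := by
    intro b
    refine h _ ?_ ?_
    · intro x hx
      exact ((hfin b).mem_toFinset.mp hx).1
    · intro x hx x' hx'
      exact ((hfin b).mem_toFinset.mp hx).2.trans ((hfin b).mem_toFinset.mp hx').2.symm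
  let g : β → α → ℕ := fun b x => if hx : x ∈ (hfin b).toFinset then
    ((hfin b).toFinset.equivFin ⟨x, hx⟩ : ℕ) else 0
  refine ⟨fun x => g (key x) x, ?_, ?_⟩
  · intro x hx
    have hm : x ∈ (hfin (key x)).toFinset := (hfin _).mem_toFinset.mpr ⟨hx, rfl⟩
    simp only [g, hm, dif_pos]
    exact lt_of_lt_of_le (Fin.is_lt _) (hcard _)
  · intro x hx x' hx' hk hi
    have hm : x ∈ (hfin (key x)).toFinset := (hfin _).mem_toFinset.mpr ⟨hx, rfl⟩
    have hm' : x' ∈ (hfin (key x)).toFinset := (hfin _).mem_toFinset.mpr ⟨hx', hk.symm⟩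
    have hi' : g (key x) x = g (key x) x' := by
      have hi2 : g (key x) x = g (key x') x' := hi
      rwa [← hk] at hi2
    simp only [g, hm, hm', dif_pos] at hi'
    have := (hfin (key x)).toFinset.equivFin.injective (Fin.ext hi')
    simpa using this

/-! ### Part 4: the masses attached to a graph -/

lemma geo_half {q : ℝ} (h0 : 0 ≤ q) (h1 : q < 1) (T : Finset ℕ) (g : ℕ → ℕ)
    (hg : ∀ x ∈ T, ∀ x' ∈ T, g x = g x' → x = x') : ∑ i ∈ T, q ^ g i ≤ (1 - q)⁻¹ := by
  rw [← tsum_geometric_of_lt_one h0 h1]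
  have := Finset.sum_image (f := fun i => q ^ i) (s := T) (g := g)
    (fun x hx x' hx' h => hg x hx x' hx' h)
  rw [← this]
  exact Summable.sum_le_tsum _ (fun i _ => pow_nonneg h0 i) (summable_geometric_of_lt_one h0 h1)

/-- Exponent: distance of rows. -/
def rd (y y' : ℕ) : ℕ := (y - y') + (y' - y)

lemma geo {q : ℝ} (h0 : 0 ≤ q) (h1 : q < 1) (T : Finset ℕ) (y : ℕ) :
    ∑ i ∈ T, q ^ rd y i ≤ 2 * (1 - q)⁻¹ := by
  rw [← Finset.sum_filter_add_sum_filter_not T (fun i => y ≤ i)]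
  have a1 := geo_half h0 h1 (T.filter (fun i => y ≤ i)) (rd y) (by
    intro x hx x' hx' h
    simp only [Finset.mem_filter] at hx hx'
    unfold rd at h
    omega)
  have a2 := geo_half h0 h1 (T.filter (fun i => ¬ y ≤ i)) (rd y) (by
    intro x hx x' hx' h
    simp only [Finset.mem_filter] at hx hx'
    unfold rd at h
    omega)
  linarith

/-- Parameters. -/
def rr (m : ℕ) : ℕ := Nat.sqrt m + 3
def BB (m : ℕ) : ℕ := 2 ^ rr m
def DD (t m : ℕ) : ℕ := (t + 1) * (m + 1)
def tau (t m : ℕ) : ℕ := 2 * BB m * DD t m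
noncomputable def qq (m : ℕ) : ℝ := 1 - 1 / (BB m : ℝ)

lemma rr_ge (m : ℕ) : 3 ≤ rr m := Nat.le_add_left _ _

lemma BB_ge (m : ℕ) : 8 ≤ BB m := by
  unfold BB
  calc 8 = 2 ^ 3 := by norm_num
    _ ≤ 2 ^ rr m := Nat.pow_le_pow_right (by norm_num) (rr_ge m)

lemma BB_geR (m : ℕ) : (8 : ℝ) ≤ BB m := by exact_mod_cast BB_ge m

lemma two_mul_le_two_pow : ∀ r : ℕ, 1 ≤ r → 2 * r ≤ 2 ^ r := by
  intro r hr
  induction r, hr using Nat.le_induction with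
  | base => norm_num
  | succ n hn ih => rw [pow_succ]; omega

lemma rr_sq (m : ℕ) : m ≤ rr m * rr m := by
  have := Nat.sqrt_le_add m
  unfold rr
  nlinarith

lemma rr_sq' (m : ℕ) : rr m * rr m ≤ m + 6 * rr m := by
  have := Nat.sqrt_le m
  unfold rr
  nlinarith

lemma pow_le_BB (m : ℕ) : 2 ^ m ≤ BB m ^ rr m := by
  unfold BB
  rw [← pow_mul]
  exact Nat.pow_le_pow_right (by norm_num) (rr_sq m)

lemma tau_pos (t m : ℕ) : 1 ≤ tau t m := by
  have := BB_ge m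
  unfold tau DD
  apply Nat.succ_le_of_lt
  positivity

lemma qq_half (m : ℕ) : 1 / 2 ≤ qq m := by
  have := BB_geR m
  unfold qq
  have : 1 / (BB m : ℝ) ≤ 1 / 8 := one_div_le_one_div_of_le (by norm_num) this
  linarith

lemma qq_lt (m : ℕ) : qq m < 1 := by
  have := BB_geR m
  unfold qq
  have : 0 < 1 / (BB m : ℝ) := by positivity
  linarith

lemma qq_inv (m : ℕ) : (1 - qq m)⁻¹ = BB m := by
  unfold qq
  simp

lemma qq_pow (m : ℕ) : 1 / 2 ≤ qq m ^ rr m := by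
  have h := one_add_mul_le_pow (a := -(1 / (BB m : ℝ))) (by
    have := qq_half m
    unfold qq at this
    linarith) (rr m)
  have h2 : ((2 * rr m : ℕ) : ℝ) ≤ BB m := by
    exact_mod_cast two_mul_le_two_pow (rr m) (by have := rr_ge m; omega)
  have hB := BB_geR m
  have h3 : (rr m : ℝ) * (1 / (BB m : ℝ)) ≤ 1 / 2 := by
    rw [mul_one_div, div_le_iff₀ (by linarith)]
    push_cast at h2
    linarith
  unfold qq
  rw [sub_eq_add_neg]
  linarith

section ctx
variable {V : Type} (s : Finset (V × ℕ)) (t m : ℕ) (zs : V → Fin (t + 1) → V) (a b p : V → ℕ)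

structure Ctx : Prop where
  card : s.card ≤ 2 ^ m
  zs0 : ∀ x, zs x 0 = x
  pos : ∀ x y, (x, y) ∈ s → ∀ j y', (zs x j, y') ∈ s → a (zs x j) ≤ p x ∧ p x ≤ b (zs x j)
  depth : ∀ Q : Finset V, (∀ z ∈ Q, ∃ y, (z, y) ∈ s) → ∀ c, (∀ z ∈ Q, a z ≤ c ∧ c ≤ b z) →
    Q.card ≤ DD t m

/-- Mass of position `j` in row `y`. -/
noncomputable def ff (y j : ℕ) : ℝ := ∑ v ∈ s, if p v.1 = j then qq m ^ rd y v.2 else 0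

/-- Total mass of row `y`. -/
noncomputable def MM (y : ℕ) : ℝ := ∑ v ∈ s, qq m ^ rd y v.2

variable {s t m zs a b p}

lemma qpow_nonneg (m i : ℕ) : 0 ≤ qq m ^ i := pow_nonneg (by have := qq_half m; linarith) i

lemma mass_ff (y c d : ℕ) : mass (ff s m p y) c d =
    ∑ v ∈ s, if c ≤ p v.1 ∧ p v.1 < d then qq m ^ rd y v.2 else 0 := by
  unfold mass ff
  rw [Finset.sum_comm]
  refine Finset.sum_congr rfl (fun v _ => ?_)
  rw [Finset.sum_ite_eq]
  simp only [Finset.mem_Ico]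

lemma mass_le_MM (y c d : ℕ) : mass (ff s m p y) c d ≤ MM s m y := by
  rw [mass_ff]
  refine Finset.sum_le_sum (fun v _ => ?_)
  split_ifs
  · exact le_rfl
  · exact qpow_nonneg _ _

/-- The bound on occurring positions. -/
noncomputable def NN (s : Finset (V × ℕ)) (p : V → ℕ) : ℕ := s.sup (fun v => p v.1) + 1

lemma lt_NN {v : V × ℕ} (hv : v ∈ s) : p v.1 < NN s p :=
  Nat.lt_succ_of_le (Finset.le_sup (f := fun v : V × ℕ => p v.1) hv)

lemma MM_eq (y : ℕ) : MM s m y = mass (ff s m p y) 0 (NN s p) := by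
  rw [mass_ff]
  refine Finset.sum_congr rfl (fun v hv => ?_)
  simp [lt_NN hv]

lemma MM_le (h : s.card ≤ 2 ^ m) (y : ℕ) : MM s m y ≤ 2 ^ m := by
  have : MM s m y ≤ ∑ v ∈ s, (1 : ℝ) := Finset.sum_le_sum (fun v _ =>
    pow_le_one₀ (by have := qq_half m; linarith) (qq_lt m).le)
  simp at this
  refine this.trans ?_
  exact_mod_cast h

lemma qstep {y y' d : ℕ} (h : rd y' d ≤ rd y d + 1) : qq m * qq m ^ rd y d ≤ qq m ^ rd y' d := by
  rw [← pow_succ']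
  exact pow_le_pow_of_le_one (by have := qq_half m; linarith) (qq_lt m).le h

lemma slow (X : Ctx s t m zs a b p) :
    Slow (ff s m p) (qq m) (tau t m : ℝ) (BB m) (rr m) (NN s p) := by
  have hq0 : 0 < qq m := by have := qq_half m; linarith
  have hB := BB_geR m
  refine ⟨?_, hq0, (qq_lt m).le, ?_, ?_, ?_, ?_, ?_, ?_, qq_pow m, BB_ge m, ?_⟩
  · intro y j
    refine Finset.sum_nonneg (fun v _ => ?_)
    split_ifs
    · exact qpow_nonneg _ _
    · exact le_rfl
  · intro y j
    unfold ff
    rw [Finset.mul_sum]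
    refine Finset.sum_le_sum (fun v _ => ?_)
    split_ifs
    · exact qstep (by unfold rd; omega)
    · simp
  · intro y j
    unfold ff
    rw [Finset.mul_sum]
    refine Finset.sum_le_sum (fun v _ => ?_)
    split_ifs
    · exact qstep (by unfold rd; omega)
    · simp
  · exact_mod_cast tau_pos t m
  · intro y j
    unfold ff
    rw [← Finset.sum_filter]
    set s' := s.filter (fun v => p v.1 = j) with hs'
    have hQ : (s'.image Prod.fst).card ≤ DD t m := by
      refine X.depth _ ?_ j ?_
      · intro z hz
        simp only [hs', Finset.mem_image, Finset.mem_filter] at hz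
        obtain ⟨v, ⟨hv, _⟩, rfl⟩ := hz
        exact ⟨v.2, hv⟩
      · intro z hz
        simp only [hs', Finset.mem_image, Finset.mem_filter] at hz
        obtain ⟨v, ⟨hv, hj⟩, rfl⟩ := hz
        have := X.pos v.1 v.2 hv 0 v.2 (by rw [X.zs0]; exact hv)
        rw [X.zs0, hj] at this
        exact this
    have hsub : s' ⊆ (s'.image Prod.fst) ×ˢ (s'.image Prod.snd) := by
      intro v hv
      exact Finset.mem_product.mpr ⟨Finset.mem_image_of_mem _ hv, Finset.mem_image_of_mem _ hv⟩
    calc ∑ v ∈ s', qq m ^ rd y v.2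
        ≤ ∑ v ∈ (s'.image Prod.fst) ×ˢ (s'.image Prod.snd), qq m ^ rd y v.2 :=
          Finset.sum_le_sum_of_subset_of_nonneg hsub (fun _ _ _ => qpow_nonneg _ _)
      _ = ∑ x ∈ s'.image Prod.fst, ∑ y' ∈ s'.image Prod.snd, qq m ^ rd y y' :=
          Finset.sum_product _ _ _
      _ ≤ ∑ x ∈ s'.image Prod.fst, (2 * (BB m : ℝ)) := by
          refine Finset.sum_le_sum (fun x _ => ?_)
          have := geo hq0.le (qq_lt m) (s'.image Prod.snd) y
          rwa [qq_inv] at this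
      _ = (s'.image Prod.fst).card * (2 * (BB m : ℝ)) := by simp
      _ ≤ (DD t m : ℝ) * (2 * (BB m : ℝ)) := by
          have : ((s'.image Prod.fst).card : ℝ) ≤ DD t m := by exact_mod_cast hQ
          exact mul_le_mul_of_nonneg_right this (by positivity)
      _ = (tau t m : ℝ) := by unfold tau; push_cast; ring
  · intro y j hj
    refine Finset.sum_eq_zero (fun v hv => ?_)
    have := lt_NN (p := p) hv
    rw [if_neg (by omega)]
  · intro y c d
    refine (mass_le_MM y c d).trans ((MM_le X.card y).trans ?_)
    have h1 : (2 : ℝ) ^ m ≤ (BB m : ℝ) ^ rr m := by exact_mod_cast pow_le_BB m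
    have h2 : (1 : ℝ) ≤ tau t m := by exact_mod_cast tau_pos t m
    have h3 : (0 : ℝ) ≤ (BB m : ℝ) ^ rr m := by positivity
    nlinarith
  · have := rr_ge m; omega

lemma MM_up (y : ℕ) : MM s m y ≤ 2 * MM s m (y + 1) := by
  have h1 : qq m * MM s m y ≤ MM s m (y + 1) := by
    unfold MM
    rw [Finset.mul_sum]
    exact Finset.sum_le_sum (fun v _ => qstep (by unfold rd; omega))
  have h2 := qq_half m
  have h3 : 0 ≤ MM s m y := Finset.sum_nonneg (fun v _ => qpow_nonneg _ _)
  nlinarith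

/-- Cumulative mass of the rows before `y`. -/
noncomputable def FF (s : Finset (V × ℕ)) (m y : ℕ) : ℝ := ∑ i ∈ Finset.range y, MM s m i

lemma FF_succ (y : ℕ) : FF s m (y + 1) = FF s m y + MM s m y := Finset.sum_range_succ _ _

lemma MM_nonneg (y : ℕ) : 0 ≤ MM s m y := Finset.sum_nonneg (fun v _ => qpow_nonneg _ _)

lemma FF_mono {y y' : ℕ} (h : y ≤ y') : FF s m y ≤ FF s m y' :=
  Finset.sum_le_sum_of_subset_of_nonneg (Finset.range_mono h) (fun i _ _ => MM_nonneg i)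

lemma FF_le (h : s.card ≤ 2 ^ m) (y : ℕ) : FF s m y ≤ 2 ^ m * (2 * BB m) := by
  unfold FF MM
  rw [Finset.sum_comm]
  have hq0 : 0 < qq m := by have := qq_half m; linarith
  have : ∀ v ∈ s, ∑ i ∈ Finset.range y, qq m ^ rd i v.2 ≤ 2 * (BB m : ℝ) := by
    intro v _
    have := geo hq0.le (qq_lt m) (Finset.range y) v.2
    rw [qq_inv] at this
    refine le_trans (le_of_eq (Finset.sum_congr rfl (fun i _ => ?_))) this
    congr 1
    unfold rd; omega
  refine (Finset.sum_le_sum this).trans ?_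
  simp only [Finset.sum_const, nsmul_eq_mul]
  have h' : (s.card : ℝ) ≤ 2 ^ m := by exact_mod_cast h
  exact mul_le_mul_of_nonneg_right h' (by positivity)

/-- Vertices relevant in row `y`. -/
def Rel (s : Finset (V × ℕ)) (y : ℕ) (z : V) : Prop :=
  (z, y) ∈ s ∨ ∃ y', y = y' + 1 ∧ (z, y') ∈ s

lemma Rel.exists {y : ℕ} {z : V} (h : Rel s y z) : ∃ y', (z, y') ∈ s ∧ rd y y' ≤ 1 := by
  rcases h with h | ⟨y', rfl, h⟩
  · exact ⟨y, h, by unfold rd; omega⟩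
  · exact ⟨y', h, by unfold rd; omega⟩

lemma qq_le_pow {i : ℕ} (h : i ≤ 1) : 1 / 2 ≤ qq m ^ i := by
  have h1 : qq m ^ 1 ≤ qq m ^ i :=
    pow_le_pow_of_le_one (by have := qq_half m; linarith) (qq_lt m).le h
  have := qq_half m
  rw [pow_one] at h1
  linarith

lemma Rel.mass {y : ℕ} {z : V} (h : Rel s y z) : 1 / 2 ≤ MM s m y := by
  obtain ⟨y', h1, h2⟩ := h.exists
  refine (qq_le_pow (m := m) h2).trans ?_
  exact Finset.single_le_sum (f := fun v : V × ℕ => qq m ^ rd y v.2)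
    (fun v _ => qpow_nonneg _ _) h1

lemma rel_card (y c d : ℕ) (Q : Finset V) (hQ : ∀ z ∈ Q, Rel s y z)
    (hp : ∀ z ∈ Q, c ≤ p z ∧ p z < d) : (Q.card : ℝ) ≤ 2 * SPAL.mass (ff s m p y) c d := by
  have hc : ∀ z, ∃ y', z ∈ Q → (z, y') ∈ s ∧ rd y y' ≤ 1 := by
    intro z
    by_cases h : z ∈ Q
    · obtain ⟨y', h'⟩ := (hQ z h).exists
      exact ⟨y', fun _ => h'⟩
    · exact ⟨0, fun h' => absurd h' h⟩
  choose g hg using hc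
  have hsub : Q.image (fun z => (z, g z)) ⊆ s := by
    intro v hv
    obtain ⟨z, hz, rfl⟩ := Finset.mem_image.mp hv
    exact (hg z hz).1
  have h1 : ∑ v ∈ Q.image (fun z => (z, g z)), (if c ≤ p v.1 ∧ p v.1 < d then
      qq m ^ rd y v.2 else 0) ≤ SPAL.mass (ff s m p y) c d := by
    rw [mass_ff]
    refine Finset.sum_le_sum_of_subset_of_nonneg hsub (fun v _ _ => ?_)
    split_ifs
    · exact qpow_nonneg _ _
    · exact le_rfl
  rw [Finset.sum_image (by
    intro x _ x' _ h
    exact congrArg Prod.fst h)] at h1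
  have h2 : ∑ z ∈ Q, (1 / 2 : ℝ) ≤ ∑ z ∈ Q, (if c ≤ p z ∧ p z < d then
      qq m ^ rd y (g z) else 0) := by
    refine Finset.sum_le_sum (fun z hz => ?_)
    rw [if_pos (hp z hz)]
    exact qq_le_pow (hg z hz).2
  simp only [Finset.sum_const, nsmul_eq_mul] at h2
  simp only at h1
  linarith

end ctx

/-! ### Part 5: the addressing scheme -/

/-- First level without cuts. -/
noncomputable def kap (C : ℕ → Finset ℕ) : ℕ := sInf {l | C l = ∅}

/-- First level at which no cut separates `[a, b]`. -/
noncomputable def levC (C : ℕ → Finset ℕ) (a b : ℕ) : ℕ :=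
  sInf {l | ∀ c ∈ C l, ¬ (a < c ∧ c ≤ b)}

section levels
variable {C : ℕ → Finset ℕ} {k : ℕ} (hn : ∀ l, C (l + 1) ⊆ C l) (he : ∀ l, k ≤ l → C l = ∅)
include he

lemma kap_le : kap C ≤ k := Nat.sInf_le (he k le_rfl)

lemma kap_empty0 : C (kap C) = ∅ := Nat.sInf_mem (s := {l | C l = ∅}) ⟨k, he k le_rfl⟩

include hn in
lemma kap_empty {l : ℕ} (h : kap C ≤ l) : C l = ∅ := by
  have := nest_le hn h
  rw [kap_empty0 he] at this
  exact Finset.subset_empty.mp this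

omit he in
lemma kap_nonempty {l : ℕ} (h : kap C = l + 1) : (C l).Nonempty := by
  rw [Finset.nonempty_iff_ne_empty]
  intro h'
  have : kap C ≤ l := Nat.sInf_le h'
  omega

lemma levC_le (a b : ℕ) : levC C a b ≤ k := Nat.sInf_le (by
  intro c hc
  rw [he k le_rfl] at hc
  simp at hc)

include hn in
lemma levC_spec {a b l : ℕ} (h : levC C a b ≤ l) : ∀ c ∈ C l, ¬ (a < c ∧ c ≤ b) := by
  intro c hc
  exact Nat.sInf_mem (s := {l | ∀ c ∈ C l, ¬ (a < c ∧ c ≤ b)}) ⟨k, by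
    intro c hc
    rw [he k le_rfl] at hc
    simp at hc⟩ c (nest_le hn h hc)

omit he in
lemma levC_succ {a b l : ℕ} (h : levC C a b = l + 1) : ∃ c ∈ C l, a < c ∧ c ≤ b := by
  by_contra h'
  push Not at h'
  have : levC C a b ≤ l := Nat.sInf_le (by
    intro c hc hh
    have := h' c hc hh.1
    omega)
  omega

include hn in
lemma levC_same {a b l p p' : ℕ} (h : levC C a b ≤ l) (h1 : a ≤ p) (h2 : p ≤ b)
    (h1' : a ≤ p') (h2' : p' ≤ b) : Same (C l) p p' := by
  intro c hc
  have := levC_spec hn he h c hc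
  omega

end levels

section rows
variable {V : Type} {s : Finset (V × ℕ)} {t m : ℕ} {zs : V → Fin (t + 1) → V} {a b p : V → ℕ}

/-- The unit of row codes. -/
noncomputable def uu (m κ : ℕ) : ℝ := (BB m : ℝ) ^ κ / (2 * BB m)

lemma uu_pos (m κ : ℕ) : 0 < uu m κ := by
  have := BB_geR m
  unfold uu
  positivity

/-- The row code. -/
noncomputable def AA (s : Finset (V × ℕ)) (m y κ : ℕ) : ℕ := ⌈FF s m y / uu m κ⌉₊

lemma FF_nonneg (y : ℕ) : 0 ≤ FF s m y := Finset.sum_nonneg (fun i _ => MM_nonneg i)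

lemma AA_lower (y κ : ℕ) : FF s m y ≤ AA s m y κ * uu m κ := by
  rw [← div_le_iff₀ (uu_pos m κ)]
  exact Nat.le_ceil _

lemma AA_upper (y κ : ℕ) : AA s m y κ * uu m κ < FF s m y + uu m κ := by
  have h := Nat.ceil_lt_add_one (a := FF s m y / uu m κ)
    (div_nonneg (FF_nonneg y) (uu_pos m κ).le)
  have h2 : ((AA s m y κ : ℕ) : ℝ) * uu m κ < (FF s m y / uu m κ + 1) * uu m κ :=
    mul_lt_mul_of_pos_right h (uu_pos m κ)
  have h3 : (FF s m y / uu m κ + 1) * uu m κ = FF s m y + uu m κ := by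
    have := (uu_pos m κ).ne'
    field_simp
  linarith

lemma uu_le (X : Ctx s t m zs a b p) {y : ℕ} {C : ℕ → Finset ℕ}
    (h : Inv (ff s m p) (qq m) (tau t m : ℝ) (BB m) (rr m) (NN s p) y C)
    (hM : 1 / 2 ≤ MM s m y) : uu m (kap C) ≤ MM s m y := by
  have hB := BB_geR m
  rcases hk : kap C with _ | l
  · refine le_trans ?_ hM
    unfold uu
    rw [pow_zero]
    exact one_div_le_one_div_of_le (by norm_num) (by linarith)
  · obtain ⟨c, hc⟩ := kap_nonempty hk
    have hc1 := Finset.mem_Icc.mp (h.sub l hc)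
    have h1 := (slow X).inv_heavy h l c hc 0 (Or.inl rfl) (by omega)
    refine le_trans ?_ (h1.trans (mass_le_MM _ _ _))
    have h2 : (1 : ℝ) ≤ tau t m := by exact_mod_cast tau_pos t m
    have h3 : (0 : ℝ) < (BB m : ℝ) ^ l := by positivity
    unfold uu
    rw [pow_succ, div_le_div_iff₀ (by positivity) (by norm_num)]
    nlinarith [mul_pos h3 (show (0:ℝ) < BB m by linarith)]

lemma row_inj {y y' κ : ℕ} (h : uu m κ ≤ MM s m y) (h' : uu m κ ≤ MM s m y')
    (hA : AA s m y κ = AA s m y' κ) : y = y' := by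
  have key : ∀ y y', uu m κ ≤ MM s m y → AA s m y κ = AA s m y' κ → ¬ y < y' := by
    intro y y' h hA hlt
    have h1 := AA_upper (s := s) (m := m) y κ
    have h2 := AA_lower (s := s) (m := m) y' κ
    have h3 := FF_mono (s := s) (m := m) (show y + 1 ≤ y' from hlt)
    rw [FF_succ] at h3
    rw [hA] at h1
    linarith
  have := key y y' h hA
  have := key y' y h' hA.symm
  omega

lemma AA_bound (X : Ctx s t m zs a b p) {y κ : ℕ} (h : uu m κ ≤ MM s m y) :
    AA s m y κ * BB m ^ κ ≤ 4 * BB m ^ 2 * 2 ^ m := by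
  have h1 := AA_upper (s := s) (m := m) y κ
  have h2 := FF_le X.card (y + 1)
  rw [FF_succ] at h2
  have h3 : (AA s m y κ : ℝ) * uu m κ ≤ 2 ^ m * (2 * BB m) := by linarith
  unfold uu at h3
  have hB := BB_geR m
  rw [mul_div_assoc', div_le_iff₀ (by positivity)] at h3
  have h4 : (AA s m y κ : ℝ) * (BB m : ℝ) ^ κ ≤ 4 * (BB m : ℝ) ^ 2 * 2 ^ m := by nlinarith
  exact_mod_cast h4

lemma AA_step {y κ κ' : ℕ} (h' : MM s m (y + 1) ≤ uu m κ' * (12 * tau t m * BB m))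
    (h : uu m κ ≤ MM s m y) :
    ∃ o, o ≤ 36 * tau t m * BB m + 1 ∧
      AA s m (y + 1) κ' = AA s m y κ * BB m ^ κ / BB m ^ κ' + o := by
  have hB := BB_geR m
  have hB8 := BB_ge m
  have hBp : (0 : ℝ) < (BB m : ℝ) ^ κ' := by positivity
  have hBn : 0 < BB m ^ κ' := by positivity
  have hu := uu_pos m κ'
  have huB : uu m κ' * (2 * BB m) = (BB m : ℝ) ^ κ' := by unfold uu; field_simp
  have huB' : uu m κ * (2 * BB m) = (BB m : ℝ) ^ κ := by unfold uu; field_simp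
  set n := AA s m y κ * BB m ^ κ / BB m ^ κ' with hn
  set A := AA s m y κ
  set A' := AA s m (y + 1) κ' with hA'
  have n1 : (n : ℝ) * uu m κ' ≤ A * uu m κ := by
    have : n * BB m ^ κ' ≤ A * BB m ^ κ := Nat.div_mul_le_self _ _
    have : (n : ℝ) * (BB m : ℝ) ^ κ' ≤ A * (BB m : ℝ) ^ κ := by exact_mod_cast this
    rw [← huB, ← huB'] at this
    refine le_of_mul_le_mul_right (a := (2 * BB m : ℝ)) ?_ (by positivity)
    linarith
  have n2 : A * uu m κ ≤ (n + 1 : ℝ) * uu m κ' := by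
    have : A * BB m ^ κ < (n + 1) * BB m ^ κ' := by
      have := Nat.lt_div_mul_add (a := A * BB m ^ κ) hBn
      rw [add_mul, one_mul]
      exact this
    have : (A : ℝ) * (BB m : ℝ) ^ κ ≤ (n + 1 : ℝ) * (BB m : ℝ) ^ κ' := by exact_mod_cast this.le
    rw [← huB, ← huB'] at this
    refine le_of_mul_le_mul_right (a := (2 * BB m : ℝ)) ?_ (by positivity)
    linarith
  have a1 := AA_lower (s := s) (m := m) y κ
  have a2 := AA_upper (s := s) (m := m) y κ
  have b1 := AA_lower (s := s) (m := m) (y + 1) κ'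
  have b2 := AA_upper (s := s) (m := m) (y + 1) κ'
  have e := FF_succ (s := s) (m := m) y
  have up := MM_up (s := s) (m := m) y
  have c1 : n ≤ A' := by
    have : (n : ℝ) * uu m κ' ≤ A' * uu m κ' := by linarith
    exact_mod_cast le_of_mul_le_mul_right this hu
  refine ⟨A' - n, ?_, by omega⟩
  have c2 : (A' : ℝ) * uu m κ' ≤ ((n + 2 + 24 * tau t m * BB m : ℕ) : ℝ) * uu m κ' := by
    push_cast
    nlinarith
  have c3 : A' ≤ n + 2 + 24 * tau t m * BB m := by
    exact_mod_cast le_of_mul_le_mul_right c2 hu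
  have c4 : 1 ≤ tau t m * BB m := Nat.mul_pos (tau_pos t m) (by omega)
  rw [mul_assoc] at c3 ⊢
  omega

/-- The data used by the labels. -/
structure Scheme (s : Finset (V × ℕ)) (t m : ℕ) (zs : V → Fin (t + 1) → V)
    (κ A : ℕ → ℕ) (dg : ℕ → ℕ → V → ℕ) (lev idx : ℕ → V → ℕ) : Prop where
  inj : ∀ y y' z z', Rel s y z → Rel s y' z' → κ y = κ y' → A y = A y' → lev y z = lev y' z' →
    (∀ l, lev y z ≤ l → dg y l z = dg y' l z') → idx y z = idx y' z' → y = y' ∧ z = z'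
  loc : ∀ y x y1 j y2 l, (x, y1) ∈ s → (zs x j, y2) ∈ s → lev y (zs x j) ≤ l →
    dg y l x = dg y l (zs x j)
  dg_lt : ∀ y l x, dg y l x < 16 * BB m
  dg_zero : ∀ y l x, κ y ≤ l → dg y l x = 0
  κ_le : ∀ y, κ y ≤ rr m
  lev_le : ∀ y z, lev y z ≤ rr m
  idx_lt : ∀ y z, Rel s y z → idx y z < 12 * tau t m
  chg : ∀ y l x, l ≠ y % rr m → l + 1 ≠ y % rr m → dg (y + 1) l x = dg y l x
  A_le : ∀ y z, Rel s y z → A y * BB m ^ κ y ≤ 4 * BB m ^ 2 * 2 ^ m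
  A_step : ∀ y z, Rel s y z → ∃ o, o ≤ 36 * tau t m * BB m + 1 ∧
    A (y + 1) = A y * BB m ^ κ y / BB m ^ κ (y + 1) + o

lemma idx_bound (X : Ctx s t m zs a b p) {y : ℕ} {C : ℕ → Finset ℕ}
    (h : Inv (ff s m p) (qq m) (tau t m : ℝ) (BB m) (rr m) (NN s p) y C) (l : ℕ) (Q : Finset V)
    (hQ : ∀ z ∈ Q, Rel s y z) (hl : ∀ z ∈ Q, levC C (a z) (b z) = l)
    (hs : ∀ z ∈ Q, ∀ z' ∈ Q, Same (C l) (p z) (p z')) : Q.card ≤ 12 * tau t m := by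
  have hab : ∀ z ∈ Q, a z ≤ p z ∧ p z ≤ b z := by
    intro z hz
    obtain ⟨y', h1, _⟩ := (hQ z hz).exists
    have := X.pos z y' h1 0 y' (by rw [X.zs0]; exact h1)
    rwa [X.zs0] at this
  rcases Q.eq_empty_or_nonempty with rfl | hne
  · simp
  rcases l with _ | l
  · obtain ⟨c, hc, hmin⟩ := Finset.exists_min_image Q p hne
    obtain ⟨d, hd, hmax⟩ := Finset.exists_max_image Q p hne
    have h1 := rel_card (m := m) (p := p) y (p c) (p d + 1) Q hQ
      (fun z hz => ⟨hmin z hz, Nat.lt_succ_of_le (hmax z hz)⟩)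
    have h2 := (slow X).inv_light h (Nat.zero_le _) (p c) (p d + 1) (by
      intro x hx hh
      have := hs c hc d hd x hx
      omega)
    rw [pow_zero, one_mul] at h2
    have : (Q.card : ℝ) ≤ ((12 * tau t m : ℕ) : ℝ) := by push_cast; linarith
    exact_mod_cast this
  · have hc : ∀ z, ∃ c, z ∈ Q → c ∈ C l ∧ a z < c ∧ c ≤ b z := by
      intro z
      by_cases hz : z ∈ Q
      · obtain ⟨c, hc⟩ := levC_succ (hl z hz)
        exact ⟨c, fun _ => hc⟩
      · exact ⟨0, fun h => absurd h hz⟩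
    choose g hg using hc
    have hlk : l + 1 ≤ rr m := by
      obtain ⟨z, hz⟩ := hne
      rw [← hl z hz]
      exact levC_le h.empty _ _
    have h1 : (Q.image g).card ≤ 12 * BB m + 1 := by
      refine (slow X).cell_card h hlk (T := Q.image g) ?_ ?_
      · intro c hc
        obtain ⟨z, hz, rfl⟩ := Finset.mem_image.mp hc
        exact (hg z hz).1
      · intro c hc c' hc'
        obtain ⟨z, hz, rfl⟩ := Finset.mem_image.mp hc
        obtain ⟨z', hz', rfl⟩ := Finset.mem_image.mp hc'
        have e1 := levC_same h.nest h.empty (hl z hz).le (hg z hz).2.1.le (hg z hz).2.2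
          (hab z hz).1 (hab z hz).2
        have e2 := levC_same h.nest h.empty (hl z' hz').le (hg z' hz').2.1.le (hg z' hz').2.2
          (hab z' hz').1 (hab z' hz').2
        exact (e1.trans (hs z hz z' hz')).trans e2.symm
    have h2 : Q.card ≤ DD t m * (Q.image g).card := by
      refine Finset.card_le_mul_card_image Q _ (fun c _ => ?_)
      refine X.depth _ ?_ c ?_
      · intro z hz
        obtain ⟨y', h1, _⟩ := (hQ z (Finset.mem_filter.mp hz).1).exists
        exact ⟨y', h1⟩
      · intro z hz
        obtain ⟨hz2, rfl⟩ := Finset.mem_filter.mp hz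
        exact ⟨(hg z hz2).2.1.le, (hg z hz2).2.2⟩
    have h3 := BB_ge m
    calc Q.card ≤ DD t m * (12 * BB m + 1) := h2.trans (Nat.mul_le_mul_left _ h1)
      _ ≤ DD t m * (24 * BB m) := Nat.mul_le_mul_left _ (by omega)
      _ = 12 * tau t m := by unfold tau; ring

theorem scheme_exists (X : Ctx s t m zs a b p) :
    ∃ κ A dg lev idx, Scheme s t m zs κ A dg lev idx := by
  obtain ⟨C, hC, hch⟩ := (slow X).exists_seq
  have hu : ∀ y z, Rel s y z → uu m (kap (C y)) ≤ MM s m y :=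
    fun y z hz => uu_le X (hC y) hz.mass
  let dg : ℕ → ℕ → V → ℕ := fun y l x => dig (C y (l + 1)) (C y l) (p x)
  let lev : ℕ → V → ℕ := fun y z => levC (C y) (a z) (b z)
  have hidx : ∀ y, ∃ idx : V → ℕ, (∀ z ∈ {z | Rel s y z}, idx z < 12 * tau t m) ∧
      ∀ z ∈ {z | Rel s y z}, ∀ z' ∈ {z | Rel s y z},
        (lev y z, fun l => if lev y z ≤ l then dg y l z else 0) =
        (lev y z', fun l => if lev y z' ≤ l then dg y l z' else 0) → idx z = idx z' → z = z' := by
    intro y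
    refine exists_idx (fun z => (lev y z, fun l => if lev y z ≤ l then dg y l z else 0)) _ _ ?_
    intro Q hQ hk
    rcases Q.eq_empty_or_nonempty with rfl | ⟨z0, hz0⟩
    · simp
    have hl : ∀ z ∈ Q, lev y z = lev y z0 := fun z hz => congrArg Prod.fst (hk z hz z0 hz0)
    refine idx_bound X (hC y) (lev y z0) Q hQ hl ?_
    intro z hz z' hz'
    refine same_of_digs (hC y).empty _ (fun l hll => ?_)
    have := congrFun (congrArg Prod.snd (hk z hz z' hz')) l
    simp only [hl z hz, hl z' hz', if_pos hll] at this
    exact this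
  choose idx hi1 hi2 using hidx
  refine ⟨fun y => kap (C y), fun y => AA s m y (kap (C y)), dg, lev, idx, ?_, ?_, ?_, ?_, ?_, ?_,
    ?_, ?_, ?_, ?_⟩
  · intro y y' z z' hz hz' hκ hA hlev hd hi
    have hy : y = y' := by
      have h1 := hu y z hz
      have h2 := hu y' z' hz'
      rw [← hκ] at hA h2
      exact row_inj h1 h2 hA
    subst hy
    refine ⟨rfl, hi2 y z hz z' hz' ?_ hi⟩
    refine Prod.ext hlev (funext fun l => ?_)
    simp only [← hlev]
    split_ifs with hh
    · exact hd l hh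
    · rfl
  · intro y x y1 j y2 l h1 h2 hl
    have e1 := X.pos x y1 h1 j y2 h2
    have e2 := X.pos (zs x j) y2 h2 0 y2 (by rw [X.zs0]; exact h2)
    rw [X.zs0] at e2
    exact digs_of_same (hC y).nest (levC_same (hC y).nest (hC y).empty (le_refl _)
      e1.1 e1.2 e2.1 e2.2) l hl
  · intro y l x
    have := (slow X).dig_le (hC y) l (p x)
    have := BB_ge m
    simp only [dg]
    omega
  · intro y l x hl
    simp only [dg, dig, kap_empty (hC y).nest (hC y).empty hl]
    rfl
  · exact fun y => kap_le (hC y).empty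
  · exact fun y z => levC_le (hC y).empty _ _
  · exact fun y z hz => hi1 y z hz
  · intro y l x h1 h2
    simp only [dg]
    rw [hch y l h1, hch y (l + 1) h2]
  · exact fun y z hz => AA_bound X (hu y z hz)
  · intro y z hz
    refine AA_step ?_ (hu y z hz)
    have h1 := (slow X).inv_light (hC (y + 1)) (kap_le (hC (y + 1)).empty) 0 (NN s p) (by
      intro c hc
      rw [kap_empty0 (hC (y + 1)).empty] at hc
      simp at hc)
    rw [← MM_eq] at h1
    refine h1.trans (le_of_eq ?_)
    have hB := BB_geR m
    unfold uu
    field_simp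
    ring

end rows

/-! ### Part 6: codes -/

/-- Number of values of a small field. -/
def Qn (t m : ℕ) : ℕ := 2 ^ (t + 7 + 4 * rr m)

/-- The type of codes. -/
abbrev Code (t m : ℕ) : Type :=
  (Σ κ : Fin (rr m + 1), Fin (4 * BB m ^ 2 * 2 ^ m / BB m ^ (κ : ℕ) + 1) ×
      (Fin (κ : ℕ) → Fin (16 * BB m))) ×
    (Fin 5 → Fin (Qn t m)) × (Fin (t + 1) → (Fin 4 → Fin (Qn t m)) × (Fin 3 → Bool))

abbrev Name : Type := ℕ × ℕ × ℕ × (ℕ → ℕ) × ℕ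

section code
variable {t m : ℕ}

def Code.k0 (L : Code t m) : ℕ := L.1.1
def Code.A0 (L : Code t m) : ℕ := L.1.2.1
def Code.d0 (L : Code t m) (l : ℕ) : ℕ := if h : l < (L.1.1 : ℕ) then L.1.2.2 ⟨l, h⟩ else 0
def Code.k1 (L : Code t m) : ℕ := L.2.1 3
def Code.A1 (L : Code t m) : ℕ :=
  Code.A0 L * BB m ^ Code.k0 L / BB m ^ Code.k1 L + L.2.1 4
def Code.d1 (L : Code t m) (l : ℕ) : ℕ :=
  if l = (L.2.1 0 : ℕ) then L.2.1 1 else if l + 1 = (L.2.1 0 : ℕ) then L.2.1 2 else Code.d0 L l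

/-- Assemble a name. -/
def mkName (k A lev : ℕ) (d : ℕ → ℕ) (idx : ℕ) : Name :=
  (k, A, lev, (fun l => if lev ≤ l then d l else 0), idx)

def Code.N0 (L : Code t m) (j : Fin (t + 1)) : Name :=
  mkName (Code.k0 L) (Code.A0 L) ((L.2.2 j).1 0) (Code.d0 L) ((L.2.2 j).1 1)
def Code.N1 (L : Code t m) (j : Fin (t + 1)) : Name :=
  mkName (Code.k1 L) (Code.A1 L) ((L.2.2 j).1 2) (Code.d1 L) ((L.2.2 j).1 3)

def Code.half (L L' : Code t m) : Prop := ∃ j,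
  ((L.2.2 j).2 0 = true ∧ Code.N0 L j = Code.N0 L' 0) ∨
  ((L.2.2 j).2 1 = true ∧ Code.N1 L j = Code.N0 L' 0) ∨
  ((L.2.2 j).2 2 = true ∧ Code.N0 L j = Code.N1 L' 0)

def Code.adj (L L' : Code t m) : Prop := Code.half L L' ∨ Code.half L' L

lemma m_le_BB (m : ℕ) : m + 1 ≤ BB m ^ 2 := by
  have h1 := rr_sq m
  have h2 := two_mul_le_two_pow (rr m) (by have := rr_ge m; omega)
  have h3 : 2 * rr m ≤ BB m := h2
  have := rr_ge m
  nlinarith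

lemma tau_le (t m : ℕ) : tau t m * BB m ≤ 2 * 2 ^ t * BB m ^ 4 := by
  have h1 := m_le_BB m
  have h2 : t + 1 ≤ 2 ^ t := Nat.lt_two_pow_self
  unfold tau DD
  calc 2 * BB m * ((t + 1) * (m + 1)) * BB m ≤ 2 * BB m * (2 ^ t * BB m ^ 2) * BB m := by gcongr
    _ = 2 * 2 ^ t * BB m ^ 4 := by ring

lemma Qn_eq (t m : ℕ) : Qn t m = 128 * (2 ^ t * BB m ^ 4) := by
  unfold Qn BB
  rw [← pow_mul, pow_add, pow_add, mul_comm (rr m) 4]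
  ring

lemma Qn_o (t m : ℕ) : 36 * tau t m * BB m + 1 < Qn t m := by
  have h := tau_le t m
  rw [Qn_eq, mul_assoc]
  have : 1 ≤ 2 ^ t * BB m ^ 4 := by
    have := BB_ge m
    exact Nat.succ_le_of_lt (by positivity)
  rw [mul_assoc] at h
  omega

lemma Qn_d (t m : ℕ) : 16 * BB m ≤ Qn t m := by
  have h := BB_ge m
  rw [Qn_eq]
  have h1 : BB m ≤ BB m ^ 4 := Nat.le_self_pow (by norm_num) _
  have h2 : 1 ≤ 2 ^ t := Nat.one_le_two_pow
  nlinarith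

lemma Qn_r (t m : ℕ) : rr m < Qn t m := by
  have h := Qn_d t m
  have : rr m < BB m := Nat.lt_two_pow_self
  omega

lemma Qn_i (t m : ℕ) : 12 * tau t m ≤ Qn t m := by
  have h := Qn_o t m
  have := BB_ge m
  nlinarith

variable {V : Type} {s : Finset (V × ℕ)} {zs : V → Fin (t + 1) → V}
  {κ A : ℕ → ℕ} {dg : ℕ → ℕ → V → ℕ} {lev idx : ℕ → V → ℕ}

/-- Truncate to a small field. -/
def tr (t m i : ℕ) : Fin (Qn t m) := ⟨i % Qn t m, Nat.mod_lt _ (by unfold Qn; positivity)⟩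

lemma tr_val {i : ℕ} (h : i < Qn t m) : (tr t m i : ℕ) = i := Nat.mod_eq_of_lt h

lemma mk_code (S : Scheme s t m zs κ A dg lev idx) (x : V) (y : ℕ) (hv : (x, y) ∈ s)
    (bits : Fin (t + 1) → Fin 3 → Bool) :
    ∃ L : Code t m, (∀ j, (L.2.2 j).2 = bits j) ∧
      (∀ j, Rel s y (zs x j) → Code.N0 L j =
        mkName (κ y) (A y) (lev y (zs x j)) (dg y · (zs x j)) (idx y (zs x j))) ∧
      (∀ j, Rel s (y + 1) (zs x j) → Code.N1 L j =
        mkName (κ (y + 1)) (A (y + 1)) (lev (y + 1) (zs x j)) (dg (y + 1) · (zs x j))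
          (idx (y + 1) (zs x j))) := by
  have hr : Rel s y x := Or.inl hv
  obtain ⟨o, ho, hA⟩ := S.A_step y x hr
  have hB := BB_ge m
  have hlem : ∀ y' k A0 (d : ℕ → ℕ) (lv ix : Fin (Qn t m)) (j : Fin (t + 1)), Rel s y' (zs x j) →
      k = κ y' → A0 = A y' → (∀ l, d l = dg y' l x) → lv = tr t m (lev y' (zs x j)) →
      ix = tr t m (idx y' (zs x j)) → mkName k A0 lv d ix =
      mkName (κ y') (A y') (lev y' (zs x j)) (dg y' · (zs x j)) (idx y' (zs x j)) := by
    intro y' k A0 d lv ix j hrel hk hA0 hd hlv hix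
    have e1 : (lv : ℕ) = lev y' (zs x j) := by
      rw [hlv]
      exact tr_val (lt_of_le_of_lt (S.lev_le _ _) (Qn_r t m))
    have e2 : (ix : ℕ) = idx y' (zs x j) := by
      rw [hix]
      exact tr_val (lt_of_lt_of_le (S.idx_lt _ _ hrel) (Qn_i t m))
    obtain ⟨y2, hy2, _⟩ := hrel.exists
    unfold mkName
    rw [hk, hA0, e1, e2]
    congr 4
    funext l
    split_ifs with hl
    · rw [hd l]
      exact S.loc y' x y j y2 l hv hy2 hl
    · rfl
  let L : Code t m := ⟨⟨⟨κ y, Nat.lt_succ_of_le (S.κ_le y)⟩,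
      ⟨A y, Nat.lt_succ_of_le ((Nat.le_div_iff_mul_le (by positivity)).mpr (S.A_le y x hr))⟩,
      fun l => ⟨dg y l x, S.dg_lt y l x⟩⟩,
    ![tr t m (y % rr m), tr t m (dg (y + 1) (y % rr m) x), tr t m (dg (y + 1) (y % rr m - 1) x),
      tr t m (κ (y + 1)), tr t m o],
    fun j => (![tr t m (lev y (zs x j)), tr t m (idx y (zs x j)), tr t m (lev (y + 1) (zs x j)),
      tr t m (idx (y + 1) (zs x j))], bits j)⟩
  have hd0 : ∀ l, Code.d0 L l = dg y l x := by
    intro l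
    by_cases hl : l < κ y
    · simp [Code.d0, L, hl]
    · simp only [Code.d0, L, hl, dif_neg, not_false_iff]
      exact (S.dg_zero y l x (not_lt.mp hl)).symm
  have hk1 : Code.k1 L = κ (y + 1) := tr_val (lt_of_le_of_lt (S.κ_le _) (Qn_r t m))
  have ho' : ((L.2.1 4 : Fin _) : ℕ) = o := tr_val (lt_of_le_of_lt ho (Qn_o t m))
  have hl0 : ((L.2.1 0 : Fin _) : ℕ) = y % rr m := tr_val (lt_of_le_of_lt
    (Nat.mod_lt _ (by have := rr_ge m; omega)).le (Qn_r t m))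
  have hl1 : ((L.2.1 1 : Fin _) : ℕ) = dg (y + 1) (y % rr m) x :=
    tr_val (lt_of_lt_of_le (S.dg_lt _ _ _) (Qn_d t m))
  have hl2 : ((L.2.1 2 : Fin _) : ℕ) = dg (y + 1) (y % rr m - 1) x :=
    tr_val (lt_of_lt_of_le (S.dg_lt _ _ _) (Qn_d t m))
  refine ⟨L, fun _ => rfl, ?_, ?_⟩
  · intro j hrel
    exact hlem y _ _ _ _ _ j hrel rfl rfl hd0 rfl rfl
  · intro j hrel
    refine hlem (y + 1) _ _ _ _ _ j hrel hk1 ?_ ?_ rfl rfl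
    · unfold Code.A1
      rw [hk1, ho', hA]
      rfl
    · intro l
      unfold Code.d1
      rw [hl0, hl1, hl2]
      split_ifs with h1 h2
      · rw [h1]
      · rw [← h2]; rfl
      · rw [hd0, S.chg y l x h1 h2]

theorem labels (S : Scheme s t m zs κ A dg lev idx) (hz0 : ∀ x, zs x 0 = x)
    (R : V × ℕ → V × ℕ → Prop) (hR : ∀ v w, R v w → R w v ∧ v ∈ s ∧ w ∈ s ∧
      ((∃ j, zs v.1 j = w.1) ∨ (∃ j, zs w.1 j = v.1)) ∧
      (v.2 = w.2 ∨ v.2 + 1 = w.2 ∨ w.2 + 1 = v.2)) :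
    ∃ lab : V × ℕ → Code t m, (∀ v ∈ s, ∀ w ∈ s, lab v = lab w → v = w) ∧
      ∀ v ∈ s, ∀ w ∈ s, (Code.adj (lab v) (lab w) ↔ R v w) := by
  let bits : V × ℕ → Fin (t + 1) → Fin 3 → Bool := fun v j =>
    ![decide (R v (zs v.1 j, v.2)), decide (R v (zs v.1 j, v.2 + 1)),
      decide (∃ y', y' + 1 = v.2 ∧ R v (zs v.1 j, y'))]
  have hex : ∀ v : V × ℕ, ∃ L : Code t m, v ∈ s → (∀ j, (L.2.2 j).2 = bits v j) ∧
      (∀ j, Rel s v.2 (zs v.1 j) → Code.N0 L j =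
        mkName (κ v.2) (A v.2) (lev v.2 (zs v.1 j)) (dg v.2 · (zs v.1 j)) (idx v.2 (zs v.1 j))) ∧
      (∀ j, Rel s (v.2 + 1) (zs v.1 j) → Code.N1 L j =
        mkName (κ (v.2 + 1)) (A (v.2 + 1)) (lev (v.2 + 1) (zs v.1 j)) (dg (v.2 + 1) · (zs v.1 j))
          (idx (v.2 + 1) (zs v.1 j))) := by
    rintro ⟨x, y⟩
    by_cases hv : (x, y) ∈ s
    · obtain ⟨L, hL⟩ := mk_code S x y hv (bits (x, y))
      exact ⟨L, fun _ => hL⟩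
    · exact ⟨⟨⟨0, 0, fun i => i.elim0⟩, fun _ => tr t m 0, fun _ => (fun _ => tr t m 0, fun _ => false)⟩,
        fun h => absurd h hv⟩
  choose lab hlab using hex
  have ninj : ∀ y y' z z', Rel s y z → Rel s y' z' →
      mkName (κ y) (A y) (lev y z) (dg y · z) (idx y z) =
      mkName (κ y') (A y') (lev y' z') (dg y' · z') (idx y' z') → y = y' ∧ z = z' := by
    intro y y' z z' h1 h2 h
    simp only [mkName, Prod.mk.injEq] at h
    obtain ⟨e1, e2, e3, e4, e5⟩ := h
    refine S.inj y y' z z' h1 h2 e1 e2 e3 (fun l hl => ?_) e5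
    have := congrFun e4 l
    simpa only [← e3, if_pos hl] using this
  have N0z : ∀ w ∈ s, Code.N0 (lab w) 0 =
      mkName (κ w.2) (A w.2) (lev w.2 w.1) (dg w.2 · w.1) (idx w.2 w.1) := by
    intro w hw
    have := (hlab w hw).2.1 0 (by rw [hz0]; exact Or.inl hw)
    rwa [hz0] at this
  have N1z : ∀ w ∈ s, Code.N1 (lab w) 0 =
      mkName (κ (w.2 + 1)) (A (w.2 + 1)) (lev (w.2 + 1) w.1) (dg (w.2 + 1) · w.1)
        (idx (w.2 + 1) w.1) := by
    intro w hw
    have := (hlab w hw).2.2 0 (by rw [hz0]; exact Or.inr ⟨_, rfl, hw⟩)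
    rwa [hz0] at this
  have half1 : ∀ v ∈ s, ∀ w ∈ s, Code.half (lab v) (lab w) → R v w := by
    intro v hv w hw ⟨j, h⟩
    obtain ⟨hb, hN0, hN1⟩ := hlab v hv
    rw [hb j, N0z w hw, N1z w hw] at h
    rcases h with ⟨b, h⟩ | ⟨b, h⟩ | ⟨b, h⟩
    · have b' : R v (zs v.1 j, v.2) := by simpa [bits] using b
      have hr : Rel s v.2 (zs v.1 j) := Or.inl (hR _ _ b').2.2.1
      rw [hN0 j hr] at h
      obtain ⟨e1, e2⟩ := ninj _ _ _ _ hr (Or.inl hw) h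
      rw [e1, e2] at b'
      exact b'
    · have b' : R v (zs v.1 j, v.2 + 1) := by simpa [bits] using b
      have hr : Rel s (v.2 + 1) (zs v.1 j) := Or.inl (hR _ _ b').2.2.1
      rw [hN1 j hr] at h
      obtain ⟨e1, e2⟩ := ninj _ _ _ _ hr (Or.inl hw) h
      rw [e1, e2] at b'
      exact b'
    · have b' : ∃ y', y' + 1 = v.2 ∧ R v (zs v.1 j, y') := by simpa [bits] using b
      obtain ⟨y', hy, b'⟩ := b'
      have hr : Rel s v.2 (zs v.1 j) := Or.inr ⟨y', hy.symm, (hR _ _ b').2.2.1⟩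
      rw [hN0 j hr] at h
      obtain ⟨e1, e2⟩ := ninj _ _ _ _ hr (Or.inr ⟨_, rfl, hw⟩) h
      have e3 : y' = w.2 := by omega
      rw [e3, e2] at b'
      exact b'
  have half2 : ∀ v ∈ s, ∀ w ∈ s, R v w → ∀ j, zs v.1 j = w.1 → Code.half (lab v) (lab w) := by
    intro v hv w hw hvw j hj
    obtain ⟨hb, hN0, hN1⟩ := hlab v hv
    refine ⟨j, ?_⟩
    rw [hb j, N0z w hw, N1z w hw]
    rcases (hR v w hvw).2.2.2.2 with e | e | e
    · refine Or.inl ⟨?_, ?_⟩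
      · simp only [bits, hj, e]
        simpa using hvw
      · rw [hN0 j (Or.inl (by rw [hj, e]; exact hw)), hj, e]
    · refine Or.inr (Or.inl ⟨?_, ?_⟩)
      · simp only [bits, hj, e]
        simpa using hvw
      · rw [hN1 j (Or.inl (by rw [hj, e]; exact hw)), hj, e]
    · refine Or.inr (Or.inr ⟨?_, ?_⟩)
      · simp only [bits, hj]
        simpa using ⟨w.2, e, hvw⟩
      · rw [hN0 j (Or.inr ⟨w.2, e.symm, by rw [hj]; exact hw⟩), hj, e]
  refine ⟨lab, ?_, ?_⟩
  · intro v hv w hw h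
    have h1 := N0z v hv
    rw [h, N0z w hw] at h1
    obtain ⟨e1, e2⟩ := ninj _ _ _ _ (Or.inl hw) (Or.inl hv) h1
    exact (Prod.ext e2 e1).symm
  · intro v hv w hw
    constructor
    · rintro (h | h)
      · exact half1 v hv w hw h
      · exact (hR _ _ (half1 w hw v hv h)).1
    · intro h
      rcases (hR _ _ h).2.2.2.1 with ⟨j, hj⟩ | ⟨j, hj⟩
      · exact Or.inl (half2 v hv w hw h j hj)
      · exact Or.inr (half2 w hw v hv (hR _ _ h).1 j hj)

/-- The overhead in the label length. -/
def EE (t m : ℕ) : ℕ := 11 * rr m + 3 + 5 * (t + 7 + 4 * rr m) +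
  (t + 1) * (4 * (t + 7 + 4 * rr m) + 3)

lemma head_card (κ : ℕ) (hκ : κ ≤ rr m) :
    (4 * BB m ^ 2 * 2 ^ m / BB m ^ κ + 1) * (16 * BB m) ^ κ ≤ 2 ^ (m + 10 * rr m + 1) := by
  have h1 : (4 * BB m ^ 2 * 2 ^ m / BB m ^ κ) * BB m ^ κ ≤ 4 * BB m ^ 2 * 2 ^ m :=
    Nat.div_mul_le_self _ _
  have hB := BB_ge m
  have h16 : 16 ^ κ ≤ 2 ^ (4 * rr m) := by
    rw [pow_mul]
    exact Nat.pow_le_pow_right (by norm_num) hκ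
  have hBk : BB m ^ κ ≤ 2 ^ (m + 6 * rr m) := by
    calc BB m ^ κ ≤ BB m ^ rr m := Nat.pow_le_pow_right (by omega) hκ
      _ = 2 ^ (rr m * rr m) := by unfold BB; rw [pow_mul]
      _ ≤ _ := Nat.pow_le_pow_right (by norm_num) (rr_sq' m)
  have h4 : 4 * BB m ^ 2 * 2 ^ m ≤ 2 ^ (m + 6 * rr m) := by
    have : 4 * BB m ^ 2 * 2 ^ m = 2 ^ (2 + rr m * 2 + m) := by
      unfold BB
      rw [pow_add, pow_add, pow_mul]
      norm_num
    rw [this]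
    exact Nat.pow_le_pow_right (by norm_num) (by have := rr_ge m; omega)
  calc (4 * BB m ^ 2 * 2 ^ m / BB m ^ κ + 1) * (16 * BB m) ^ κ
      = ((4 * BB m ^ 2 * 2 ^ m / BB m ^ κ) * BB m ^ κ + BB m ^ κ) * 16 ^ κ := by
        rw [mul_pow]; ring
    _ ≤ (2 ^ (m + 6 * rr m) + 2 ^ (m + 6 * rr m)) * 2 ^ (4 * rr m) := by
        gcongr
        exact h1.trans h4
    _ = 2 ^ (m + 10 * rr m + 1) := by
        rw [← two_mul, ← pow_succ', ← pow_add]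
        congr 1
        ring

lemma tail_card (t Q : ℕ) : Nat.card ((Fin 5 → Fin Q) ×
    (Fin (t + 1) → (Fin 4 → Fin Q) × (Fin 3 → Bool))) = Q ^ 5 * (Q ^ 4 * 2 ^ 3) ^ (t + 1) := by
  simp only [Nat.card_prod, Nat.card_fun, Nat.card_fin, Nat.card_eq_fintype_card (α := Bool),
    Fintype.card_bool]

lemma heads_card (m : ℕ) :
    Nat.card (Σ κ : Fin (rr m + 1), Fin (4 * BB m ^ 2 * 2 ^ m / BB m ^ (κ : ℕ) + 1) ×
      (Fin (κ : ℕ) → Fin (16 * BB m))) ≤ 2 ^ (m + 11 * rr m + 3) := by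
  rw [Nat.card_sigma]
  have : ∀ κ ∈ (Finset.univ : Finset (Fin (rr m + 1))),
      Nat.card (Fin (4 * BB m ^ 2 * 2 ^ m / BB m ^ (κ : ℕ) + 1) ×
        (Fin (κ : ℕ) → Fin (16 * BB m))) ≤ 2 ^ (m + 10 * rr m + 1) := by
    intro κ _
    rw [Nat.card_prod, Nat.card_fin, Nat.card_fun, Nat.card_fin, Nat.card_fin]
    exact head_card κ (Nat.lt_succ_iff.mp κ.2)
  refine (Finset.sum_le_card_nsmul _ _ _ this).trans ?_
  rw [Finset.card_univ, Fintype.card_fin, smul_eq_mul]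
  have hr : rr m + 1 ≤ 2 ^ rr m := Nat.lt_two_pow_self
  calc (rr m + 1) * 2 ^ (m + 10 * rr m + 1) ≤ 2 ^ rr m * 2 ^ (m + 10 * rr m + 1) :=
        Nat.mul_le_mul_right _ hr
    _ = 2 ^ (rr m + (m + 10 * rr m + 1)) := (pow_add _ _ _).symm
    _ ≤ _ := Nat.pow_le_pow_right (by norm_num) (by omega)

lemma code_card (t m : ℕ) : Nat.card (Code t m) ≤ 2 ^ (m + EE t m) := by
  rw [Nat.card_prod, tail_card]
  have h2 : Qn t m ^ 5 * (Qn t m ^ 4 * 2 ^ 3) ^ (t + 1) =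
      2 ^ (5 * (t + 7 + 4 * rr m) + (t + 1) * (4 * (t + 7 + 4 * rr m) + 3)) := by
    unfold Qn
    rw [← pow_mul, ← pow_mul, ← pow_add, ← pow_mul, ← pow_add]
    congr 1
    ring
  rw [h2]
  have h3 := heads_card m
  have h4 : m + EE t m = (m + 11 * rr m + 3) +
      (5 * (t + 7 + 4 * rr m) + (t + 1) * (4 * (t + 7 + 4 * rr m) + 3)) := by
    unfold EE
    ring
  rw [h4, pow_add 2 (m + 11 * rr m + 3)]
  generalize Nat.card (Σ κ : Fin (rr m + 1), Fin (4 * BB m ^ 2 * 2 ^ m / BB m ^ (κ : ℕ) + 1) ×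
      (Fin (κ : ℕ) → Fin (16 * BB m))) = x at h3 ⊢
  generalize 2 ^ (5 * (t + 7 + 4 * rr m) + (t + 1) * (4 * (t + 7 + 4 * rr m) + 3)) = y
  generalize 2 ^ (m + 11 * rr m + 3) = z at h3 ⊢
  exact Nat.mul_le_mul_right y h3

end code

/-! ### Part 7: bit strings -/

lemma rr_mono {m m' : ℕ} (h : m ≤ m') : rr m ≤ rr m' := by
  unfold rr
  have := Nat.sqrt_le_sqrt h
  omega

lemma EE_mono (t : ℕ) {m m' : ℕ} (h : m ≤ m') : EE t m ≤ EE t m' := by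
  have := rr_mono h
  unfold EE
  gcongr

lemma enc_exists (t m : ℕ) : ∃ f : Code t m → List Bool, Function.Injective f ∧
    ∀ c, (f c).length = m + EE t m := by
  have h : Nat.card (Code t m) ≤ Nat.card (Fin (m + EE t m) → Bool) := by
    rw [Nat.card_fun, Nat.card_fin, Nat.card_eq_fintype_card (α := Bool), Fintype.card_bool]
    exact code_card t m
  have h2 : ∃ g : Code t m → (Fin (m + EE t m) → Bool), Function.Injective g := by
    rw [Nat.card_eq_fintype_card, Nat.card_eq_fintype_card] at h
    obtain ⟨g⟩ := Function.Embedding.nonempty_of_card_le h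
    exact ⟨g, g.injective⟩
  obtain ⟨g, hg⟩ := h2
  refine ⟨fun c => List.ofFn (g c), ?_, fun c => List.length_ofFn⟩
  intro c c' hcc
  exact hg (List.ofFn_injective hcc)

theorem universal (t : ℕ) : ∃ (f : ∀ m, Code t m → List Bool) (A : List Bool → List Bool → Bool),
    (∀ m, Function.Injective (f m)) ∧ (∀ m c, (f m c).length = m + EE t m) ∧
    ∀ m c c', A (f m c) (f m c') = true ↔ Code.adj c c' := by
  choose f hf1 hf2 using enc_exists t
  refine ⟨f, fun l l' => decide (∃ m c c', f m c = l ∧ f m c' = l' ∧ Code.adj c c'), hf1, hf2, ?_⟩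
  intro m c c'
  rw [decide_eq_true_iff]
  constructor
  · rintro ⟨m', c1, c1', h1, h2, h⟩
    have hm : m' = m := by
      have e := congrArg List.length h1
      rw [hf2, hf2] at e
      rcases le_total m m' with hl | hl
      · have := EE_mono t hl; omega
      · have := EE_mono t hl; omega
    subst hm
    rw [hf1 _ h1, hf1 _ h2] at h
    exact h
  · intro h
    exact ⟨m, c, c', rfl, rfl, h⟩

/-! ### Part 8: the context of a `t`-tree -/

lemma slots_exists {V : Type} (t : ℕ) (P : V → Finset V) (hP : ∀ x, (P x).card ≤ t) :
    ∃ zs : V → Fin (t + 1) → V, (∀ x, zs x 0 = x) ∧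
      ∀ x w, (∃ j, zs x j = w) ↔ w = x ∨ w ∈ P x := by
  refine ⟨fun x => Fin.cons x (fun i : Fin t => if h : (i : ℕ) < (P x).card then
    ((P x).equivFin.symm ⟨i, h⟩ : V) else x), fun x => rfl, ?_⟩
  intro x w
  constructor
  · rintro ⟨j, rfl⟩
    refine Fin.cases ?_ (fun i => ?_) j
    · exact Or.inl rfl
    · simp only [Fin.cons_succ]
      split_ifs with h
      · exact Or.inr (Subtype.coe_prop _)
      · exact Or.inl rfl
  · rintro (rfl | h)
    · exact ⟨0, rfl⟩
    · let i := (P x).equivFin ⟨w, h⟩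
      refine ⟨Fin.succ ⟨i, lt_of_lt_of_le i.2 (hP x)⟩, ?_⟩
      simp only [Fin.cons_succ]
      rw [dif_pos i.2]
      simp [i]

theorem ctx_exists {V : Type} (H : SimpleGraph V) (t m : ℕ) (s : Finset (V × ℕ))
    (hs : s.card ≤ 2 ^ m) (e : V → ℕ) (he : Function.Injective e) (P : V → Finset V)
    (hP : ∀ x w, w ∈ P x ↔ H.Adj x w ∧ e w < e x)
    (hcl : ∀ g u w, H.Adj g u → H.Adj g w → e u < e g → e w < e g → u ≠ w → H.Adj u w)
    (ht : ∀ x, (P x).card ≤ t) :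
    ∃ (zs : V → Fin (t + 1) → V) (a b p : V → ℕ), Ctx s t m zs a b p ∧
      ∀ x w, (∃ j, zs x j = w) ↔ w = x ∨ (H.Adj x w ∧ e w < e x) := by
  obtain ⟨zs, hz0, hz⟩ := slots_exists t P ht
  simp only [hP] at hz
  have hXs : (s.image Prod.fst).card ≤ 2 ^ m := Finset.card_image_le.trans hs
  obtain ⟨a, b, h1, h2, h3⟩ := rep_exists (t := t) H e he hcl (by
    intro v S hS
    refine le_trans (Finset.card_le_card (fun w hw => ?_)) (ht v)
    exact (hP v w).mpr (hS w hw)) (m + 1) (2 ^ m) (s.image Prod.fst) hXs (by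
    intro Y hY _
    calc Y.card ≤ (s.image Prod.fst).card := Finset.card_le_card hY
      _ ≤ 2 ^ m := hXs
      _ < 2 ^ (m + 1) := Nat.pow_lt_pow_right (by norm_num) (by omega))
  have hX : ∀ z, z ∈ s.image Prod.fst ↔ ∃ y, (z, y) ∈ s := by
    intro z
    simp
  refine ⟨zs, a, b, fun x => Finset.univ.sup (fun j => if zs x j ∈ s.image Prod.fst then
    a (zs x j) else 0), ⟨hs, hz0, ?_, ?_⟩, hz⟩
  · intro x y hxy j y' hj
    have hjX : zs x j ∈ s.image Prod.fst := (hX _).mpr ⟨y', hj⟩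
    constructor
    · have := Finset.le_sup (f := fun j => if zs x j ∈ s.image Prod.fst then
        a (zs x j) else 0) (Finset.mem_univ j)
      simp only [if_pos hjX] at this
      exact this
    · refine Finset.sup_le (fun j' _ => ?_)
      split_ifs with hj'
      · by_cases hee : zs x j' = zs x j
        · rw [hee]; exact h1 _ hjX
        · refine h2 _ hj' _ hjX ?_
          rcases (hz x (zs x j)).mp ⟨j, rfl⟩ with e1 | e1
          · rcases (hz x (zs x j')).mp ⟨j', rfl⟩ with e2 | e2
            · exact absurd (e2.trans e1.symm) hee
            · rw [e1]; exact e2.1.symm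
          · rcases (hz x (zs x j')).mp ⟨j', rfl⟩ with e2 | e2
            · rw [e2]; exact e1.1
            · exact hcl x _ _ e2.1 e1.1 e2.2 e1.2 hee
      · exact Nat.zero_le _
  · intro Q hQ c hc
    refine le_trans (Finset.card_le_card (fun z hz => ?_)) (h3 c)
    exact Finset.mem_filter.mpr ⟨(hX z).mpr (hQ z hz), hc z hz⟩

/-! ### Part 9: numerics -/

lemma length_bound (t : ℕ) : ∃ C : ℝ, 0 < C ∧ ∀ n : ℕ, 2 ≤ n →
    ((Nat.clog 2 n + EE t (Nat.clog 2 n) : ℕ) : ℝ) ≤ Real.logb 2 n +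
      C * Real.sqrt (Real.logb 2 n * Real.logb 2 (Real.logb 2 n + 2)) := by
  let K : ℕ := 14 + 5 * (t + 11) + (t + 1) * (4 * (t + 11) + 3)
  refine ⟨5 * K + 1, by positivity, ?_⟩
  intro n hn
  set m := Nat.clog 2 n with hm
  set x := Real.logb 2 n with hx
  have hn' : (2 : ℝ) ≤ n := by exact_mod_cast hn
  have hx1 : 1 ≤ x := by
    rw [hx, Real.le_logb_iff_rpow_le (by norm_num) (by linarith), Real.rpow_one]
    exact hn'
  have hmx : (m : ℝ) ≤ x + 1 := by
    have h1 : 2 ^ (m - 1) < n := Nat.pow_pred_clog_lt_self (by norm_num) (by omega)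
    have h2 : ((m - 1 : ℕ) : ℝ) ≤ x := by
      rw [hx, Real.le_logb_iff_rpow_le (by norm_num) (by linarith), Real.rpow_natCast]
      exact_mod_cast h1.le
    have h3 : m ≤ (m - 1) + 1 := by omega
    have h4 : (m : ℝ) ≤ ((m - 1 : ℕ) : ℝ) + 1 := by exact_mod_cast h3
    linarith
  have hlog : 1 ≤ Real.logb 2 (x + 2) := by
    rw [Real.le_logb_iff_rpow_le (by norm_num) (by linarith), Real.rpow_one]
    linarith
  have hsq1 : 1 ≤ Real.sqrt x := Real.one_le_sqrt.mpr hx1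
  have hsx : Real.sqrt x * Real.sqrt x = x := Real.mul_self_sqrt (by linarith)
  have hmono : Real.sqrt x ≤ Real.sqrt (x * Real.logb 2 (x + 2)) :=
    Real.sqrt_le_sqrt (by nlinarith)
  have hrr : (rr m : ℝ) ≤ 5 * Real.sqrt x := by
    have h1 : Nat.sqrt m * Nat.sqrt m ≤ m := Nat.sqrt_le m
    have h2 : ((Nat.sqrt m : ℕ) : ℝ) * ((Nat.sqrt m : ℕ) : ℝ) ≤ m := by exact_mod_cast h1
    have h3 : ((Nat.sqrt m : ℕ) : ℝ) ≤ 2 * Real.sqrt x := by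
      by_contra hcon
      push Not at hcon
      nlinarith
    unfold rr
    push_cast
    linarith
  have hE : EE t m ≤ K * rr m := by
    have := rr_ge m
    have h1 : t + 7 + 4 * rr m ≤ (t + 11) * rr m := by nlinarith
    have h2 : 4 * (t + 7 + 4 * rr m) + 3 ≤ (4 * (t + 11) + 3) * rr m := by nlinarith
    have h3 : (t + 1) * (4 * (t + 7 + 4 * rr m) + 3) ≤
      (t + 1) * ((4 * (t + 11) + 3) * rr m) := Nat.mul_le_mul_left _ h2
    unfold EE
    calc _ ≤ 14 * rr m + 5 * ((t + 11) * rr m) + (t + 1) * ((4 * (t + 11) + 3) * rr m) := by omega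
      _ = K * rr m := by simp only [K]; ring
  have hE' : (EE t m : ℝ) ≤ K * rr m := by exact_mod_cast hE
  have hK : (0 : ℝ) ≤ K := by positivity
  push_cast
  have h5 : (K : ℝ) * rr m ≤ K * (5 * Real.sqrt x) := mul_le_mul_of_nonneg_left hrr hK
  nlinarith

end SPAL

/-- adjacency labelling for subgraphs of `H ⊠ P`: for every fixed
`t ≥ 1` there are a constant `C > 0` and a universal adjacency decoder `A` such that
every `n`-vertex graph (`n ≥ 2`) whose vertices are pairs `(v, y)` with `v` a vertex of
a `t`-tree `H` and `y ∈ {1,…,h}`, and whose edges respect the strong product `H ⊠ P`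
(i.e. endpoints are equal-or-adjacent in `H` and equal-or-consecutive in the path `P`),
has an injective labelling by bit strings of length at most
`log₂ n + C·√(log₂ n · log₂(log₂ n + 2))` from which `A` decides adjacency. -/
theorem strong_product_adjacency_labelling (t : ℕ) (ht : 1 ≤ t) :
    ∃ C : ℝ, 0 < C ∧ ∃ A : List Bool → List Bool → Bool,
      ∀ n : ℕ, 2 ≤ n →
      ∀ (VH : Type) (_ : Fintype VH) (H : SimpleGraph VH), IsTTree t H →
      ∀ h : ℕ, ∀ s : Finset (VH × ℕ), s.card = n →
        (∀ p ∈ s, 1 ≤ p.2 ∧ p.2 ≤ h) →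
        ∀ G : SimpleGraph {p : VH × ℕ // p ∈ s},
          (∀ u v : {p : VH × ℕ // p ∈ s}, G.Adj u v →
            (u.1.1 = v.1.1 ∨ H.Adj u.1.1 v.1.1) ∧
            (u.1.2 = v.1.2 ∨ u.1.2 + 1 = v.1.2 ∨ v.1.2 + 1 = u.1.2)) →
          ∃ ℓ : {p : VH × ℕ // p ∈ s} → List Bool, Function.Injective ℓ ∧
            (∀ v, ((ℓ v).length : ℝ) ≤
              Real.logb 2 n +
                C * Real.sqrt (Real.logb 2 n * Real.logb 2 (Real.logb 2 n + 2))) ∧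
            (∀ v w, v ≠ w → (A (ℓ v) (ℓ w) = true ↔ G.Adj v w)) := by
  obtain ⟨C, hC, hlen⟩ := SPAL.length_bound t
  obtain ⟨f, A, hf1, hf2, hA⟩ := SPAL.universal t
  refine ⟨C, hC, A, ?_⟩
  intro n hn VH _ H hH h s hs hrow G hG
  obtain ⟨e, he⟩ := hH
  have hadj : ∀ x w, w ∈ (Set.toFinite {w | H.Adj x w ∧ e w < e x}).toFinset ↔
      H.Adj x w ∧ (e w : ℕ) < e x := by
    intro x w
    rw [Set.Finite.mem_toFinset]
    exact Iff.rfl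
  obtain ⟨zs, a, b, p, X, hz⟩ := SPAL.ctx_exists H t (Nat.clog 2 n) s
    (by rw [hs]; exact Nat.le_pow_clog (by norm_num) n) (fun v => (e v : ℕ))
    (fun u v huv => e.injective (Fin.ext huv))
    (fun x => (Set.toFinite {w | H.Adj x w ∧ e w < e x}).toFinset) hadj
    (fun g u w h1 h2 h3 h4 hne => (he g).1 ⟨h1, h3⟩ ⟨h2, h4⟩ hne)
    (fun x => by
      rw [← Set.ncard_eq_toFinset_card]
      exact (he x).2)
  obtain ⟨κ, A', dg, lev, idx, S⟩ := SPAL.scheme_exists X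
  obtain ⟨lab, hl1, hl2⟩ := SPAL.labels S X.zs0
    (fun v w => ∃ (hv : v ∈ s) (hw : w ∈ s), G.Adj ⟨v, hv⟩ ⟨w, hw⟩) (by
      rintro v w ⟨hv, hw, hvw⟩
      have hg := hG _ _ hvw
      refine ⟨⟨hw, hv, hvw.symm⟩, hv, hw, ?_, hg.2⟩
      rcases hg.1 with h1 | h1
      · exact Or.inl ((hz _ _).mpr (Or.inl h1.symm))
      · rcases lt_trichotomy (e w.1 : ℕ) (e v.1 : ℕ) with h2 | h2 | h2
        · exact Or.inl ((hz _ _).mpr (Or.inr ⟨h1, h2⟩))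
        · exact absurd (e.injective (Fin.ext h2)) h1.ne.symm
        · exact Or.inr ((hz _ _).mpr (Or.inr ⟨h1.symm, h2⟩)))
  refine ⟨fun v => f (Nat.clog 2 n) (lab v.1), ?_, ?_, ?_⟩
  · intro v w hvw
    exact Subtype.ext (hl1 v.1 v.2 w.1 w.2 (hf1 _ hvw))
  · intro v
    simp only [hf2]
    exact hlen n hn
  · intro v w _
    rw [hA, hl2 v.1 v.2 w.1 w.2]
    exact ⟨fun ⟨_, _, h⟩ => h, fun h => ⟨v.2, w.2, h⟩⟩
end
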